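/- Assume the partition setup for R, W, V_1, …, V_s, W_1, …, W_s, U_1, …, U_s, with integers t ≥ 2, k ≥ 3 and k ≤ s ≤ t+k. Let K = 2.4·10^7·(t+k)^5, let m be an even integer with m ≥ 1.728·10^10·(t+k)^9, suppose R contains no cycle of length m, suppose |V| ≤ (t+k)·m, and suppose 2·δ(R) > m + K + 2s. Then |U_i| ≤ m−1 for every 1 ≤ i ≤ s. -/

import Mathlib

/-- `G` contains a cycle of length `m`. -/
def HasCycleLen {V : Type*} (G : SimpleGraph V) (m : ℕ) : Prop :=
  ∃ (v : V) (c : G.Walk v v), c.IsCycle ∧ c.length = m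

/-- The subgraph of `R` induced by the finite vertex set `A` is 2-connected:
it has at least 3 vertices, is connected, and remains connected after deleting
any one vertex. -/
def TwoConnectedOn {V : Type*} [DecidableEq V] (R : SimpleGraph V) (A : Finset V) : Prop :=
  3 ≤ A.card ∧ (R.induce (A : Set V)).Connected ∧
    ∀ v ∈ A, (R.induce ((A.erase v : Finset V) : Set V)).Connected

/-- `W_i`: the vertices of `W` having at least `2s` neighbours (in `R`) inside `A`. -/
def bigNbrSet {V : Type*} [DecidableEq V] (R : SimpleGraph V) [DecidableRel R.Adj]
    (s : ℕ) (W A : Finset V) : Finset V :=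
  W.filter fun w => 2 * s ≤ (A.filter fun v => R.Adj w v).card



def HP {V : Type*} [DecidableEq V] (r : V → V → Prop) (S : Finset V) (n : ℕ) (a b : V) : Prop :=
  ∃ l : List V, l.Nodup ∧ l.IsChain r ∧ l.head? = some a ∧ l.getLast? = some b ∧
    l.toFinset = S ∧ l.length = n

section basics
variable {V : Type*} [DecidableEq V] {r : V → V → Prop}

theorem HP.card {S : Finset V} {n : ℕ} {a b : V} (h : HP r S n a b) : S.card = n := by
  obtain ⟨l, h1, -, -, -, rfl, rfl⟩ := h
  exact List.toFinset_card_of_nodup h1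

theorem HP.left {S : Finset V} {n : ℕ} {a b : V} (h : HP r S n a b) : a ∈ S := by
  obtain ⟨l, h1, -, h2, -, rfl, rfl⟩ := h
  exact List.mem_toFinset.2 (List.mem_of_head? h2)

theorem HP.right {S : Finset V} {n : ℕ} {a b : V} (h : HP r S n a b) : b ∈ S := by
  obtain ⟨l, h1, -, -, h2, rfl, rfl⟩ := h
  exact List.mem_toFinset.2 (List.mem_of_getLast? h2)

theorem HP.pos {S : Finset V} {n : ℕ} {a b : V} (h : HP r S n a b) : 1 ≤ n := by
  rw [← h.card]; exact Finset.card_pos.2 ⟨a, h.left⟩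

theorem hp_single (a : V) : HP r {a} 1 a a := ⟨[a], by simp⟩

theorem HP.symm (hr : ∀ x y, r x y → r y x) {S : Finset V} {n : ℕ} {a b : V}
    (h : HP r S n a b) : HP r S n b a := by
  obtain ⟨l, h1, h2, h3, h4, rfl, rfl⟩ := h
  refine ⟨l.reverse, List.nodup_reverse.2 h1, ?_, by simpa using h4, by simpa using h3, by simp, by simp⟩
  rw [List.isChain_reverse]
  exact h2.imp (fun a b => hr _ _)

theorem HP.append {S T : Finset V} {n m : ℕ} {a b c d : V} (h : HP r S n a b) (h' : HP r T m c d)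
    (hbc : r b c) (hd : Disjoint S T) : HP r (S ∪ T) (n + m) a d := by
  obtain ⟨l, h1, h2, h3, h4, rfl, rfl⟩ := h
  obtain ⟨l', h1', h2', h3', h4', rfl, rfl⟩ := h'
  refine ⟨l ++ l', ?_, ?_, ?_, ?_, by simp, by simp⟩
  · rw [List.nodup_append']
    refine ⟨h1, h1', ?_⟩
    rw [List.disjoint_iff_ne]
    intro x hx y hy hxy
    subst hxy
    exact Finset.disjoint_left.1 hd (List.mem_toFinset.2 hx) (List.mem_toFinset.2 hy)
  · rw [List.isChain_append]
    refine ⟨h2, h2', ?_⟩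
    intro x hx y hy
    rw [h4] at hx; rw [h3'] at hy
    simp at hx hy; subst hx; subst hy; exact hbc
  · rw [List.head?_append, h3]; rfl
  · rw [List.getLast?_append, h4']; rfl

theorem HP.tail {S : Finset V} {n : ℕ} {a b : V} (h : HP r S n a b) :
    (S = {a} ∧ a = b ∧ n = 1) ∨ ∃ c m, n = m + 1 ∧ r a c ∧ HP r (S.erase a) m c b := by
  obtain ⟨l, h1, h2, h3, h4, rfl, rfl⟩ := h
  match l, h1, h2, h3, h4 with
  | [x], _, _, h3, h4 => simp at h3 h4; left; simp [h3, ← h4]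
  | x :: y :: l, h1, h2, h3, h4 =>
    right
    simp only [List.head?_cons, Option.some.injEq] at h3
    subst h3
    refine ⟨y, (y :: l).length, by simp, ?_, y :: l, ?_, ?_, by simp, ?_, ?_, rfl⟩
    · exact (List.isChain_cons_cons.1 h2).1
    · exact (List.nodup_cons.1 h1).2
    · exact (List.isChain_cons_cons.1 h2).2
    · simpa [List.getLast?_cons_cons] using h4
    · rw [List.toFinset_cons (a := x), Finset.erase_insert]
      simpa using (List.nodup_cons.1 h1).1

theorem HP.cons {S : Finset V} {n : ℕ} {a b c : V} (h : HP r S n a b) (hc : r c a) (hcS : c ∉ S) :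
    HP r (insert c S) (n + 1) c b := by
  have := (hp_single (r := r) c).append h hc (by simpa using hcS)
  rw [Nat.add_comm]; simpa using this

theorem HP.snoc {S : Finset V} {n : ℕ} {a b c : V} (h : HP r S n a b) (hc : r b c) (hcS : c ∉ S) :
    HP r (insert c S) (n + 1) a c := by
  have := h.append (hp_single (r := r) c) hc (by simpa using hcS)
  simpa [Finset.union_comm] using this

theorem HP.eq_of_one {S : Finset V} {a b : V} (h : HP r S 1 a b) : a = b := by
  rcases h.tail with h1 | ⟨c, m, hm, _, h2⟩
  · exact h1.2.1
  · have := h2.pos; omega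

theorem HP.ne {S : Finset V} {n : ℕ} {a b : V} (h : HP r S n a b) (hn : 2 ≤ n) : a ≠ b := by
  rintro rfl
  rcases h.tail with h1 | ⟨c, m, hm, _, h2⟩
  · omega
  · have := h2.right; simp at this

/-- concatenation at a shared vertex -/
theorem HP.trans {S T : Finset V} {n m : ℕ} {a b c : V} (h : HP r S n a b) (h' : HP r T m b c)
    (hd : S ∩ T ⊆ {b}) : HP r (S ∪ T) (n + m - 1) a c := by
  rcases h'.tail with ⟨h1, rfl, rfl⟩ | ⟨d, k, rfl, hbd, h2⟩
  · have : S ∪ T = S := by rw [h1]; simpa using h.right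
    rw [this]; exact h
  · have := h.append h2 hbd ?_
    · have e : S ∪ T.erase b = S ∪ T := by
        ext x; simp; 
        constructor
        · tauto
        · rintro (h3 | h3)
          · exact Or.inl h3
          · by_cases hx : x = b
            · subst hx; exact Or.inl h.right
            · exact Or.inr ⟨hx, h3⟩
      rw [e] at this; exact this
    · rw [Finset.disjoint_left]
      intro x hx hx'
      rw [Finset.mem_erase] at hx'
      have := hd (Finset.mem_inter.2 ⟨hx, hx'.2⟩)
      simp at this; exact hx'.1 this

theorem HP.firsthit {S : Finset V} {n : ℕ} {a b : V} (h : HP r S n a b) (T : Finset V) (hb : b ∈ T) :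
    ∃ S' n' b', S' ⊆ S ∧ b' ∈ T ∧ HP r S' n' a b' ∧ S' ∩ T = {b'} := by
  induction n generalizing S a with
  | zero => have := h.pos; omega
  | succ n ih =>
    by_cases ha : a ∈ T
    · exact ⟨{a}, 1, a, by simpa using h.left, ha, hp_single a, by simpa using ha⟩
    · rcases h.tail with ⟨h1, rfl, h3⟩ | ⟨c, m, hm, hac, h2⟩
      · exact absurd hb ha
      · have : m = n := by omega
        subst this
        obtain ⟨S', n', b', h4, h5, h6, h7⟩ := ih h2
        refine ⟨insert a S', n' + 1, b', ?_, h5, h6.cons hac (fun h => by simpa using h4 h), ?_⟩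
        · rw [Finset.insert_subset_iff]
          exact ⟨h.left, h4.trans (Finset.erase_subset _ _)⟩
        · rw [Finset.insert_inter_of_notMem ha, h7]

theorem HP.split {S : Finset V} {n : ℕ} {a b c : V} (h : HP r S n a b) (hc : c ∈ S) :
    ∃ S1 n1 S2 n2, HP r S1 n1 a c ∧ HP r S2 n2 c b ∧ S1 ∩ S2 = {c} ∧ S1 ∪ S2 = S ∧ n1 + n2 = n + 1 := by
  induction n generalizing S a with
  | zero => have := h.pos; omega
  | succ n ih =>
    by_cases hac : c = a
    · subst hac
      refine ⟨{c}, 1, S, n + 1, hp_single c, h, ?_, ?_, by omega⟩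
      · simpa using hc
      · simpa using hc
    · rcases h.tail with ⟨h1, rfl, h3⟩ | ⟨d, m, hm, had, h2⟩
      · rw [h1] at hc; simp at hc; exact absurd hc hac
      · have : m = n := by omega
        subst this
        obtain ⟨S1, n1, S2, n2, h4, h5, h6, h7, h8⟩ := ih h2 (Finset.mem_erase.2 ⟨hac, hc⟩)
        have ha1 : a ∉ S1 := fun hx => by
          have := Finset.mem_union_left S2 hx
          rw [h7] at this; simp at this
        have ha2 : a ∉ S2 := fun hx => by
          have := Finset.mem_union_right S1 hx
          rw [h7] at this; simp at this
        refine ⟨insert a S1, n1 + 1, S2, n2, h4.cons had ha1, h5, ?_, ?_, by omega⟩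
        · rw [Finset.insert_inter_of_notMem ha2, h6]
        · rw [Finset.insert_union, h7, Finset.insert_erase h.left]

theorem HP.map {U : Type*} [DecidableEq U] {r' : U → U → Prop} {S : Finset U} {n : ℕ} {a b : U}
    (h : HP r' S n a b) (f : U → V) (hinj : Set.InjOn f S)
    (hr : ∀ x ∈ S, ∀ y ∈ S, r' x y → r (f x) (f y)) : HP r (S.image f) n (f a) (f b) := by
  obtain ⟨l, h1, h2, h3, h4, rfl, rfl⟩ := h
  refine ⟨l.map f, ?_, ?_, by simp [h3], by simp [h4], by ext; simp, by simp⟩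
  · refine List.Nodup.map_on ?_ h1
    intro x hx y hy hxy
    exact hinj (by simpa using hx) (by simpa using hy) hxy
  · rw [List.isChain_map]
    have hl : ∀ x ∈ l, x ∈ l.toFinset := fun x hx => by simpa using hx
    clear h1 h3 h4 hinj
    generalize l.toFinset = S at *
    induction l with
    | nil => simp
    | cons x l ih =>
      cases l with
      | nil => simp
      | cons y l =>
        rw [List.isChain_cons_cons] at h2 ⊢
        exact ⟨hr _ (hl _ (by simp)) _ (hl _ (by simp)) h2.1,
          ih h2.2 (fun z hz => hl z (List.mem_cons_of_mem _ hz))⟩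

/-- index-level segment -/
theorem hp_up {r : ℕ → ℕ → Prop} {a b : ℕ} (hab : a ≤ b) (hr : ∀ i, a ≤ i → i < b → r i (i + 1)) :
    HP r (Finset.Icc a b) (b + 1 - a) a b := by
  induction b, hab using Nat.le_induction with
  | base => simpa using hp_single (r := r) a
  | succ b hab ih =>
    have := (ih (fun i h1 h2 => hr i h1 (by omega))).snoc (hr b hab (by omega)) (by simp)
    have e : insert (b + 1) (Finset.Icc a b) = Finset.Icc a (b + 1) := by
      ext x; simp; omega
    rw [e] at this
    convert this using 1; omega

def IsP (r : V → V → Prop) (y : ℕ → V) (p : ℕ) : Prop :=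
  (∀ i, i ≤ p → ∀ j, j ≤ p → y i = y j → i = j) ∧ ∀ i, i < p → r (y i) (y (i + 1))

theorem HP.toFun {S : Finset V} {n : ℕ} {a b : V} (h : HP r S n a b) :
    ∃ y : ℕ → V, IsP r y (n - 1) ∧ y 0 = a ∧ y (n - 1) = b ∧ S = (Finset.range n).image y := by
  have hn := h.pos
  obtain ⟨l, h1, h2, h3, h4, rfl, rfl⟩ := h
  refine ⟨fun i => l.getD i a, ⟨?_, ?_⟩, ?_, ?_, ?_⟩
  · intro i hi j hj hij
    have hi' : i < l.length := by omega
    have hj' : j < l.length := by omega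
    simp only [List.getD_eq_getElem _ _ hi', List.getD_eq_getElem _ _ hj'] at hij
    exact (List.Nodup.getElem_inj_iff h1).1 hij
  · intro i hi
    have hi' : i < l.length := by omega
    have hj' : i + 1 < l.length := by omega
    simp only [List.getD_eq_getElem _ _ hi', List.getD_eq_getElem _ _ hj']
    exact List.isChain_iff_getElem.1 h2 i (by omega)
  · cases l with
    | nil => simp at hn
    | cons x l => simpa using h3
  · have hi' : l.length - 1 < l.length := by omega
    simp only [List.getD_eq_getElem _ _ hi']
    rw [List.getLast?_eq_getElem?, List.getElem?_eq_getElem hi'] at h4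
    simpa using h4
  · ext x
    simp only [List.mem_toFinset, Finset.mem_image, Finset.mem_range]
    constructor
    · intro hx
      obtain ⟨i, hi, rfl⟩ := List.mem_iff_getElem.1 hx
      exact ⟨i, hi, List.getD_eq_getElem _ _ hi⟩
    · rintro ⟨i, hi, rfl⟩
      rw [List.getD_eq_getElem _ _ hi]
      exact List.getElem_mem hi

/-- transport an index path to the graph -/
theorem IsP.map {y : ℕ → V} {p : ℕ} (hy : IsP r y p) {S : Finset ℕ} {n a b : ℕ}
    (h : HP (fun i j => r (y i) (y j)) S n a b) (hS : ∀ i ∈ S, i ≤ p) :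
    HP r (S.image y) n (y a) (y b) :=
  h.map y (fun i hi j hj hij => hy.1 i (hS i hi) j (hS j hj) hij) (fun _ _ _ _ h => h)

theorem IsP.up {y : ℕ → V} {p : ℕ} (hy : IsP r y p) {a b : ℕ} (hab : a ≤ b) (hb : b ≤ p) :
    HP (fun i j => r (y i) (y j)) (Finset.Icc a b) (b + 1 - a) a b :=
  hp_up hab (fun i _ h2 => hy.2 i (by omega))

theorem IsP.down (hr : ∀ x y, r x y → r y x) {y : ℕ → V} {p : ℕ} (hy : IsP r y p) {a b : ℕ} (hab : a ≤ b) (hb : b ≤ p) :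
    HP (fun i j => r (y i) (y j)) (Finset.Icc a b) (b + 1 - a) b a :=
  (hy.up hab hb).symm (fun _ _ h => hr _ _ h)

theorem IsP.comp {y : ℕ → V} {p : ℕ} (hy : IsP r y p) (σ : ℕ → ℕ) (h1 : ∀ i, i ≤ p → σ i ≤ p)
    (h2 : ∀ i, i ≤ p → ∀ j, j ≤ p → σ i = σ j → i = j)
    (h3 : ∀ i, i < p → r (y (σ i)) (y (σ (i + 1)))) : IsP r (fun i => y (σ i)) p :=
  ⟨fun i hi j hj hij => h2 i hi j hj (hy.1 _ (h1 i hi) _ (h1 j hj) hij), h3⟩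

/-- closure of the set reachable inside `X` -/
theorem HP.reach {X S : Finset V} {n : ℕ} {a b c : V}
    (h : HP r S n a b) (hS : S ⊆ X) (hc : c ∈ X) (hbc : r b c) :
    ∃ S' n', S' ⊆ X ∧ HP r S' n' a c := by
  by_cases hcS : c ∈ S
  · obtain ⟨S1, n1, S2, n2, h1, h2, h3, h4, h5⟩ := h.split hcS
    exact ⟨S1, n1, (by rw [← h4] at hS; exact (Finset.subset_union_left).trans hS), h1⟩
  · exact ⟨_, _, Finset.insert_subset hc hS, h.snoc hbc hcS⟩

end basics

def HasCyc {V : Type*} [DecidableEq V] (r : V → V → Prop) (n : ℕ) : Prop :=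
  ∃ S a b, HP r S n a b ∧ r b a

theorem hasCyc_of_two {V : Type*} [DecidableEq V] {r : V → V → Prop} {S T : Finset V} {n m : ℕ} {a b : V}
    (hr : ∀ x y, r x y → r y x)
    (h : HP r S n a b) (h' : HP r T m a b) (hd : S ∩ T ⊆ {a, b}) (hab : a ≠ b) :
    HasCyc r (n + m - 2) := by
  rcases h'.tail with h1 | ⟨c, k, rfl, hac, h2⟩
  · exact absurd h1.2.1 hab
  · have h3 := (h2.symm hr)
    have h4 := h.trans h3 (by
      intro x hx
      simp only [Finset.mem_inter, Finset.mem_erase] at hx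
      have := hd (Finset.mem_inter.2 ⟨hx.1, hx.2.2⟩)
      simp at this ⊢; tauto)
    have e : n + (k + 1) - 2 = n + k - 1 := by omega
    rw [e]
    exact ⟨_, a, c, h4, hr _ _ hac⟩


theorem nocons {A : Finset ℕ} {lo hi : ℕ} (h : ∀ a ∈ A, lo ≤ a ∧ a ≤ hi) (h2 : ∀ a ∈ A, a + 1 ∉ A) :
    2 * A.card ≤ hi + 2 - lo := by
  have hd : Disjoint A (A.image (· + 1)) := by
    rw [Finset.disjoint_left]
    intro x hx hx'
    obtain ⟨z, hz, rfl⟩ := Finset.mem_image.1 hx'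
    exact h2 z hz hx
  have hc : (A.image (· + 1)).card = A.card := Finset.card_image_of_injective _ (fun a b => by simp)
  have hs : A ∪ A.image (· + 1) ⊆ Finset.Icc lo (hi + 1) := by
    intro x hx
    simp only [Finset.mem_union, Finset.mem_image] at hx
    rw [Finset.mem_Icc]
    rcases hx with hx | ⟨z, hz, rfl⟩
    · have := h x hx; omega
    · have := h z hz; omega
  have := Finset.card_le_card hs
  rw [Finset.card_union_of_disjoint hd, hc, Nat.card_Icc] at this
  omega

theorem exists_max_nat {P : ℕ → Prop} (B : ℕ) (h : ∃ x, P x) (hB : ∀ x, P x → x ≤ B) :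
    ∃ x, P x ∧ ∀ z, P z → z ≤ x := by
  classical
  obtain ⟨x, hx⟩ := h
  exact ⟨Nat.findGreatest P B, Nat.findGreatest_spec (hB x hx) hx, fun z hz => Nat.le_findGreatest (hB z hz) hz⟩

theorem exists_min_nat {P : ℕ → Prop} (h : ∃ x, P x) :
    ∃ x, P x ∧ ∀ z, P z → x ≤ z := by
  classical
  exact ⟨Nat.find h, Nat.find_spec h, fun z hz => Nat.find_min' h hz⟩

section
variable {V : Type*} [DecidableEq V] (G : SimpleGraph V) [DecidableRel G.Adj]

def MP (X : Finset V) (q : V) (p : ℕ) (y : ℕ → V) : Prop :=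
  IsP G.Adj y p ∧ (∀ i, i ≤ p → y i ∈ X) ∧ y p = q

variable {G}

theorem MP.nbr {X : Finset V} {q : V} {p : ℕ} {y : ℕ → V} (h : MP G X q p y)
    (hmax : ∀ y, ¬ MP G X q (p + 1) y) {v : V} (hv : v ∈ X) (ha : G.Adj (y 0) v) :
    ∃ j, 1 ≤ j ∧ j ≤ p ∧ v = y j := by
  by_contra hcon
  push Not at hcon
  have hne : ∀ j, j ≤ p → v ≠ y j := by
    intro j hj
    rcases Nat.eq_zero_or_pos j with rfl | h0
    · exact (G.ne_of_adj ha).symm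
    · exact hcon j h0 hj
  refine hmax (fun j => if j = 0 then v else y (j - 1)) ⟨⟨?_, ?_⟩, ?_, ?_⟩
  · intro i hi j hj hij
    dsimp at hij
    split_ifs at hij with h1 h2 h2
    · omega
    · exact absurd hij (hne _ (by omega))
    · exact absurd hij.symm (hne _ (by omega))
    · have := h.1.1 _ (by omega) _ (by omega) hij; omega
  · intro i hi
    dsimp
    split_ifs with h1
    · simpa [h1] using ha.symm
    · have := h.1.2 (i - 1) (by omega)
      have e : i - 1 + 1 = i := by omega
      rw [e] at this; simpa using this
  · intro i hi
    dsimp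
    split_ifs with h1
    · exact hv
    · exact h.2.1 _ (by omega)
  · simpa using h.2.2

theorem MP.count {X : Finset V} {q : V} {p d : ℕ} {y : ℕ → V} (h : MP G X q p y)
    (hmax : ∀ y, ¬ MP G X q (p + 1) y) (hd : d ≤ (X.filter (G.Adj (y 0))).card) :
    d ≤ ((Finset.Icc 1 p).filter (fun j => G.Adj (y 0) (y j))).card := by
  refine hd.trans ((Finset.card_le_card (t := ((Finset.Icc 1 p).filter (fun j => G.Adj (y 0) (y j))).image y) ?_).trans Finset.card_image_le)
  intro v hv
  rw [Finset.mem_filter] at hv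
  obtain ⟨j, h1, h2, rfl⟩ := h.nbr hmax hv.1 hv.2
  exact Finset.mem_image.2 ⟨j, by simp [h1, h2, hv.2], rfl⟩

theorem lemmaA {X : Finset V} {q : V} {p d : ℕ} (hd3 : 3 ≤ d) (hp : 1 ≤ p)
    (hex : ∃ y, MP G X q p y)
    (hmax : ∀ y, ¬ MP G X q (p + 1) y)
    (hdeg : ∀ y, MP G X q p y → d ≤ (X.filter (G.Adj (y 0))).card)
    (hcyc : ∀ n, Even n → 2 * d - 2 ≤ n → ∀ S ⊆ X, ∀ a b, HP G.Adj S n a b → ¬ G.Adj b a) :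
    ∃ y i r, MP G X q p y ∧ 1 ≤ i ∧ i + 1 ≤ r ∧ r ≤ p ∧ G.Adj (y 0) (y i) ∧ G.Adj (y 0) (y (i + 1)) ∧
      G.Adj (y 1) (y r) ∧ ∀ v ∈ X, G.Adj (y 1) v → v = y 0 ∨ ∃ j, 2 ≤ j ∧ j ≤ r ∧ v = y j := by
  by_contra hcon
  have tog : ∀ i, ∀ y, MP G X q p y → 1 ≤ i → i + 1 ≤ p → G.Adj (y 0) (y i) → G.Adj (y 0) (y (i + 1)) →
      2 * d - 2 ≤ i := by
    intro i
    induction i using Nat.strong_induction_on with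
    | _ i ih =>
    intro y hy hi1 hip ha hb
    set σ : ℕ → ℕ := fun j => if j < i then j + 1 else if j = i then 0 else j with hσ
    have hw : MP G X q p (fun j => y (σ j)) := by
      refine ⟨hy.1.comp σ ?_ ?_ ?_, ?_, ?_⟩
      · intro j hj; simp only [hσ]; split_ifs <;> omega
      · intro j hj k hk hjk; simp only [hσ] at hjk; split_ifs at hjk <;> omega
      · intro j hj
        simp only [hσ]
        rcases lt_trichotomy (j + 1) i with h1 | h1 | h1
        · rw [if_pos (by omega), if_pos h1]; exact hy.1.2 _ (by omega)
        · rw [if_pos (by omega), if_neg (by omega), if_pos h1, h1]; exact ha.symm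
        · rw [if_neg (by omega), if_neg (by omega : ¬ (j + 1 < i)), if_neg (by omega : ¬ (j + 1 = i))]
          split_ifs with h2
          · rw [h2]; exact hb
          · exact hy.1.2 _ hj
      · intro j hj; apply hy.2.1; simp only [hσ]; split_ifs <;> omega
      · have : σ p = p := by simp only [hσ]; split_ifs <;> omega
        simp only [this]; exact hy.2.2
    have hσ0 : σ 0 = 1 := by simp only [hσ]; rw [if_pos (by omega)]
    have hn1 : ∀ v ∈ X, G.Adj (y 1) v → v = y 0 ∨ ∃ j, 2 ≤ j ∧ j ≤ p ∧ v = y j := by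
      intro v hv hav
      obtain ⟨j, h1, h2, h3⟩ := hw.nbr hmax hv (by simpa [hσ0] using hav)
      rw [h3]
      simp only [hσ]
      split_ifs with h4 h5
      · exact Or.inr ⟨j + 1, by omega, by omega, rfl⟩
      · exact Or.inl rfl
      · exact Or.inr ⟨j, by omega, by omega, rfl⟩
    -- all neighbours of y1 at index at most i
    have hle : ∀ j, 2 ≤ j → j ≤ p → G.Adj (y 1) (y j) → j ≤ i := by
      by_contra hne
      push Not at hne
      obtain ⟨j0, h1, h2, h3, h4⟩ := hne
      obtain ⟨r, hr, hrm⟩ := exists_max_nat (P := fun j => 2 ≤ j ∧ j ≤ p ∧ G.Adj (y 1) (y j)) p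
        ⟨j0, h1, h2, h3⟩ (fun x hx => hx.2.1)
      have := hrm j0 ⟨h1, h2, h3⟩
      refine hcon ⟨y, i, r, hy, hi1, by omega, hr.2.1, ha, hb, hr.2.2, ?_⟩
      intro v hv hav
      rcases hn1 v hv hav with h | ⟨j, h5, h6, rfl⟩
      · exact Or.inl h
      · exact Or.inr ⟨j, h5, hrm j ⟨h5, h6, hav⟩, rfl⟩
    by_cases hc : ∃ j, 2 ≤ j ∧ j + 1 ≤ i ∧ G.Adj (y 1) (y j) ∧ G.Adj (y 1) (y (j + 1))
    · obtain ⟨j, h1, h2, h3, h4⟩ := hc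
      have := ih (j - 1) (by omega) _ hw (by omega) (by omega) ?_ ?_
      · omega
      · have e : σ (j - 1) = j := by simp only [hσ]; rw [if_pos (by omega)]; omega
        simpa [hσ0, e] using h3
      · have e : σ (j - 1 + 1) = j + 1 := by simp only [hσ]; rw [if_pos (by omega)]; omega
        simp only [hσ0, e]; exact h4
    · push Not at hc
      set A := (Finset.Icc 2 i).filter (fun j => G.Adj (y 1) (y j)) with hA
      have h1 : 2 * A.card ≤ i + 2 - 2 := by
        apply nocons
        · intro a ha; simp [hA] at ha; omega
        · intro a ha ha'
          simp [hA] at ha ha'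
          exact hc a (by omega) (by omega) ha.2 ha'.2
      have h2 : d ≤ (insert (y 0) (A.image y)).card := by
        refine (hdeg _ hw).trans (Finset.card_le_card ?_)
        intro v hv
        simp only [Finset.mem_filter, hσ0] at hv
        rcases hn1 v hv.1 hv.2 with h | ⟨j, h5, h6, rfl⟩
        · simp [h]
        · exact Finset.mem_insert_of_mem (Finset.mem_image_of_mem _ (by
            simp only [hA, Finset.mem_filter, Finset.mem_Icc]
            exact ⟨⟨h5, hle j h5 h6 hv.2⟩, hv.2⟩))
      have h3 := Finset.card_insert_le (y 0) (A.image y)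
      have h4 := Finset.card_image_le (s := A) (f := y)
      omega
  obtain ⟨y0, hy0⟩ := hex
  obtain ⟨o, ⟨hodd, hop, y, hy, hyo⟩, homax⟩ := exists_max_nat
    (P := fun o => Odd o ∧ o ≤ p ∧ ∃ y, MP G X q p y ∧ G.Adj (y 0) (y o)) p
    ⟨1, odd_one, hp, y0, hy0, hy0.1.2 0 (by omega)⟩ (fun x hx => hx.2.1)
  rw [Nat.odd_iff] at hodd
  have himg : ∀ y, MP G X q p y → ∀ T : Finset ℕ, (∀ i ∈ T, i ≤ p) → T.image y ⊆ X := by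
    intro y hy T hT v hv
    obtain ⟨i, hi, rfl⟩ := Finset.mem_image.1 hv
    exact hy.2.1 i (hT i hi)
  have hsmall : o + 1 < 2 * d - 2 := by
    by_contra hlt
    have h1 := hy.1.up (Nat.zero_le o) hop
    have h2 := hy.1.map h1 (by intro i hi; simp at hi; omega)
    exact hcyc _ (by rw [Nat.even_iff]; omega) (by omega) _ (himg y hy _ (by intro i hi; simp at hi; omega)) _ _ h2 hyo.symm
  have far : ∀ y, MP G X q p y → ∃ e M, o < e ∧ e ≤ M ∧ M ≤ p ∧ e % 2 = 0 ∧ M % 2 = 0 ∧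
      G.Adj (y 0) (y e) ∧ G.Adj (y 0) (y M) ∧ 2 * d - (o + 1) ≤ M + 2 - e := by
    intro y hy
    set N := (Finset.Icc 1 p).filter (fun j => G.Adj (y 0) (y j)) with hN
    have hNc : d ≤ N.card := hy.count hmax (hdeg y hy)
    set A := N.filter (fun j => j ≤ o)
    set B := N.filter (fun j => ¬ j ≤ o) with hB
    have hAB : A.card + B.card = N.card := Finset.card_filter_add_card_filter_not _
    have hAc : 2 * A.card ≤ o + 2 - 1 := by
      apply nocons
      · intro a ha; simp [A, hN] at ha; omega
      · intro a ha ha'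
        simp [A, hN] at ha ha'
        have := tog a y hy (by omega) (by omega) ha.1.2 ha'.1.2
        omega
    have hBe : ∀ j ∈ B, o < j ∧ j ≤ p ∧ j % 2 = 0 ∧ G.Adj (y 0) (y j) := by
      intro j hj
      simp [hB, hN] at hj
      refine ⟨hj.2, hj.1.1.2, ?_, hj.1.2⟩
      by_contra hh
      have := homax j ⟨Nat.odd_iff.2 (by omega), hj.1.1.2, y, hy, hj.1.2⟩
      omega
    have hBn : B.Nonempty := by
      rw [← Finset.card_pos]; omega
    have h1 := hBe _ (B.min'_mem hBn)
    have h2 := hBe _ (B.max'_mem hBn)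
    have h3 : 2 * B.card ≤ B.max' hBn + 2 - B.min' hBn := by
      apply nocons
      · intro a ha; exact ⟨B.min'_le a ha, B.le_max' a ha⟩
      · intro a ha ha'
        have := (hBe _ ha).2.2.1
        have := (hBe _ ha').2.2.1
        omega
    exact ⟨B.min' hBn, B.max' hBn, h1.1, B.min'_le _ (B.max'_mem hBn), h2.2.1, h1.2.2.1, h2.2.2.1, h1.2.2.2, h2.2.2.2, by omega⟩
  obtain ⟨eu, Mu, hu1, hu2, hu3, hu4, hu5, hu6, hu7, hu8⟩ := far y hy
  set σ : ℕ → ℕ := fun j => if j < o then o - 1 - j else j with hσ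
  have hw : MP G X q p (fun j => y (σ j)) := by
    refine ⟨hy.1.comp σ ?_ ?_ ?_, ?_, ?_⟩
    · intro j hj; simp only [hσ]; split_ifs <;> omega
    · intro j hj k hk hjk; simp only [hσ] at hjk; split_ifs at hjk <;> omega
    · intro j hj
      simp only [hσ]
      rcases lt_trichotomy (j + 1) o with h1 | h1 | h1
      · rw [if_pos (by omega), if_pos h1]
        have := hy.1.2 (o - 1 - (j + 1)) (by omega)
        have e : o - 1 - (j + 1) + 1 = o - 1 - j := by omega
        rw [e] at this; exact this.symm
      · rw [if_pos (by omega), if_neg (by omega), h1]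
        have e : o - 1 - j = 0 := by omega
        rw [e]; exact hyo
      · rw [if_neg (by omega), if_neg (by omega)]
        exact hy.1.2 _ hj
    · intro j hj; apply hy.2.1; simp only [hσ]; split_ifs <;> omega
    · have : σ p = p := by simp only [hσ]; split_ifs <;> omega
      simp only [this]; exact hy.2.2
  have hσ0 : σ 0 = o - 1 := by simp only [hσ]; rw [if_pos (by omega)]; omega
  have hσb : ∀ j, o < j → σ j = j := by intro j hj; simp only [hσ]; rw [if_neg (by omega)]
  obtain ⟨ev, Mv, hv1, hv2, hv3, hv4, hv5, hv6, hv7, hv8⟩ := far _ hw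
  simp only [hσ0, hσb ev hv1, hσb Mv (by omega)] at hv6 hv7
  rcases le_total (2 * d + eu) (Mv + o + 3) with hcase | hcase
  · have h1 := (hy.1.down (fun _ _ h => h.symm) (Nat.zero_le (o - 1)) (by omega)).append
      (hy.1.up (show eu ≤ Mv by omega) hv3) hu6 (by
        rw [Finset.disjoint_left]; intro x hx hx'; simp at hx hx'; omega)
    have h2 := hy.1.map h1 (by intro i hi; simp at hi; omega)
    exact hcyc _ (by rw [Nat.even_iff]; omega) (by omega) _ (himg y hy _ (by intro i hi; simp at hi; omega)) _ _ h2 hv7.symm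
  · have h1 := (hy.1.up (Nat.zero_le (o - 1)) (by omega)).append
      (hy.1.up (show ev ≤ Mu by omega) hu3) hv6 (by
        rw [Finset.disjoint_left]; intro x hx hx'; simp at hx hx'; omega)
    have h2 := hy.1.map h1 (by intro i hi; simp at hi; omega)
    exact hcyc _ (by rw [Nat.even_iff]; omega) (by omega) _ (himg y hy _ (by intro i hi; simp at hi; omega)) _ _ h2 hu7.symm

end

theorem lemmaB {ρ : ℕ → ℕ → Prop} [DecidableRel ρ] (hρ : ∀ a b, ρ a b → ρ b a) {i r : ℕ} (hi : 1 ≤ i) (hir : i + 1 ≤ r)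
    (hs : ∀ j, j < r → ρ j (j + 1)) (h0i : ρ 0 i) (h0i1 : ρ 0 (i + 1)) (h1r : ρ 1 r) :
    ∃ x, (x = 0 ∨ x = i) ∧ ∀ a, a < r → a ≠ x → ∀ c, c < 2 → ∃ T n, (∀ j ∈ T, j ≤ r) ∧ HP ρ T n a r ∧ n % 2 = c ∧
      ((Finset.Icc 2 r).filter (ρ 1)).card ≤ n + 1 := by
  have up : ∀ a b, a ≤ b → b ≤ r → HP ρ (Finset.Icc a b) (b + 1 - a) a b := fun a b hab hb =>
    hp_up hab (fun j h1 h2 => hs j (by omega))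
  have dn : ∀ a b, a ≤ b → b ≤ r → HP ρ (Finset.Icc a b) (b + 1 - a) b a := fun a b hab hb =>
    (up a b hab hb).symm hρ
  have size : ∀ T n a b z, HP ρ T n a b → (∀ j, 2 ≤ j → j ≤ r → ρ 1 j → j = z ∨ j ∈ T) →
      ((Finset.Icc 2 r).filter (ρ 1)).card ≤ n + 1 := by
    intro T n a b z h1 h2
    rw [← h1.card]
    refine (Finset.card_le_card ?_).trans (Finset.card_insert_le z T)
    intro j hj
    simp at hj
    simpa using h2 j (by omega) (by omega) hj.2
  -- finishing with both parities
  have fin : ∀ a c, c < 2 → ∀ T n T' n', (∀ j ∈ T, j ≤ r) → (∀ j ∈ T', j ≤ r) → HP ρ T n a r → HP ρ T' n' a r → 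
      (n' + n) % 2 = 1 → (∀ j, 2 ≤ j → j ≤ r → ρ 1 j → j = i + 1 ∨ j ∈ T) → (∀ j, 2 ≤ j → j ≤ r → ρ 1 j → j = i + 1 ∨ j ∈ T') →
      ∃ T n, (∀ j ∈ T, j ≤ r) ∧ HP ρ T n a r ∧ n % 2 = c ∧ ((Finset.Icc 2 r).filter (ρ 1)).card ≤ n + 1 := by
    intro a c hc T n T' n' hT hT' h1 h2 hn h3 h4
    by_cases hpar : n % 2 = c
    · exact ⟨T, n, hT, h1, hpar, size _ _ _ _ _ h1 h3⟩
    · exact ⟨T', n', hT', h2, by omega, size _ _ _ _ _ h2 h4⟩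
  have main : ∀ a, 1 ≤ a → a < r → (a = i → r = i + 1) → ∀ c, c < 2 → ∃ T n, (∀ j ∈ T, j ≤ r) ∧ HP ρ T n a r ∧ n % 2 = c ∧
      ((Finset.Icc 2 r).filter (ρ 1)).card ≤ n + 1 := by
    intro a ha har hai c hc
    obtain ⟨k, ⟨hk1, hk2⟩, hk3⟩ := exists_min_nat (P := fun k => a < k ∧ ρ 1 k) ⟨r, har, h1r⟩
    have hkr : k ≤ r := hk3 r ⟨har, h1r⟩
    have hk3' : ∀ j, ρ 1 j → j ≤ a ∨ k ≤ j := fun j hj => by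
      by_contra hh; push Not at hh; have := hk3 j ⟨hh.1, hj⟩; omega
    have base := (dn 1 a ha (by omega)).append (up k r hkr le_rfl) hk2 (by
      rw [Finset.disjoint_left]; intro x hx hx'; simp at hx hx'; omega)
    rcases lt_trichotomy a i with h1 | h1 | h1
    · by_cases h2 : i < k
      · have p1 := ((dn 1 a ha (by omega)).snoc (hρ _ _ (hs 0 (by omega))) (by simp)).append (up (i+1) r hir le_rfl) h0i1 (by
          rw [Finset.disjoint_left]; intro x hx hx'; simp at hx hx'; omega)
        have p2 := ((dn 1 a ha (by omega)).snoc (hρ _ _ (hs 0 (by omega))) (by simp)).append (up i r (by omega) le_rfl) h0i (by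
          rw [Finset.disjoint_left]; intro x hx hx'; simp at hx hx'; omega)
        refine fin a c hc _ _ _ _ ?_ ?_ p1 p2 (by omega) ?_ ?_
        · intro j hj; simp at hj; omega
        · intro j hj; simp at hj; omega
        · intro j h3 h4 h5; have := hk3' j h5; simp; omega
        · intro j h3 h4 h5; have := hk3' j h5; simp; omega
      · have p1 := ((dn 1 a ha (by omega)).append (up k i (by omega) (by omega)) hk2 (by
          rw [Finset.disjoint_left]; intro x hx hx'; simp at hx hx'; omega)).snoc (hρ _ _ h0i) (by simp; omega)
        have p2 := p1.append (up (i+1) r hir le_rfl) h0i1 (by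
          rw [Finset.disjoint_left]; intro x hx hx'; simp at hx hx'; omega)
        refine fin a c hc _ _ _ _ ?_ ?_ base p2 (by omega) ?_ ?_
        · intro j hj; simp at hj; omega
        · intro j hj; simp at hj; omega
        · intro j h3 h4 h5; have := hk3' j h5; simp; omega
        · intro j h3 h4 h5; have := hk3' j h5; simp; omega
    · have hr := hai h1
      have hkr' : k = r := by omega
      have p2 := ((dn 1 a ha (by omega)).snoc (hρ _ _ (hs 0 (by omega))) (by simp)).append (up (i+1) r hir le_rfl) h0i1 (by
          rw [Finset.disjoint_left]; intro x hx hx'; simp at hx hx'; omega)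
      refine fin a c hc _ _ _ _ ?_ ?_ base p2 (by omega) ?_ ?_
      · intro j hj; simp at hj; omega
      · intro j hj; simp at hj; omega
      · intro j h3 h4 h5; have := hk3' j h5; simp; omega
      · intro j h3 h4 h5; have := hk3' j h5; simp; omega
    · have p1 := ((dn (i+1) a (by omega) (by omega)).snoc (hρ _ _ h0i1) (by simp)).append (dn 1 i hi (by omega)) h0i (by
          rw [Finset.disjoint_left]; intro x hx hx'; simp at hx hx'; omega)
      have p2 := p1.append (up k r (by omega) le_rfl) hk2 (by
          rw [Finset.disjoint_left]; intro x hx hx'; simp at hx hx'; omega)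
      refine fin a c hc _ _ _ _ ?_ ?_ base p2 (by omega) ?_ ?_
      · intro j hj; simp at hj; omega
      · intro j hj; simp at hj; omega
      · intro j h3 h4 h5; have := hk3' j h5; simp; omega
      · intro j h3 h4 h5; have := hk3' j h5; simp; omega
  by_cases hri : r = i + 1
  · refine ⟨0, Or.inl rfl, fun a har ha c hc => main a (by omega) har (fun _ => hri) c hc⟩
  · refine ⟨i, Or.inr rfl, fun a har ha c hc => ?_⟩
    rcases Nat.eq_zero_or_pos a with rfl | ha0
    · obtain ⟨k, ⟨hk1, hk2⟩, hk3⟩ := exists_min_nat (P := fun k => i + 1 < k ∧ ρ 1 k) ⟨r, by omega, h1r⟩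
      have hkr : k ≤ r := hk3 r ⟨by omega, h1r⟩
      have hk3' : ∀ j, ρ 1 j → j ≤ i + 1 ∨ k ≤ j := fun j hj => by
        by_contra hh; push Not at hh; have := hk3 j ⟨hh.1, hj⟩; omega
      have p1 := ((dn 1 i hi (by omega)).cons h0i (by simp)).append (up k r (by omega) le_rfl) hk2 (by
          rw [Finset.disjoint_left]; intro x hx hx'; simp at hx hx'; omega)
      have p2 := ((dn 1 (i+1) (by omega) (by omega)).cons h0i1 (by simp)).append (up k r (by omega) le_rfl) hk2 (by
          rw [Finset.disjoint_left]; intro x hx hx'; simp at hx hx'; omega)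
      refine fin 0 c hc _ _ _ _ ?_ ?_ p1 p2 (by omega) ?_ ?_
      · intro j hj; simp at hj; omega
      · intro j hj; simp at hj; omega
      · intro j h3 h4 h5; have := hk3' j h5; simp; omega
      · intro j h3 h4 h5; have := hk3' j h5; simp; omega
    · exact main a ha0 har (fun h => absurd h ha) c hc


section
variable {V : Type*} [DecidableEq V] {r : V → V → Prop}

def AB (r : V → V → Prop) (X A B S : Finset V) (n : ℕ) (a b : V) : Prop :=
  HP r S n a b ∧ S ⊆ X ∧ a ∈ A ∧ b ∈ B ∧ (∀ x ∈ S, x ∈ A → x = a) ∧ (∀ x ∈ S, x ∈ B → x = b)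

theorem AB.symm (hr : ∀ x y, r x y → r y x) {X A B S : Finset V} {n : ℕ} {a b : V}
    (h : AB r X A B S n a b) : AB r X B A S n b a :=
  ⟨h.1.symm hr, h.2.1, h.2.2.2.1, h.2.2.1, h.2.2.2.2.2, h.2.2.2.2.1⟩

theorem ab_single {X A B : Finset V} {a : V} (hX : a ∈ X) (hA : a ∈ A) (hB : a ∈ B) :
    AB r X A B {a} 1 a a := by
  refine ⟨hp_single a, by simpa using hX, hA, hB, ?_, ?_⟩ <;> simp

theorem ab_of_hp (hr : ∀ x y, r x y → r y x) {X A B S : Finset V} {n : ℕ} {a b : V} (h : HP r S n a b)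
    (ha : a ∈ A) (hb : b ∈ B) (hS : S ⊆ X) : ∃ S' n' a' b', AB r X A B S' n' a' b' ∧ S' ⊆ S := by
  obtain ⟨S', n', b', h1, h2, h3, h4⟩ := h.firsthit B hb
  obtain ⟨T, k, a', h5, h6, h7, h8⟩ := (h3.symm hr).firsthit A ha
  refine ⟨T, k, a', b', ⟨h7.symm hr, h5.trans (h1.trans hS), h6, h2, ?_, ?_⟩, h5.trans h1⟩
  · intro x hx hxA
    have : x ∈ T ∩ A := Finset.mem_inter.2 ⟨hx, hxA⟩
    rw [h8] at this; simpa using this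
  · intro x hx hxA
    have : x ∈ S' ∩ B := Finset.mem_inter.2 ⟨h5 hx, hxA⟩
    rw [h4] at this; simpa using this

theorem HP.firsthit' {S : Finset V} {n : ℕ} {a b : V} (h : HP r S n a b) (T : Finset V) (hb : b ∈ T) :
    ∃ S' n' b', S' ⊆ S ∧ b' ∈ T ∧ HP r S' n' a b' ∧ ∀ x ∈ S', x ∈ T → x = b' := by
  obtain ⟨S', n', b', h1, h2, h3, h4⟩ := h.firsthit T hb
  refine ⟨S', n', b', h1, h2, h3, fun x hx hxA => ?_⟩
  have : x ∈ S' ∩ T := Finset.mem_inter.2 ⟨hx, hxA⟩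
  rw [h4] at this; simpa using this

theorem HP.split' {S : Finset V} {n : ℕ} {a b c : V} (h : HP r S n a b) (hc : c ∈ S) :
    ∃ S1 n1 S2 n2, HP r S1 n1 a c ∧ HP r S2 n2 c b ∧ (∀ x ∈ S1, x ∈ S2 → x = c) ∧ S1 ⊆ S ∧ S2 ⊆ S := by
  obtain ⟨S1, n1, S2, n2, h1, h2, h3, h4, h5⟩ := h.split hc
  refine ⟨S1, n1, S2, n2, h1, h2, fun x hx hxA => ?_, by simp [← h4], by simp [← h4]⟩
  have : x ∈ S1 ∩ S2 := Finset.mem_inter.2 ⟨hx, hxA⟩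
  rw [h3] at this; simpa using this

theorem HP.trans' {S T : Finset V} {n m : ℕ} {a b c : V} (h : HP r S n a b) (h' : HP r T m b c)
    (hd : ∀ x ∈ S, x ∈ T → x = b) : HP r (S ∪ T) (n + m - 1) a c := by
  refine h.trans h' ?_
  intro x hx
  rw [Finset.mem_inter] at hx
  simpa using hd x hx.1 hx.2

/-- rerouting step -/
theorem menger_step (hr : ∀ x y, r x y → r y x) {X A B S1 S2 : Finset V} {n1 n2 : ℕ} {a1 b1 a2 v : V}
    (hvX : v ∈ X) (hvB : v ∉ B) {b0 : V} (hb0 : b0 ∈ B) (hb0X : b0 ∈ X) (hvb : r v b0)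
    (Hs : ∀ c ∈ X, ∃ S n a b, HP r S n a b ∧ a ∈ A ∧ b ∈ B ∧ S ⊆ X.erase c)
    (h1 : AB r X A (insert v B) S1 n1 a1 b1) (h2 : AB r X A (insert v B) S2 n2 a2 v)
    (hd : ∀ x ∈ S1, x ∉ S2) :
    ∃ S1 n1 a1 b1 S2 n2 a2 b2, AB r X A B S1 n1 a1 b1 ∧ AB r X A B S2 n2 a2 b2 ∧ (∀ x ∈ S1, x ∉ S2) := by
  obtain ⟨p1, s1, hA1, hB1, uA1, uB1⟩ := h1
  obtain ⟨p2, s2, hA2, hB2, uA2, uB2⟩ := h2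
  have l1 := p1.left
  have r1 := p1.right
  have l2 := p2.left
  have r2 := p2.right
  have hb1 : b1 ∈ B := by
    rcases Finset.mem_insert.1 hB1 with rfl | h
    · exact absurd r2 (hd _ r1)
    · exact h
  have AB1 : AB r X A B S1 n1 a1 b1 := ⟨p1, s1, hA1, hb1, uA1, fun x hx hxB => uB1 x hx (Finset.mem_insert_of_mem hxB)⟩
  have nb2 : ∀ x ∈ S2, x ∉ B := by
    intro x hx hxB
    have := uB2 x hx (Finset.mem_insert_of_mem hxB)
    subst this; exact hvB hxB
  by_cases h01 : b0 = b1
  · subst h01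
    obtain ⟨T, k, a', b', q1, q2, q3, q4⟩ := Hs b0 hb0X
    obtain ⟨T, k, a', b', ⟨q1, q5, q2, q3, q6, q7⟩, q8⟩ := ab_of_hp hr q1 q2 q3 q4
    have hT0 : b0 ∉ T := fun h => by simpa using q5 h
    have hTX : T ⊆ X := q5.trans (Finset.erase_subset _ _)
    obtain ⟨T', k', h, t1, t2, t3, t4⟩ := (q1.symm hr).firsthit' (S1 ∪ S2 ∪ A) (by simp [q2])
    have hl := t3.left
    have hrr := t3.right
    by_cases c1 : h ∈ S1
    · obtain ⟨P, m1, Q, m2, e1, e2, e3, e4, e5⟩ := p1.split' c1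
      have hb0P : b0 ∉ P := fun hh => by
        have := e3 b0 hh e2.right
        subst this; exact hT0 (t1 hrr)
      have hb0A : b0 ∉ A := fun hh => by
        have := uA1 b0 r1 hh
        subst this; exact hb0P e1.left
      refine ⟨P ∪ T', _, a1, b', insert b0 S2, _, a2, b0, ⟨e1.trans' (t3.symm hr) ?_, ?_, hA1, q3, ?_, ?_⟩,
        ⟨p2.snoc hvb (hd _ r1), ?_, hA2, hb0, ?_, ?_⟩, ?_⟩
      · intro x hx hx'; exact t4 x hx' (by simp [e4 hx])
      · exact Finset.union_subset (e4.trans s1) (t1.trans hTX)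
      · intro x hx hxA
        rcases Finset.mem_union.1 hx with hx | hx
        · exact uA1 x (e4 hx) hxA
        · have := t4 x hx (by simp [hxA])
          subst this; exact uA1 x c1 hxA
      · intro x hx hxB
        rcases Finset.mem_union.1 hx with hx | hx
        · have := AB1.2.2.2.2.2 x (e4 hx) hxB
          subst this; exact absurd hx hb0P
        · exact q7 x (t1 hx) hxB
      · exact Finset.insert_subset hb0X s2
      · intro x hx hxA
        rcases Finset.mem_insert.1 hx with rfl | hx
        · exact absurd hxA hb0A
        · exact uA2 x hx hxA
      · intro x hx hxB
        rcases Finset.mem_insert.1 hx with rfl | hx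
        · rfl
        · exact absurd hxB (nb2 x hx)
      · intro x hx hx'
        rcases Finset.mem_insert.1 hx' with rfl | hx'
        · rcases Finset.mem_union.1 hx with hx | hx
          · exact hb0P hx
          · exact hT0 (t1 hx)
        · rcases Finset.mem_union.1 hx with hx | hx
          · exact hd x (e4 hx) hx'
          · have := t4 x hx (by simp [hx'])
            subst this; exact hd x c1 hx'
    · by_cases c2 : h ∈ S2
      · obtain ⟨P, m1, Q, m2, e1, e2, e3, e4, e5⟩ := p2.split' c2
        refine ⟨S1, _, a1, b0, P ∪ T', _, a2, b', AB1, ⟨e1.trans' (t3.symm hr) ?_, ?_, hA2, q3, ?_, ?_⟩, ?_⟩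
        · intro x hx hx'; exact t4 x hx' (by simp [e4 hx])
        · exact Finset.union_subset (e4.trans s2) (t1.trans hTX)
        · intro x hx hxA
          rcases Finset.mem_union.1 hx with hx | hx
          · exact uA2 x (e4 hx) hxA
          · have := t4 x hx (by simp [hxA])
            subst this; exact uA2 x c2 hxA
        · intro x hx hxB
          rcases Finset.mem_union.1 hx with hx | hx
          · exact absurd hxB (nb2 x (e4 hx))
          · exact q7 x (t1 hx) hxB
        · intro x hx hx'
          rcases Finset.mem_union.1 hx' with hx' | hx'
          · exact hd x hx (e4 hx')
          · have := t4 x hx' (by simp [hx])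
            subst this; exact c1 hx
      · have hhA : h ∈ A := by simpa [c1, c2] using t2
        refine ⟨S1, _, a1, b0, T', _, h, b', AB1, ⟨t3.symm hr, t1.trans hTX, hhA, q3, ?_, ?_⟩, ?_⟩
        · intro x hx hxA; exact t4 x hx (by simp [hxA])
        · intro x hx hxB; exact q7 x (t1 hx) hxB
        · intro x hx hx'
          have := t4 x hx' (by simp [hx])
          subst this; exact c1 hx
  · have hb01 : b0 ∉ S1 := fun h => h01 (AB1.2.2.2.2.2 b0 h hb0)
    have hb02 : b0 ∉ S2 := fun h => nb2 _ h hb0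
    by_cases hbA : b0 ∈ A
    · exact ⟨S1, _, a1, b1, {b0}, 1, b0, b0, AB1, ab_single hb0X hbA hb0, fun x hx hx' => by
        simp at hx'; subst hx'; exact hb01 hx⟩
    · refine ⟨S1, _, a1, b1, insert b0 S2, _, a2, b0, AB1, ⟨p2.snoc hvb hb02, Finset.insert_subset hb0X s2, hA2, hb0, ?_, ?_⟩, ?_⟩
      · intro x hx hxA
        rcases Finset.mem_insert.1 hx with rfl | hx
        · exact absurd hxA hbA
        · exact uA2 x hx hxA
      · intro x hx hxB
        rcases Finset.mem_insert.1 hx with rfl | hx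
        · rfl
        · exact absurd hxB (nb2 x hx)
      · intro x hx hx'
        rcases Finset.mem_insert.1 hx' with rfl | hx'
        · exact hb01 hx
        · exact hd x hx hx'

theorem menger2 (hr : ∀ x y, r x y → r y x) {X A B : Finset V} (hX : X.Nonempty)
    (Hs : ∀ c ∈ X, ∃ S n a b, HP r S n a b ∧ a ∈ A ∧ b ∈ B ∧ S ⊆ X.erase c) :
    ∃ S1 n1 a1 b1 S2 n2 a2 b2, AB r X A B S1 n1 a1 b1 ∧ AB r X A B S2 n2 a2 b2 ∧ (∀ x ∈ S1, x ∉ S2) := by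
  generalize hk : (X \ B).card = k
  induction k using Nat.strong_induction_on generalizing B with
  | _ k ih =>
  by_cases hv : ∃ v b0, v ∈ X ∧ v ∉ B ∧ b0 ∈ B ∧ b0 ∈ X ∧ r v b0
  · obtain ⟨v, b0, hvX, hvB, hb0, hb0X, hvb⟩ := hv
    have hlt : (X \ insert v B).card < k := by
      rw [← hk]
      apply Finset.card_lt_card
      rw [Finset.ssubset_iff_of_subset]
      · exact ⟨v, by simp [hvX, hvB], by simp⟩
      · intro x hx; simp at hx ⊢; tauto
    obtain ⟨S1, n1, a1, b1, S2, n2, a2, b2, h1, h2, hd⟩ := ih _ hlt (B := insert v B) (by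
      intro c hc
      obtain ⟨S, n, a, b, h1, h2, h3, h4⟩ := Hs c hc
      exact ⟨S, n, a, b, h1, h2, Finset.mem_insert_of_mem h3, h4⟩) rfl
    by_cases hb2 : b2 = v
    · subst hb2; exact menger_step hr hvX hvB hb0 hb0X hvb Hs h1 h2 hd
    · by_cases hb1 : b1 = v
      · subst hb1; exact menger_step hr hvX hvB hb0 hb0X hvb Hs h2 h1 (fun x hx hx' => hd x hx' hx)
      · refine ⟨S1, n1, a1, b1, S2, n2, a2, b2, ?_, ?_, hd⟩
        · obtain ⟨p1, s1, hA1, hB1, uA1, uB1⟩ := h1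
          exact ⟨p1, s1, hA1, by simpa [hb1] using hB1, uA1, fun x hx hxB => uB1 x hx (Finset.mem_insert_of_mem hxB)⟩
        · obtain ⟨p1, s1, hA1, hB1, uA1, uB1⟩ := h2
          exact ⟨p1, s1, hA1, by simpa [hb2] using hB1, uA1, fun x hx hxB => uB1 x hx (Finset.mem_insert_of_mem hxB)⟩
  · have key : ∀ c ∈ X, ∃ a, a ∈ X ∧ a ∈ A ∧ a ∈ B ∧ a ≠ c := by
      intro c hc
      obtain ⟨S, n, a, b, h1, h2, h3, h4⟩ := Hs c hc
      obtain ⟨T, k, a', b', ⟨q1, q5, q2, q3, q6, q7⟩, q8⟩ := ab_of_hp hr h1 h2 h3 h4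
      rcases (q1.symm hr).tail with ⟨_, e, _⟩ | ⟨d, m, hm, hbd, e⟩
      · subst e
        have := q5 q1.left
        simp at this
        exact ⟨b', this.2, q2, q3, this.1⟩
      · exfalso
        have hdT := Finset.mem_erase.1 e.left
        refine hv ⟨d, b', (Finset.mem_erase.1 (q5 hdT.2)).2, ?_, q3, (Finset.mem_erase.1 (q5 q1.right)).2, hr _ _ hbd⟩
        intro hdB
        exact hdT.1 (q7 d hdT.2 hdB)
    obtain ⟨c, hc⟩ := hX
    obtain ⟨a1, h1, h2, h3, -⟩ := key c hc
    obtain ⟨a2, h4, h5, h6, h7⟩ := key a1 h1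
    exact ⟨_, _, _, _, _, _, _, _, ab_single h1 h2 h3, ab_single h4 h5 h6, by simpa using h7.symm⟩

theorem tail_trick (hr : ∀ x y, r x y → r y x) {X A B S1 S2 R : Finset V} {n1 n2 m : ℕ} {a1 b1 a2 b2 α β : V}
    (h1 : AB r X A B S1 n1 a1 b1) (h2 : AB r X A B S2 n2 a2 b2) (hd : ∀ x ∈ S1, x ∉ S2)
    (hR : HP r R m α β) (hRX : R ⊆ X) (hα : α ∈ A) (hRA : ∀ x ∈ R, x ∈ A → x = α)
    (hRB : ∀ x ∈ R, x ∈ B → x = β) (hβ : β ∈ S1 ∨ β ∈ S2) :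
    ∃ S1' n1' S2' n2' a' b' b'', AB r X A B S1' n1' α b' ∧ AB r X A B S2' n2' a' b'' ∧ (∀ x ∈ S1', x ∉ S2') ∧
      ((b' = b1 ∧ b'' = b2) ∨ (b' = b2 ∧ b'' = b1)) := by
  obtain ⟨R', m', h, t1, t2, t3, t4⟩ := hR.firsthit' (S1 ∪ S2) (by simpa using hβ)
  have key : ∀ (S1 : Finset V) (n1 : ℕ) (a1 b1 : V) (S2 : Finset V), AB r X A B S1 n1 a1 b1 → (∀ x ∈ S1, x ∉ S2) → (h ∈ S1) → (∀ x ∈ R', x ∈ S1 → x = h) →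
      (∀ x ∈ R', x ∈ S2 → x = h) → (β ∈ R' → β ∈ S1) →
      ∃ S1' n1', AB r X A B S1' n1' α b1 ∧ (∀ x ∈ S1', x ∉ S2) := by
    rintro S1 n1 a1 b1 S2 ⟨p1, s1, hA1, hB1, uA1, uB1⟩ hd hh u1 u2 hβ'
    obtain ⟨P, m1, Q, m2, e1, e2, e3, e4, e5⟩ := p1.split' hh
    refine ⟨R' ∪ Q, _, ⟨t3.trans' e2 ?_, ?_, hα, hB1, ?_, ?_⟩, ?_⟩
    · intro x hx hx'; exact u1 x hx (e5 hx')
    · exact Finset.union_subset (t1.trans hRX) (e5.trans s1)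
    · intro x hx hxA
      rcases Finset.mem_union.1 hx with hx | hx
      · exact hRA x (t1 hx) hxA
      · have := uA1 x (e5 hx) hxA
        subst this
        have := e3 x e1.left hx
        subst this
        exact hRA x (t1 t3.right) hxA
    · intro x hx hxB
      rcases Finset.mem_union.1 hx with hx | hx
      · have := hRB x (t1 hx) hxB
        subst this
        exact uB1 _ (hβ' hx) hxB
      · exact uB1 x (e5 hx) hxB
    · intro x hx hx'
      rcases Finset.mem_union.1 hx with hx | hx
      · have := u2 x hx hx'
        subst this
        exact hd x hh hx'
      · exact hd x (e5 hx) hx'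
  have hβh : β ∈ R' → β = h := fun hx => t4 β hx (by simpa using hβ)
  by_cases c1 : h ∈ S1
  · obtain ⟨S1', n1', k1, k2⟩ := key S1 n1 a1 b1 S2 h1 hd c1 (fun x hx hx' => t4 x hx (by simp [hx']))
      (fun x hx hx' => t4 x hx (by simp [hx'])) (fun hx => by rw [hβh hx]; exact c1)
    exact ⟨S1', n1', S2, n2, a2, b1, b2, k1, h2, k2, Or.inl ⟨rfl, rfl⟩⟩
  · have c2 : h ∈ S2 := by simpa [c1] using t2
    obtain ⟨S1', n1', k1, k2⟩ := key S2 n2 a2 b2 S1 h2 (fun x hx hx' => hd x hx' hx) c2 (fun x hx hx' => t4 x hx (by simp [hx']))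
      (fun x hx hx' => t4 x hx (by simp [hx'])) (fun hx => by rw [hβh hx]; exact c2)
    exact ⟨S1', n1', S1, n1, a1, b2, b1, k1, h1, k2, Or.inr ⟨rfl, rfl⟩⟩

theorem menger_start (hr : ∀ x y, r x y → r y x) {X A B R : Finset V} {m : ℕ} {α β : V}
    (hR : HP r R m α β) (hRX : R ⊆ X) (hα : α ∈ A) (hβ : β ∈ B) (hRA : ∀ x ∈ R, x ∈ A → x = α)
    (Hs : ∀ c ∈ X, ∃ S n a b, HP r S n a b ∧ a ∈ A ∧ b ∈ B ∧ S ⊆ X.erase c) :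
    ∃ S1 n1 b1 S2 n2 a2 b2, AB r X A B S1 n1 α b1 ∧ AB r X A B S2 n2 a2 b2 ∧ (∀ x ∈ S1, x ∉ S2) := by
  obtain ⟨S1, n1, a1, b1, S2, n2, a2, b2, h1, h2, hd⟩ := menger2 hr ⟨α, hRX hR.left⟩ Hs
  obtain ⟨R', m', h, t1, t2, t3, t4⟩ := hR.firsthit' (S1 ∪ S2 ∪ B) (by simp [hβ])
  by_cases c : h ∈ S1 ∨ h ∈ S2
  · obtain ⟨S1', n1', S2', n2', a', b', b'', k1, k2, k3, -⟩ := tail_trick hr h1 h2 hd t3 (t1.trans hRX) hα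
      (fun x hx => hRA x (t1 hx)) (fun x hx hxB => t4 x hx (by simp [hxB])) c
    exact ⟨S1', n1', b', S2', n2', a', b'', k1, k2, k3⟩
  · push Not at c
    have hhB : h ∈ B := by simpa [c.1, c.2] using t2
    refine ⟨R', m', h, S2, n2, a2, b2, ⟨t3, t1.trans hRX, hα, hhB, fun x hx => hRA x (t1 hx),
      fun x hx hxB => t4 x hx (by simp [hxB])⟩, h2, ?_⟩
    intro x hx hx'
    have := t4 x hx (by simp [hx'])
    subst this; exact c.2 hx'

theorem menger_both (hr : ∀ x y, r x y → r y x) {X A B R : Finset V} {m : ℕ} {α β : V}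
    (hR : HP r R m α β) (hRX : R ⊆ X) (hα : α ∈ A) (hβ : β ∈ B) (hRA : ∀ x ∈ R, x ∈ A → x = α)
    (hRB : ∀ x ∈ R, x ∈ B → x = β)
    (Hs : ∀ c ∈ X, ∃ S n a b, HP r S n a b ∧ a ∈ A ∧ b ∈ B ∧ S ⊆ X.erase c) :
    ∃ S1 n1 a1 S2 n2 a2 b2, AB r X A B S1 n1 a1 β ∧ AB r X A B S2 n2 a2 b2 ∧ (∀ x ∈ S1, x ∉ S2) ∧
      (a1 = α ∨ a2 = α) := by
  obtain ⟨S1, n1, b1, S2, n2, a2, b2, h1, h2, hd⟩ := menger_start hr hR hRX hα hβ hRA Hs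
  obtain ⟨S1', n1', S2', n2', a', b', b'', k1, k2, k3, k4⟩ := tail_trick hr (h1.symm hr) (h2.symm hr) hd (hR.symm hr) hRX hβ
      hRB hRA (Or.inl h1.1.left)
  refine ⟨S1', n1', b', S2', n2', b'', a', k1.symm hr, k2.symm hr, k3, ?_⟩
  rcases k4 with h | h
  · exact Or.inl h.1
  · exact Or.inr h.2

end


section
variable {V : Type*} [DecidableEq V] {r : V → V → Prop}

theorem hsep (X A B : Finset V) (c : V) :
    (∃ S n a b, HP r S n a b ∧ a ∈ A ∧ b ∈ B ∧ S ⊆ X.erase c) ∨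
    ∃ Q ⊆ X.erase c, (∀ a ∈ A, a ∈ X → a ≠ c → a ∈ Q) ∧ (∀ b ∈ B, b ∉ Q) ∧
      ∀ x ∈ Q, ∀ y ∈ X, y ≠ c → r x y → y ∈ Q := by
  classical
  by_cases h : ∃ S n a b, HP r S n a b ∧ a ∈ A ∧ b ∈ B ∧ S ⊆ X.erase c
  · exact Or.inl h
  right
  refine ⟨(X.erase c).filter (fun v => ∃ S n a, HP r S n a v ∧ a ∈ A ∧ S ⊆ X.erase c), Finset.filter_subset _ _, ?_, ?_, ?_⟩
  · intro a ha haX hac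
    rw [Finset.mem_filter]
    exact ⟨Finset.mem_erase.2 ⟨hac, haX⟩, {a}, 1, a, hp_single a, ha, by simp [hac, haX]⟩
  · intro b hb hbQ
    rw [Finset.mem_filter] at hbQ
    obtain ⟨_, S, n, a, h1, h2, h3⟩ := hbQ
    exact h ⟨S, n, a, b, h1, h2, hb, h3⟩
  · intro x hx y hy hyc hxy
    rw [Finset.mem_filter] at hx ⊢
    obtain ⟨_, S, n, a, h1, h2, h3⟩ := hx
    have hy' := Finset.mem_erase.2 ⟨hyc, hy⟩
    obtain ⟨S', n', h4, h5⟩ := h1.reach h3 hy' hxy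
    exact ⟨hy', S', n', a, h5, h2, h4⟩

theorem ab_combine (hr : ∀ x y, r x y → r y x) {X A B S1 S2 T : Finset V} {n1 n2 t : ℕ} {a1 b1 a2 b2 : V}
    (h1 : AB r X A B S1 n1 a1 b1) (h2 : AB r X A B S2 n2 a2 b2) (hd : ∀ x ∈ S1, x ∉ S2)
    (hT : HP r T t a1 a2) (hTX : ∀ x ∈ T, x ∈ X → x ∈ A) :
    HP r (S1 ∪ T ∪ S2) (n1 + t - 1 + n2 - 1) b1 b2 := by
  refine ((h1.1.symm hr).trans' hT ?_).trans' h2.1 ?_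
  · intro x hx hx'; exact h1.2.2.2.2.1 x hx (hTX x hx' (h1.2.1 hx))
  · intro x hx hx'
    rcases Finset.mem_union.1 hx with hx | hx
    · exact absurd hx' (hd x hx)
    · exact h2.2.2.2.2.1 x hx' (hTX x hx (h2.2.1 hx'))
end

section
variable {V : Type*} [DecidableEq V] [Fintype V] (G : SimpleGraph V) [DecidableRel G.Adj]

def C2 : Prop := ∀ (c : V) (Q : Finset V), Q.Nonempty → c ∉ Q → (∃ w, w ∉ Q ∧ w ≠ c) →
  ∃ x ∈ Q, ∃ y, y ∉ Q ∧ y ≠ c ∧ G.Adj x y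

def Pocket (B : Finset V) (a b : V) : Prop :=
  B.Nonempty ∧ a ≠ b ∧ a ∉ B ∧ b ∉ B ∧ ∀ x ∈ B, ∀ y, G.Adj x y → y ∈ B ∨ y = a ∨ y = b

variable {G}

set_option maxHeartbeats 1000000 in
theorem lemmaR (hC2 : C2 G) {δ : ℕ} (hδ : 20 ≤ δ) (hdeg : ∀ v, δ ≤ (Finset.univ.filter (G.Adj v)).card)
    (hno : ∀ n, Even n → 2 * δ - 10 ≤ n → ¬ HasCyc G.Adj n) :
    ∀ (B : Finset V) (a b : V), Pocket G B a b → ∀ c, c < 2 → ∃ S n, HP G.Adj S n a b ∧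
      S ⊆ insert a (insert b B) ∧ n % 2 = c ∧ δ - 3 ≤ n := by
  have hsymm : ∀ x y, G.Adj x y → G.Adj y x := fun x y h => h.symm
  intro B
  generalize hk : B.card = k
  induction k using Nat.strong_induction_on generalizing B with
  | _ k ih =>
  rintro a b ⟨hBn, hab, haB, hbB, hcl⟩ c hc
  have hmemX : ∀ z, (z ∈ B ∨ z = a ∨ z = b) → z ∈ insert a (insert b B) := by
    intro z hz
    rcases hz with h | h | h <;> simp [h]
  have hmemX' : ∀ z, z ∈ insert a (insert b B) → (z ∈ B ∨ z = a ∨ z = b) := by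
    intro z hz
    simp only [Finset.mem_insert] at hz
    rcases hz with h | h | h <;> simp [h]
  -- reorienting
  have orient : ∀ S n b1 b2, HP G.Adj S n b1 b2 → b1 ∈ ({a, b} : Finset V) → b2 ∈ ({a, b} : Finset V) → b1 ≠ b2 →
      S ⊆ insert a (insert b B) → n % 2 = c → δ - 3 ≤ n → ∃ S n, HP G.Adj S n a b ∧
      S ⊆ insert a (insert b B) ∧ n % 2 = c ∧ δ - 3 ≤ n := by
    intro S n b1 b2 h h1 h2 h3 h4 h5 h6
    simp only [Finset.mem_insert, Finset.mem_singleton] at h1 h2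
    rcases h1 with rfl | rfl
    · rcases h2 with rfl | rfl
      · exact absurd rfl h3
      · exact ⟨S, n, h, h4, h5, h6⟩
    · rcases h2 with rfl | rfl
      · exact ⟨S, n, h.symm hsymm, h4, h5, h6⟩
      · exact absurd rfl h3
  by_cases hsm : ∃ B' c x, Pocket G B' c x ∧ B' ⊂ B ∧ (c ∈ B ∨ c = a ∨ c = b) ∧ (x ∈ B ∨ x = a ∨ x = b)
  · obtain ⟨B', u, x, hpk, hss, hu, hx⟩ := hsm
    have hlt := Finset.card_lt_card hss
    have hpk' := hpk
    obtain ⟨hB'n, hux, huB', hxB', hcl'⟩ := hpk'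
    have haB' : a ∉ B' := fun h => haB (hss.1 h)
    have hbB' : b ∉ B' := fun h => hbB (hss.1 h)
    set X' := (insert a (insert b B)) \ B' with hX'
    have huX : u ∈ X' := Finset.mem_sdiff.2 ⟨hmemX _ hu, huB'⟩
    have hxX : x ∈ X' := Finset.mem_sdiff.2 ⟨hmemX _ hx, hxB'⟩
    have Hs : ∀ v ∈ X', ∃ S n a1 b1, HP G.Adj S n a1 b1 ∧ a1 ∈ ({u, x} : Finset V) ∧ b1 ∈ ({a, b} : Finset V) ∧ S ⊆ X'.erase v := by
      intro v hv
      rcases hsep (r := G.Adj) X' {u, x} {a, b} v with h | ⟨Q, q1, q2, q3, q4⟩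
      · exact h
      exfalso
      have haQ := q3 a (by simp)
      have hbQ := q3 b (by simp)
      have hvB' : v ∉ B' := (Finset.mem_sdiff.1 hv).2
      obtain ⟨x0, hx0, y, hy, hyv, hxy⟩ := hC2 v (Q ∪ B') (hB'n.mono Finset.subset_union_right)
        (by
          rw [Finset.mem_union, not_or]
          exact ⟨fun h => by simpa using q1 h, hvB'⟩)
        (by
          by_cases h : a = v
          · exact ⟨b, by simp [hbQ, hbB'], by rw [← h]; exact hab.symm⟩
          · exact ⟨a, by simp [haQ, haB'], h⟩)
      rw [Finset.mem_union, not_or] at hy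
      rcases Finset.mem_union.1 hx0 with h | h
      · have hx0X := Finset.mem_erase.1 (q1 h)
        have hx0X' := (Finset.mem_sdiff.1 hx0X.2).1
        have hx0a : x0 ≠ a := fun e => haQ (e ▸ h)
        have hx0b : x0 ≠ b := fun e => hbQ (e ▸ h)
        have hx0B : x0 ∈ B := by simpa [hx0a, hx0b] using hx0X'
        have := hcl x0 hx0B y hxy
        exact hy.1 (q4 x0 h y (Finset.mem_sdiff.2 ⟨hmemX _ this, hy.2⟩) hyv hxy)
      · rcases hcl' x0 h y hxy with h1 | rfl | rfl
        · exact hy.2 h1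
        · exact hy.1 (q2 _ (by simp) huX hyv)
        · exact hy.1 (q2 _ (by simp) hxX hyv)
    obtain ⟨S1, n1, a1, b1, S2, n2, a2, b2, h1, h2, hd⟩ := menger2 hsymm ⟨u, huX⟩ Hs
    have ha12 : a1 ≠ a2 := fun e => hd a1 h1.1.left (e ▸ h2.1.left)
    have hb12 : b1 ≠ b2 := fun e => hd b1 h1.1.right (e ▸ h2.1.right)
    have hT : ∀ c, c < 2 → ∃ T t, HP G.Adj T t a1 a2 ∧ T ⊆ insert u (insert x B') ∧ t % 2 = c ∧ δ - 3 ≤ t := by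
      intro c hc
      obtain ⟨T, t, t1, t2, t3, t4⟩ := ih _ (hk ▸ hlt) B' rfl u x hpk c hc
      have ha1 := h1.2.2.1
      have ha2 := h2.2.2.1
      simp only [Finset.mem_insert, Finset.mem_singleton] at ha1 ha2
      rcases ha1 with rfl | rfl
      · rcases ha2 with rfl | rfl
        · exact absurd rfl ha12
        · exact ⟨T, t, t1, t2, t3, t4⟩
      · rcases ha2 with rfl | rfl
        · exact ⟨T, t, t1.symm hsymm, t2, t3, t4⟩
        · exact absurd rfl ha12
    obtain ⟨T, t, t1, t2, t3, t4⟩ := hT ((c + n1 + n2) % 2) (by omega)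
    have hn1 := h1.1.pos
    have hn2 := h2.1.pos
    refine orient _ _ b1 b2 (ab_combine hsymm h1 h2 hd t1 ?_) h1.2.2.2.1 h2.2.2.2.1 hb12 ?_ (by omega) (by omega)
    · intro z hz hzX
      have := t2 hz
      have h3 := (Finset.mem_sdiff.1 hzX).2
      simpa [h3] using this
    · refine Finset.union_subset (Finset.union_subset (h1.2.1.trans Finset.sdiff_subset) ?_) (h2.2.1.trans Finset.sdiff_subset)
      intro z hz
      have := t2 hz
      simp only [Finset.mem_insert] at this
      apply hmemX
      rcases this with rfl | rfl | h
      · exact hu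
      · exact hx
      · exact Or.inl (hss.1 h)
  · -- no smaller pocket
    obtain ⟨x0, hx0, y0, hy0, hy0b, hadj⟩ := hC2 b B hBn hbB ⟨a, haB, hab⟩
    have hy0a : y0 = a := by
      rcases hcl x0 hx0 y0 hadj with h | h | h
      · exact absurd h hy0
      · exact h
      · exact absurd h hy0b
    rw [hy0a] at hadj
    set X := insert a B with hX
    have hone : ∃ y, MP G X a 1 y := by
      have hne : x0 ≠ a := fun e => haB (e ▸ hx0)
      refine ⟨fun j => if j = 0 then x0 else a, ⟨?_, ?_⟩, ?_, by simp⟩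
      · intro i hi j hj hij
        dsimp at hij
        split_ifs at hij
        · omega
        · exact absurd hij hne
        · exact absurd hij.symm hne
        · omega
      · intro i hi
        have : i = 0 := by omega
        subst this; simpa using hadj
      · intro i hi; dsimp; split_ifs <;> simp [hX, hx0]
    obtain ⟨p, ⟨y1, hy1⟩, hpmax⟩ := exists_max_nat (P := fun p => ∃ y, MP G X a p y) X.card
      ⟨1, hone⟩
      (by
        rintro p ⟨y, hy⟩
        have h1 : ((Finset.range (p+1)).image y).card = p + 1 := by
          rw [Finset.card_image_of_injOn, Finset.card_range]
          intro i hi j hj hij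
          simp at hi hj
          exact hy.1.1 i (by omega) j (by omega) hij
        have h2 : (Finset.range (p+1)).image y ⊆ X := by
          intro v hv
          obtain ⟨i, hi, rfl⟩ := Finset.mem_image.1 hv
          simp at hi
          exact hy.2.1 i (by omega)
        have := Finset.card_le_card h2
        omega)
    have hp1 : 1 ≤ p := hpmax 1 hone
    have degX : ∀ v ∈ B, δ - 1 ≤ (X.filter (G.Adj v)).card := by
      intro v hv
      have h1 : Finset.univ.filter (G.Adj v) ⊆ insert b (X.filter (G.Adj v)) := by
        intro w hw
        simp at hw
        rcases hcl v hv w hw with h | h | h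
        · simp [hX, hw, h]
        · rw [h] at hw; simp [hX, hw, h]
        · simp [h]
      have h2 := Finset.card_le_card h1
      have h3 := Finset.card_insert_le b (X.filter (G.Adj v))
      have := hdeg v
      omega
    have inB : ∀ y, MP G X a p y → ∀ j, j < p → y j ∈ B := by
      intro y hy j hj
      have h1 := hy.2.1 j (by omega)
      have h2 : y j ≠ a := by
        intro e
        have := hy.1.1 j (by omega) p le_rfl (by rw [e, hy.2.2])
        omega
      simpa [hX, h2] using h1
    obtain ⟨y, i, r, hy, hi1, hir, hrp, e1, e2, e3, e4⟩ := lemmaA (G := G) (X := X) (q := a) (p := p) (d := δ - 1)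
      (by omega) hp1 ⟨y1, hy1⟩ (fun y hy => by have := hpmax (p + 1) ⟨y, hy⟩; omega)
      (fun y hy => degX _ (inB y hy 0 (by omega)))
      (fun n hn hn2 S hS u v h1 h2 => hno n hn (by omega) ⟨S, u, v, h1, h2⟩)
    obtain ⟨ix, hix, hB⟩ := lemmaB (ρ := fun i j => G.Adj (y i) (y j)) (fun _ _ h => h.symm) hi1 hir
      (fun j hj => hy.1.2 j (by omega)) e1 e2 e3
    have hixr : ix < r := by omega
    have hxB : y ix ∈ B := inB y hy ix (by omega)
    have hDc : δ - 2 ≤ ((Finset.Icc 2 r).filter (fun j => G.Adj (y 1) (y j))).card := by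
      have h1 : X.filter (G.Adj (y 1)) ⊆ insert (y 0) (((Finset.Icc 2 r).filter (fun j => G.Adj (y 1) (y j))).image y) := by
        intro v hv
        rw [Finset.mem_filter] at hv
        rcases e4 v hv.1 hv.2 with h | ⟨j, j1, j2, rfl⟩
        · simp [h]
        · refine Finset.mem_insert_of_mem (Finset.mem_image_of_mem _ ?_)
          simp [j1, j2, hv.2]
      have h2 := Finset.card_le_card h1
      have h3 := Finset.card_insert_le (y 0) (((Finset.Icc 2 r).filter (fun j => G.Adj (y 1) (y j))).image y)
      have h4 := Finset.card_image_le (s := (Finset.Icc 2 r).filter (fun j => G.Adj (y 1) (y j))) (f := y)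
      have := degX _ (inB y hy 1 (by omega))
      omega
    set A := ((Finset.range (r + 1)).erase ix).image y with hA
    have hmemA : ∀ j, j ≤ r → j ≠ ix → y j ∈ A := by
      intro j hj hj2
      refine Finset.mem_image_of_mem _ ?_
      simp [hj2]; omega
    set X' := (insert a (insert b B)).erase (y ix) with hX'
    have hyX' : ∀ j, j ≤ p → j ≠ ix → y j ∈ X' := by
      intro j hj hj2
      have h1 := hy.2.1 j hj
      have h2 : y j ≠ y ix := fun e => hj2 (hy.1.1 j hj ix (by omega) e)
      refine Finset.mem_erase.2 ⟨h2, ?_⟩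
      rw [hX, Finset.mem_insert] at h1
      rcases h1 with h | h <;> simp [h]
    have Hs : ∀ v ∈ X', ∃ S n a1 b1, HP G.Adj S n a1 b1 ∧ a1 ∈ A ∧ b1 ∈ ({a, b} : Finset V) ∧ S ⊆ X'.erase v := by
      intro v hv
      rcases hsep (r := G.Adj) X' A {a, b} v with h | ⟨Q, q1, q2, q3, q4⟩
      · exact h
      exfalso
      have haQ := q3 a (by simp)
      have hbQ := q3 b (by simp)
      have hv' := Finset.mem_erase.1 hv
      have hQB : ∀ z ∈ Q, z ∈ B ∧ z ≠ y ix ∧ z ≠ v := by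
        intro z hz
        have h1 := Finset.mem_erase.1 (q1 hz)
        have h2 := Finset.mem_erase.1 h1.2
        have hza : z ≠ a := fun e => haQ (e ▸ hz)
        have hzb : z ≠ b := fun e => hbQ (e ▸ hz)
        exact ⟨by simpa [hza, hzb] using h2.2, h2.1, h1.1⟩
      refine hsm ⟨Q, v, y ix, ⟨?_, hv'.1, ?_, ?_, ?_⟩, ?_, ?_, Or.inl hxB⟩
      · -- two distinct elements of A
        obtain ⟨j1, j2, k1, k2, k3, k4, k5⟩ : ∃ j1 j2, j1 ≤ r ∧ j2 ≤ r ∧ j1 ≠ ix ∧ j2 ≠ ix ∧ j1 ≠ j2 := by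
          rcases hix with h | h
          · exact ⟨1, 2, by omega, by omega, by omega, by omega, by omega⟩
          · exact ⟨0, r, by omega, by omega, by omega, by omega, by omega⟩
        by_cases h : y j1 = v
        · refine ⟨y j2, q2 _ (hmemA j2 k2 k4) (hyX' j2 (by omega) k4) ?_⟩
          intro e
          exact k5 (hy.1.1 j1 (by omega) j2 (by omega) (h.trans e.symm))
        · exact ⟨y j1, q2 _ (hmemA j1 k1 k3) (hyX' j1 (by omega) k3) h⟩
      · intro h; exact (hQB v h).2.2 rfl
      · intro h; exact (hQB _ h).2.1 rfl
      · intro z hz w hzw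
        by_cases hw1 : w = v
        · exact Or.inr (Or.inl hw1)
        by_cases hw2 : w = y ix
        · exact Or.inr (Or.inr hw2)
        left
        refine q4 z hz w ?_ hw1 hzw
        have := hcl z (hQB z hz).1 w hzw
        exact Finset.mem_erase.2 ⟨hw2, hmemX _ this⟩
      · rw [Finset.ssubset_iff_of_subset (fun z hz => (hQB z hz).1)]
        exact ⟨y ix, hxB, fun h => (hQB _ h).2.1 rfl⟩
      · exact hmemX' _ hv'.2
    have hR := hy.1.map (hy.1.up hrp le_rfl) (by intro i hi; simp at hi; omega)
    obtain ⟨S1, n1, b1, S2, n2, a2, b2, h1, h2, hd⟩ := menger_start hsymm (A := A) (B := {a, b}) (X := X') hR (by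
        intro v hv
        obtain ⟨j, hj, rfl⟩ := Finset.mem_image.1 hv
        simp at hj
        exact hyX' j (by omega) (by omega)) (hmemA r le_rfl (by omega)) (by simp [hy.2.2]) (by
        intro v hv hvA
        obtain ⟨j, hj, rfl⟩ := Finset.mem_image.1 hv
        obtain ⟨j', hj', e⟩ := Finset.mem_image.1 hvA
        simp at hj hj'
        have := hy.1.1 j' (by omega) j (by omega) e
        have : j = r := by omega
        rw [this]) Hs
    have hb12 : b2 ≠ b1 := fun e => hd b1 h1.1.right (e ▸ h2.1.right)
    obtain ⟨α, hα, hαe⟩ := Finset.mem_image.1 h2.2.2.1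
    have hαr : α ≠ r := fun e => hd _ h1.1.left (by rw [← e, hαe]; exact h2.1.left)
    simp at hα
    obtain ⟨T, t, t1, t2, t3, t4⟩ := hB α (by omega) hα.1 ((c + n1 + n2) % 2) (by omega)
    have t5 := hy.1.map t2 (fun j hj => (t1 j hj).trans hrp)
    rw [hαe] at t5
    have hn1 := h1.1.pos
    have hn2 := h2.1.pos
    refine orient _ _ b2 b1 (ab_combine hsymm h2 h1 (fun x hx hx' => hd x hx' hx) t5 ?_) h2.2.2.2.1 h1.2.2.2.1 hb12 ?_ (by omega) (by omega)
    · intro z hz hzX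
      obtain ⟨j, hj, rfl⟩ := Finset.mem_image.1 hz
      refine hmemA j (t1 j hj) ?_
      rintro rfl
      simp [hX'] at hzX
    · refine Finset.union_subset (Finset.union_subset (h2.2.1.trans (Finset.erase_subset _ _)) ?_) (h1.2.1.trans (Finset.erase_subset _ _))
      intro z hz
      obtain ⟨j, hj, rfl⟩ := Finset.mem_image.1 hz
      have := hy.2.1 j ((t1 j hj).trans hrp)
      rw [hX, Finset.mem_insert] at this
      rcases this with h | h <;> simp [h]
end


/-- rotate a cycle to start anywhere -/
theorem rotate_cyc {V : Type*} [DecidableEq V] {r : V → V → Prop} (hr : ∀ x y, r x y → r y x) {S : Finset V} {n : ℕ} {a b c : V}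
    (h : HP r S n a b) (hba : r b a) (hc : c ∈ S) : ∃ d, HP r S n c d := by
  obtain ⟨S1, n1, S2, n2, h1, h2, h3, h4, h5⟩ := h.split hc
  rcases (h1.symm hr).tail with ⟨e1, e2, e3⟩ | ⟨d, m, e1, e2, e3⟩
  · subst e2; exact ⟨b, h⟩
  · have h6 := h2.append (e3.symm hr) hba (by
      rw [Finset.disjoint_left]
      intro x hx hx'
      have h7 := Finset.mem_erase.1 hx'
      have : x ∈ S1 ∩ S2 := Finset.mem_inter.2 ⟨h7.2, hx⟩
      rw [h3] at this
      exact h7.1 (by simpa using this))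
    have e : S2 ∪ S1.erase c = S := by
      rw [← h4]; ext x
      have := h2.left
      by_cases hx : x = c
      · subst hx; simp [this]
      · simp [hx]; tauto
    have e' : n2 + m = n := by omega
    rw [e, e'] at h6
    exact ⟨d, h6⟩

section
variable {V : Type*} [DecidableEq V] [Fintype V] {G : SimpleGraph V} [DecidableRel G.Adj]

theorem IsP.le_card {y : ℕ → V} {p : ℕ} (hy : IsP G.Adj y p) : p + 1 ≤ Fintype.card V := by
  have h1 : ((Finset.range (p+1)).image y).card = p + 1 := by
    rw [Finset.card_image_of_injOn, Finset.card_range]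
    intro i hi j hj hij
    simp at hi hj
    exact hy.1 i (by omega) j (by omega) hij
  rw [← h1]; exact Finset.card_le_univ _

/-- the case of overlapping end neighbourhoods -/
theorem theoremE_b (hC2 : C2 G) {δ : ℕ} (hδ : 20 ≤ δ) (hcard : 2 * δ ≤ Fintype.card V)
    {p : ℕ} (hpmax : ∀ z, (∃ y, IsP G.Adj y z) → z ≤ p) {y : ℕ → V} (hy : IsP G.Adj y p)
    {i r t : ℕ} (hi1 : 1 ≤ i) (hir : i + 1 ≤ r) (hrp : r ≤ p) (e1 : G.Adj (y 0) (y i)) (e2 : G.Adj (y 0) (y (i+1)))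
    (e3 : G.Adj (y 1) (y r)) (ht0 : t ≠ 0) (hti : t ≠ i) (htp : G.Adj (y t) (y p)) (htr : t < r)
    (hN1 : δ - 1 ≤ ((Finset.Icc 2 r).filter (fun j => G.Adj (y 1) (y j))).card)
    (hNp : δ - 2 ≤ ((Finset.Icc 1 (p-1)).filter (fun j => j ≠ i ∧ G.Adj (y j) (y p))).card) :
    ∃ n, Even n ∧ 2 * δ - 10 ≤ n ∧ HasCyc G.Adj n := by
  have hsymm : ∀ x y, G.Adj x y → G.Adj y x := fun x y h => h.symm
  obtain ⟨D, ⟨j, k, hD, hj0, hji, hjp, hjk, hk2, hkr, h1k⟩, hmin⟩ := exists_min_nat (P := fun D => ∃ j k, D + j = k ∧ j ≠ 0 ∧ j ≠ i ∧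
    G.Adj (y j) (y p) ∧ j < k ∧ 2 ≤ k ∧ k ≤ r ∧ G.Adj (y 1) (y k)) ⟨r - t, t, r, by omega, ht0, hti, htp, htr, by omega, le_rfl, e3⟩
  have m1 : ∀ u, 2 ≤ u → u ≤ r → G.Adj (y 1) (y u) → u ≤ j ∨ k ≤ u := by
    intro u hu1 hu2 hu3
    by_contra hh
    have := hmin (u - j) ⟨j, u, by omega, hj0, hji, hjp, by omega, hu1, hu2, hu3⟩
    omega
  have m2 : ∀ u, u ≠ 0 → u ≠ i → G.Adj (y u) (y p) → u ≤ j ∨ k ≤ u := by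
    intro u hu1 hu2 hu3
    by_contra hh
    have := hmin (k - u) ⟨u, k, by omega, hu1, hu2, hu3, by omega, hk2, hkr, h1k⟩
    omega
  have fin : ∀ T n T' n', HP (fun a b => G.Adj (y a) (y b)) T n j p → HP (fun a b => G.Adj (y a) (y b)) T' n' j p →
      (∀ x ∈ T, x ≤ p) → (∀ x ∈ T', x ≤ p) → (n + n') % 2 = 1 → 2 * δ - 10 ≤ n → 2 * δ - 10 ≤ n' →
      ∃ n, Even n ∧ 2 * δ - 10 ≤ n ∧ HasCyc G.Adj n := by
    intro T n T' n' h1 h2 h3 h4 h5 h6 h7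
    by_cases hp : n % 2 = 0
    · exact ⟨n, Nat.even_iff.2 hp, h6, _, _, _, hy.map h1 h3, hjp.symm⟩
    · exact ⟨n', Nat.even_iff.2 (by omega), h7, _, _, _, hy.map h2 h4, hjp.symm⟩
  have up : ∀ a b, a ≤ b → b ≤ p → _ := fun a b h1 h2 => hy.up (a := a) (b := b) h1 h2
  have dn : ∀ a b, a ≤ b → b ≤ p → _ := fun a b h1 h2 => hy.down hsymm (a := a) (b := b) h1 h2
  have base := (dn 1 j (by omega) (by omega)).append (up k p (by omega) le_rfl) h1k (by
      rw [Finset.disjoint_left]; intro x hx hx'; simp at hx hx'; omega)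
  -- size
  have hsize : 2 * δ - 5 ≤ (j + 1 - 1) + (p + 1 - k) := by
    by_cases hkj : k = j + 1
    · -- spanning cycle
      have hcyc : ∃ T, HP (fun a b => G.Adj (y a) (y b)) T (p + 1) j p ∧ (∀ x, x ∈ T ↔ x ≤ p) := by
        rcases Nat.lt_or_gt_of_ne hji with h | h
        · have p1 := ((dn 1 j (by omega) (by omega)).append (up k i (by omega) (by omega)) h1k (by
            rw [Finset.disjoint_left]; intro x hx hx'; simp at hx hx'; omega)).snoc e1.symm (by simp; omega)
          have p2 := p1.append (up (i+1) p (by omega) le_rfl) e2 (by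
            rw [Finset.disjoint_left]; intro x hx hx'; simp at hx hx'; omega)
          refine ⟨_, by convert p2 using 1; omega, ?_⟩
          intro x; simp; omega
        · have p1 := ((dn (i+1) j (by omega) (by omega)).snoc e2.symm (by simp)).append (dn 1 i hi1 (by omega)) e1 (by
            rw [Finset.disjoint_left]; intro x hx hx'; simp at hx hx'; omega)
          have p2 := p1.append (up k p (by omega) le_rfl) h1k (by
            rw [Finset.disjoint_left]; intro x hx hx'; simp at hx hx'; omega)
          refine ⟨_, by convert p2 using 1; omega, ?_⟩
          intro x; simp; omega
      obtain ⟨T, hT, hTm⟩ := hcyc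
      have hT' := hy.map hT (fun x hx => (hTm x).1 hx)
      have hall : T.image y = Finset.univ := by
        by_contra hne
        have hout : (Finset.univ \ T.image y).Nonempty := by
          rw [Finset.sdiff_nonempty]
          intro h; exact hne (Finset.univ_subset_iff.1 h)
        have hmem : ∀ j, j ≤ p → y j ∈ T.image y := fun j hj => Finset.mem_image_of_mem _ ((hTm j).2 hj)
        obtain ⟨x, hx, z, hz, hzc, hxz⟩ := hC2 (y 0) (Finset.univ \ T.image y) hout (by
          simpa using hmem 0 (by omega)) ⟨y 1, by simpa using hmem 1 (by omega), fun e => by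
            have := hy.1 1 (by omega) 0 (by omega) e; omega⟩
        have hz' : z ∈ T.image y := by
          by_contra h; exact hz (by simpa using h)
        have hx' : x ∉ T.image y := (Finset.mem_sdiff.1 hx).2
        obtain ⟨d, hd⟩ := rotate_cyc hsymm hT' hjp.symm hz'
        obtain ⟨y', hy', -⟩ := (hd.cons hxz hx').toFun
        have := hpmax _ ⟨y', hy'⟩
        omega
      have := hT'.card
      rw [hall, Finset.card_univ] at this
      omega
    · set N1 := (Finset.Icc 2 r).filter (fun j => G.Adj (y 1) (y j)) with hN1d
      set Np := (Finset.Icc 1 (p-1)).filter (fun j => j ≠ i ∧ G.Adj (y j) (y p)) with hNpd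
      have hd : Disjoint (N1.image (fun u => u - 1)) Np := by
        rw [Finset.disjoint_left]
        intro x hx hx'
        obtain ⟨u, hu, rfl⟩ := Finset.mem_image.1 hx
        simp [hN1d] at hu
        simp [hNpd] at hx'
        have := hmin 1 ⟨u - 1, u, by omega, by omega, hx'.2.1, hx'.2.2, by omega, hu.1.1, hu.1.2, hu.2⟩
        omega
      have hc1 : (N1.image (fun u => u - 1)).card = N1.card := by
        apply Finset.card_image_of_injOn
        intro a ha b hb hab
        simp [hN1d] at ha hb hab
        omega
      have hsub : N1.image (fun u => u - 1) ∪ Np ⊆ insert (k - 1) (Finset.Icc 1 j ∪ Finset.Icc k p) := by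
        intro x hx
        rcases Finset.mem_union.1 hx with hx | hx
        · obtain ⟨u, hu, rfl⟩ := Finset.mem_image.1 hx
          simp [hN1d] at hu
          have := m1 u (by omega) (by omega) hu.2
          simp; omega
        · simp [hNpd] at hx
          have := m2 x (by omega) hx.2.1 hx.2.2
          simp; omega
      have h1 := Finset.card_le_card hsub
      rw [Finset.card_union_of_disjoint hd, hc1] at h1
      have h2 := Finset.card_insert_le (k - 1) (Finset.Icc 1 j ∪ Finset.Icc k p)
      have h3 := Finset.card_union_le (Finset.Icc 1 j) (Finset.Icc k p)
      simp only [Nat.card_Icc] at h3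
      omega
  rcases Nat.lt_or_gt_of_ne hji with h | h
  · by_cases hik : i < k
    · have p1 := ((dn 1 j (by omega) (by omega)).snoc (hy.2 0 (by omega)).symm (by simp)).append (up (i+1) p (by omega) le_rfl) e2 (by
          rw [Finset.disjoint_left]; intro x hx hx'; simp at hx hx'; omega)
      have p2 := ((dn 1 j (by omega) (by omega)).snoc (hy.2 0 (by omega)).symm (by simp)).append (up i p (by omega) le_rfl) e1 (by
          rw [Finset.disjoint_left]; intro x hx hx'; simp at hx hx'; omega)
      refine fin _ _ _ _ p1 p2 ?_ ?_ (by omega) (by omega) (by omega)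
      · intro x hx; simp at hx; omega
      · intro x hx; simp at hx; omega
    · have p1 := ((dn 1 j (by omega) (by omega)).append (up k i (by omega) (by omega)) h1k (by
            rw [Finset.disjoint_left]; intro x hx hx'; simp at hx hx'; omega)).snoc e1.symm (by simp; omega)
      have p2 := p1.append (up (i+1) p (by omega) le_rfl) e2 (by
            rw [Finset.disjoint_left]; intro x hx hx'; simp at hx hx'; omega)
      refine fin _ _ _ _ base p2 ?_ ?_ (by omega) (by omega) (by omega)
      · intro x hx; simp at hx; omega
      · intro x hx; simp at hx; omega
  · have p1 := ((dn (i+1) j (by omega) (by omega)).snoc e2.symm (by simp)).append (dn 1 i hi1 (by omega)) e1 (by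
            rw [Finset.disjoint_left]; intro x hx hx'; simp at hx hx'; omega)
    have p2 := p1.append (up k p (by omega) le_rfl) h1k (by
            rw [Finset.disjoint_left]; intro x hx hx'; simp at hx hx'; omega)
    refine fin _ _ _ _ base p2 ?_ ?_ (by omega) (by omega) (by omega)
    · intro x hx; simp at hx; omega
    · intro x hx; simp at hx; omega

set_option maxHeartbeats 1000000 in
theorem theoremE (hC2 : C2 G) {δ : ℕ} (hδ : 20 ≤ δ) (hdeg : ∀ v, δ ≤ (Finset.univ.filter (G.Adj v)).card)
    (hcard : 2 * δ ≤ Fintype.card V) : ∃ n, Even n ∧ 2 * δ - 10 ≤ n ∧ HasCyc G.Adj n := by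
  have hsymm : ∀ x y, G.Adj x y → G.Adj y x := fun x y h => h.symm
  by_contra hcon
  have hno : ∀ n, Even n → 2 * δ - 10 ≤ n → ¬ HasCyc G.Adj n := fun n h1 h2 h3 => hcon ⟨n, h1, h2, h3⟩
  by_cases hpk : ∃ B a b w, Pocket G B a b ∧ w ∉ B ∧ w ≠ a ∧ w ≠ b
  · obtain ⟨B, a, b, w, hB, hw1, hw2, hw3⟩ := hpk
    have hB2 : Pocket G (Finset.univ \ (insert a (insert b B))) a b := by
      refine ⟨⟨w, by simp [hw1, hw2, hw3]⟩, hB.2.1, by simp, by simp, ?_⟩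
      intro x hx z hxz
      simp only [Finset.mem_sdiff, Finset.mem_univ, true_and, Finset.mem_insert, not_or] at hx ⊢
      by_contra hz
      have hzB : z ∈ B := by
        by_contra h
        apply hz
        by_cases h1 : z = a
        · exact Or.inr (Or.inl h1)
        by_cases h2 : z = b
        · exact Or.inr (Or.inr h2)
        exact Or.inl ⟨h1, h2, h⟩
      rcases hB.2.2.2.2 z hzB x hxz.symm with h | h | h
      · exact hx.2.2 h
      · exact hx.1 h
      · exact hx.2.1 h
    obtain ⟨S1, n1, a1, a2, a3, a4⟩ := lemmaR hC2 hδ hdeg hno B a b hB 0 (by omega)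
    obtain ⟨S2, n2, b1, b2, b3, b4⟩ := lemmaR hC2 hδ hdeg hno _ a b hB2 0 (by omega)
    refine hno (n1 + n2 - 2) (Nat.even_iff.2 (by omega)) (by omega) (hasCyc_of_two hsymm a1 b1 ?_ hB.2.1)
    intro x hx
    rw [Finset.mem_inter] at hx
    have h1 := a2 hx.1
    have h2 := b2 hx.2
    simp only [Finset.mem_insert, Finset.mem_sdiff, Finset.mem_singleton, Finset.mem_univ, true_and, not_or] at h1 h2 ⊢
    rcases h2 with h | h | h
    · exact Or.inl h
    · exact Or.inr h
    · rcases h1 with h' | h' | h'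
      · exact Or.inl h'
      · exact Or.inr h'
      · exact absurd h' h.2.2
  · have hV : Nonempty V := by
      rw [← Fintype.card_pos_iff]; omega
    obtain ⟨v0⟩ := hV
    obtain ⟨p, ⟨yq, hyq⟩, hpmax⟩ := exists_max_nat (P := fun p => ∃ y, IsP G.Adj y p) (Fintype.card V)
      ⟨0, fun _ => v0, by intro i hi j hj _; omega, by intro i hi; omega⟩
      (by rintro p ⟨y, hy⟩; have := hy.le_card; omega)
    have hmax : ∀ q y, ¬ MP G Finset.univ q (p + 1) y := by
      intro q y hy
      have := hpmax _ ⟨y, hy.1⟩; omega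
    have hp1 : 1 ≤ p := by
      have h1 := hdeg (yq 0)
      obtain ⟨w, hw⟩ := Finset.card_pos.1 (show 0 < (Finset.univ.filter (G.Adj (yq 0))).card by omega)
      simp at hw
      obtain ⟨j, h1, h2, _⟩ := MP.nbr (X := Finset.univ) (q := yq p) ⟨hyq, by simp, rfl⟩ (hmax _) (Finset.mem_univ w) hw
      omega
    obtain ⟨y, i, r, hy, hi1, hir, hrp, e1, e2, e3, e4⟩ := lemmaA (G := G) (X := Finset.univ) (q := yq p) (p := p) (d := δ)
      (by omega) hp1 ⟨yq, hyq, by simp, rfl⟩ (hmax _) (fun y hy => hdeg _)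
      (fun n hn hn2 S hS u v h1 h2 => hno n hn (by omega) ⟨S, u, v, h1, h2⟩)
    obtain ⟨ix, hix, hB⟩ := lemmaB (ρ := fun i j => G.Adj (y i) (y j)) (fun _ _ h => h.symm) hi1 hir
      (fun j hj => hy.1.2 j (by omega)) e1 e2 e3
    have hixr : ix < r := by omega
    have hDc : δ - 1 ≤ ((Finset.Icc 2 r).filter (fun j => G.Adj (y 1) (y j))).card := by
      have h1 : Finset.univ.filter (G.Adj (y 1)) ⊆ insert (y 0) (((Finset.Icc 2 r).filter (fun j => G.Adj (y 1) (y j))).image y) := by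
        intro v hv
        rw [Finset.mem_filter] at hv
        rcases e4 v hv.1 hv.2 with h | ⟨j, j1, j2, rfl⟩
        · simp [h]
        · refine Finset.mem_insert_of_mem (Finset.mem_image_of_mem _ ?_)
          simp [j1, j2, hv.2]
      have h2 := Finset.card_le_card h1
      have h3 := Finset.card_insert_le (y 0) (((Finset.Icc 2 r).filter (fun j => G.Adj (y 1) (y j))).image y)
      have h4 := Finset.card_image_le (s := (Finset.Icc 2 r).filter (fun j => G.Adj (y 1) (y j))) (f := y)
      have := hdeg (y 1)
      omega
    have hy1 : IsP G.Adj y p := hy.1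
    -- the far end
    have hrev : MP G Finset.univ (y 0) p (fun j => y (p - j)) := by
      refine ⟨hy.1.comp (fun j => p - j) ?_ ?_ ?_, by simp, by simp⟩
      · intro j hj; omega
      · intro j hj k hk hjk; omega
      · intro j hj
        have := hy.1.2 (p - (j + 1)) (by omega)
        have e : p - (j + 1) + 1 = p - j := by omega
        rw [e] at this; exact this.symm
    have hpn : ∀ v, G.Adj (y p) v → ∃ j, j < p ∧ v = y j := by
      intro v hv
      obtain ⟨j, h1, h2, h3⟩ := hrev.nbr (hmax _) (Finset.mem_univ v) (by simpa using hv)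
      exact ⟨p - j, by omega, h3⟩
    set Np := (Finset.Icc 1 (p-1)).filter (fun j => j ≠ i ∧ G.Adj (y j) (y p)) with hNpd
    have hNp : δ - 2 ≤ Np.card := by
      have h1 : Finset.univ.filter (G.Adj (y p)) ⊆ insert (y 0) (insert (y i) (Np.image y)) := by
        intro v hv
        rw [Finset.mem_filter] at hv
        obtain ⟨j, hj, rfl⟩ := hpn v hv.2
        by_cases hj0 : j = 0
        · simp [hj0]
        by_cases hji : j = i
        · simp [hji]
        refine Finset.mem_insert_of_mem (Finset.mem_insert_of_mem (Finset.mem_image_of_mem _ ?_))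
        simp only [hNpd, Finset.mem_filter, Finset.mem_Icc]
        exact ⟨⟨by omega, by omega⟩, hji, hv.2.symm⟩
      have h2 := Finset.card_le_card h1
      have h3 := Finset.card_insert_le (y 0) (insert (y i) (Np.image y))
      have h4 := Finset.card_insert_le (y i) (Np.image y)
      have h5 := Finset.card_image_le (s := Np) (f := y)
      have := hdeg (y p)
      omega
    have hNpn : Np.Nonempty := Finset.card_pos.1 (by omega)
    obtain ⟨t, htN, htmin⟩ : ∃ t ∈ Np, ∀ u ∈ Np, t ≤ u := ⟨Np.min' hNpn, Np.min'_mem _, fun u hu => Np.min'_le u hu⟩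
    have htN' := htN
    simp only [hNpd, Finset.mem_filter, Finset.mem_Icc] at htN'
    obtain ⟨⟨ht1, htp⟩, hti, htadj⟩ := htN'
    by_cases htr : t < r
    · exact hcon (theoremE_b hC2 hδ hcard hpmax hy.1 hi1 hir hrp e1 e2 e3 (by omega) hti htadj htr hDc hNp)
    · push Not at htr
      set A := ((Finset.range (r + 1)).erase ix).image y with hA
      have hmemA : ∀ j, j ≤ r → j ≠ ix → y j ∈ A := by
        intro j hj hj2
        refine Finset.mem_image_of_mem _ ?_
        simp [hj2]; omega
      set Bs := (Finset.Icc t p).image y with hBs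
      set X' := Finset.univ.erase (y ix) with hX'
      have hyX' : ∀ j, j ≤ p → j ≠ ix → y j ∈ X' := by
        intro j hj hj2
        have h2 : y j ≠ y ix := fun e => hj2 (hy.1.1 j hj ix (by omega) e)
        simp [hX', h2]
      have Hs : ∀ v ∈ X', ∃ S n a1 b1, HP G.Adj S n a1 b1 ∧ a1 ∈ A ∧ b1 ∈ Bs ∧ S ⊆ X'.erase v := by
        intro v hv
        rcases hsep (r := G.Adj) X' A Bs v with h | ⟨Q, q1, q2, q3, q4⟩
        · exact h
        exfalso
        have hv' := Finset.mem_erase.1 hv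
        have hQB : ∀ z ∈ Q, z ≠ y ix ∧ z ≠ v := by
          intro z hz
          have h1 := Finset.mem_erase.1 (q1 hz)
          have h2 := Finset.mem_erase.1 h1.2
          exact ⟨h2.1, h1.1⟩
        have hpock : Pocket G Q v (y ix) := by
          refine ⟨?_, hv'.1, ?_, ?_, ?_⟩
          · obtain ⟨j1, j2, k1, k2, k3, k4, k5⟩ : ∃ j1 j2, j1 ≤ r ∧ j2 ≤ r ∧ j1 ≠ ix ∧ j2 ≠ ix ∧ j1 ≠ j2 := by
              rcases hix with h | h
              · exact ⟨1, 2, by omega, by omega, by omega, by omega, by omega⟩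
              · exact ⟨0, r, by omega, by omega, by omega, by omega, by omega⟩
            by_cases h : y j1 = v
            · refine ⟨y j2, q2 _ (hmemA j2 k2 k4) (hyX' j2 (by omega) k4) ?_⟩
              intro e
              exact k5 (hy.1.1 j1 (by omega) j2 (by omega) (h.trans e.symm))
            · exact ⟨y j1, q2 _ (hmemA j1 k1 k3) (hyX' j1 (by omega) k3) h⟩
          · intro h; exact (hQB v h).2 rfl
          · intro h; exact (hQB _ h).1 rfl
          · intro z hz w hzw
            by_cases hw1 : w = v
            · exact Or.inr (Or.inl hw1)
            by_cases hw2 : w = y ix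
            · exact Or.inr (Or.inr hw2)
            left
            exact q4 z hz w (Finset.mem_erase.2 ⟨hw2, Finset.mem_univ _⟩) hw1 hzw
        have hout : ∀ j, t ≤ j → j ≤ p → y j ∉ Q ∧ y j ≠ y ix := by
          intro j h1 h2
          refine ⟨q3 _ (Finset.mem_image_of_mem _ (by simp [h1, h2])), ?_⟩
          intro e
          have := hy.1.1 j (by omega) ix (by omega) e
          omega
        by_cases h : y p = v
        · refine hpk ⟨Q, v, y ix, y t, hpock, (hout t le_rfl (by omega)).1, ?_, (hout t le_rfl (by omega)).2⟩
          intro e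
          have := hy.1.1 t (by omega) p (by omega) (e.trans h.symm)
          omega
        · exact hpk ⟨Q, v, y ix, y p, hpock, (hout p (by omega) (by omega)).1, h, (hout p (by omega) (by omega)).2⟩
      have hR := hy.1.map (hy.1.up htr (by omega)) (by intro i hi; simp at hi; omega)
      obtain ⟨S1, n1, a1, S2, n2, a2, b2, h1, h2, hd, hα⟩ := menger_both hsymm (A := A) (B := Bs) (X := X') hR (by
        intro v hv
        obtain ⟨j, hj, rfl⟩ := Finset.mem_image.1 hv
        simp at hj
        exact hyX' j (by omega) (by omega)) (hmemA r le_rfl (by omega)) (Finset.mem_image_of_mem _ (by simp; omega)) (by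
        intro v hv hvA
        obtain ⟨j, hj, rfl⟩ := Finset.mem_image.1 hv
        obtain ⟨j', hj', e⟩ := Finset.mem_image.1 hvA
        simp at hj hj'
        have := hy1.1 j' (by omega) j (by omega) e
        have : j = r := by omega
        rw [this]) (by
        intro v hv hvA
        obtain ⟨j, hj, rfl⟩ := Finset.mem_image.1 hv
        obtain ⟨j', hj', e⟩ := Finset.mem_image.1 hvA
        simp at hj hj'
        have := hy1.1 j' (by omega) j (by omega) e
        have : j = t := by omega
        rw [this]) Hs
      have ha12 : a1 ≠ a2 := fun e => hd a1 h1.1.left (e ▸ h2.1.left)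
      obtain ⟨β, hβ, hβe⟩ := Finset.mem_image.1 h2.2.2.2.1
      have hβt : β ≠ t := fun e => hd _ h1.1.right (by rw [← e, hβe]; exact h2.1.right)
      simp at hβ
      -- far side path
      obtain ⟨k', ⟨hk1, hk2, hk3⟩, hk4⟩ := exists_max_nat (P := fun k' => t ≤ k' ∧ k' < β ∧ G.Adj (y k') (y p)) β
        ⟨t, le_rfl, by omega, htadj⟩ (fun x hx => by omega)
      have U := (hy.1.up hk1 (by omega)).append (hy.1.down hsymm hβ.2 le_rfl) hk3 (by
        rw [Finset.disjoint_left]; intro x hx hx'; simp at hx hx'; omega)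
      have U' := hy.1.map U (by intro i hi; simp at hi; omega)
      have hUc : δ - 2 ≤ (k' + 1 - t) + (p + 1 - β) := by
        have hs : Np ⊆ Finset.Icc t k' ∪ Finset.Icc β p := by
          intro x hx
          have h3 := htmin x hx
          simp only [hNpd, Finset.mem_filter, Finset.mem_Icc] at hx
          have h4 : x < β → x ≤ k' := fun h => hk4 x ⟨h3, h, hx.2.2⟩
          simp; omega
        have h3 := Finset.card_le_card hs
        rw [U.card] at h3
        omega
      -- near side path
      have hnear : ∀ c, c < 2 → ∃ (T : Finset ℕ) (n : ℕ), (∀ j ∈ T, j ≤ r) ∧ HP G.Adj (T.image y) n a1 a2 ∧ n % 2 = c ∧ δ - 2 ≤ n := by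
        intro c hc
        rcases hα with hα | hα
        · obtain ⟨α, hα', hαe⟩ := Finset.mem_image.1 h2.2.2.1
          simp at hα'
          have : α ≠ r := by rintro rfl; exact ha12 (hα.trans hαe)
          obtain ⟨T, n, t1, t2, t3, t4⟩ := hB α (by omega) hα'.1 c hc
          refine ⟨T, n, t1, ?_, t3, by omega⟩
          rw [← hαe, hα]
          exact (hy.1.map t2 (fun j hj => (t1 j hj).trans hrp)).symm hsymm
        · obtain ⟨α, hα', hαe⟩ := Finset.mem_image.1 h1.2.2.1
          simp at hα'
          have : α ≠ r := by rintro rfl; exact ha12 (hαe.symm.trans hα.symm)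
          obtain ⟨T, n, t1, t2, t3, t4⟩ := hB α (by omega) hα'.1 c hc
          refine ⟨T, n, t1, ?_, t3, by omega⟩
          rw [← hαe, hα]
          exact hy.1.map t2 (fun j hj => (t1 j hj).trans hrp)
      obtain ⟨T, tn, t1, t2, t3, t4⟩ := hnear ((n1 + n2 + ((k' + 1 - t) + (p + 1 - β))) % 2) (by omega)
      have hn1 := h1.1.pos
      have hn2 := h2.1.pos
      have comb := ab_combine hsymm h1 h2 hd t2 (by
        intro z hz hzX
        obtain ⟨j, hj, rfl⟩ := Finset.mem_image.1 hz
        refine hmemA j (t1 j hj) ?_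
        rintro rfl
        simp [hX'] at hzX)
      rw [hβe] at U'
      refine hno _ ?_ ?_ (hasCyc_of_two hsymm comb U' ?_ ?_)
      · rw [Nat.even_iff]; omega
      · omega
      · intro x hx
        rw [Finset.mem_inter] at hx
        obtain ⟨hx1, hx2⟩ := hx
        obtain ⟨j, hj, rfl⟩ := Finset.mem_image.1 hx2
        simp at hj
        have hjB : y j ∈ Bs := Finset.mem_image_of_mem _ (by simp; omega)
        simp only [Finset.mem_insert, Finset.mem_singleton]
        rcases Finset.mem_union.1 hx1 with hx1 | hx1
        · rcases Finset.mem_union.1 hx1 with hx1 | hx1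
          · exact Or.inl (h1.2.2.2.2.2 _ hx1 hjB)
          · obtain ⟨j', hj', e⟩ := Finset.mem_image.1 hx1
            have := t1 j' hj'
            have := hy.1.1 j' (by omega) j (by omega) e
            have : j = t := by omega
            exact Or.inl (by rw [this])
        · exact Or.inr (h2.2.2.2.2.2 _ hx1 hjB)
      · rw [← hβe]
        intro e
        exact hβt (hy.1.1 t (by omega) β (by omega) e).symm

end


def Cn {V : Type*} (l : List V) (x y : V) : Prop := ∃ A B, l = A ++ x :: y :: B

section con
variable {V : Type*}

theorem gl_cons (A B : List V) (c : V) : (A ++ c :: B).getLast? = (c :: B).getLast? := by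
  simp [List.getLast?_append, List.getLast?_cons]

theorem Cn.left {A : List V} {x y : V} (h : Cn A x y) (B : List V) : Cn (A ++ B) x y := by
  obtain ⟨P, Q, rfl⟩ := h
  exact ⟨P, Q ++ B, by simp⟩

theorem Cn.right {A : List V} {x y : V} (h : Cn A x y) (B : List V) : Cn (B ++ A) x y := by
  obtain ⟨P, Q, rfl⟩ := h
  exact ⟨B ++ P, Q, by simp⟩

theorem Cn.cons {A : List V} {x y : V} (h : Cn A x y) (b : V) : Cn (b :: A) x y := by
  simpa using h.right [b]

theorem Cn.rev {A : List V} {x y : V} (h : Cn A x y) : Cn A.reverse y x := by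
  obtain ⟨P, Q, rfl⟩ := h
  exact ⟨Q.reverse, P.reverse, by simp⟩

theorem Cn.mem1 {A : List V} {x y : V} (h : Cn A x y) : x ∈ A := by
  obtain ⟨P, Q, rfl⟩ := h
  simp

theorem Cn.mem2 {A : List V} {x y : V} (h : Cn A x y) : y ∈ A := by
  obtain ⟨P, Q, rfl⟩ := h
  simp

theorem Cn.split {P Q : List V} {c x y : V} (h : Cn (P ++ c :: Q) x y) (hx : x ≠ c) (hy : y ≠ c) :
    Cn P x y ∨ Cn Q x y := by
  induction P with
  | nil =>
    obtain ⟨A, B, h⟩ := h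
    cases A with
    | nil => simp at h; exact absurd h.1.symm hx
    | cons d A => simp at h; exact Or.inr ⟨A, B, h.2⟩
  | cons p P ih =>
    obtain ⟨A, B, h⟩ := h
    cases A with
    | nil =>
      simp at h
      cases P with
      | nil => simp at h; exact absurd h.2.1.symm hy
      | cons d P => simp at h; exact Or.inl ⟨[], P, by simp [h.1, h.2.1]⟩
    | cons d A =>
      simp at h
      rcases ih ⟨A, B, h.2⟩ with h' | h'
      · exact Or.inl (h'.cons p)
      · exact Or.inr h'

def Con2 (l : List V) (x y : V) : Prop := Cn l x y ∨ Cn l y x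

theorem Con2.left {A : List V} {x y : V} (h : Con2 A x y) (B : List V) : Con2 (A ++ B) x y :=
  h.imp (fun h => h.left B) (fun h => h.left B)
theorem Con2.right {A : List V} {x y : V} (h : Con2 A x y) (B : List V) : Con2 (B ++ A) x y :=
  h.imp (fun h => h.right B) (fun h => h.right B)
theorem Con2.cons {A : List V} {x y : V} (h : Con2 A x y) (b : V) : Con2 (b :: A) x y :=
  h.imp (fun h => h.cons b) (fun h => h.cons b)
theorem Con2.rev {A : List V} {x y : V} (h : Con2 A x y) : Con2 A.reverse x y :=
  (h.imp (fun h => h.rev) (fun h => h.rev)).symm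
theorem Con2.mem1 {A : List V} {x y : V} (h : Con2 A x y) : x ∈ A :=
  h.elim (fun h => h.mem1) (fun h => h.mem2)
theorem Con2.mem2 {A : List V} {x y : V} (h : Con2 A x y) : y ∈ A :=
  h.elim (fun h => h.mem2) (fun h => h.mem1)
theorem Con2.split {P Q : List V} {c x y : V} (h : Con2 (P ++ c :: Q) x y) (hx : x ≠ c) (hy : y ≠ c) :
    Con2 P x y ∨ Con2 Q x y := by
  rcases h with h | h
  · exact (h.split hx hy).imp Or.inl Or.inl
  · exact (h.split hy hx).imp Or.inr Or.inr

def vs (F : List (V × V × V × V)) : List V := F.flatMap (fun q => [q.1, q.2.1, q.2.2.1, q.2.2.2])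

theorem vs_cons (q : V × V × V × V) (F : List (V × V × V × V)) :
    vs (q :: F) = q.1 :: q.2.1 :: q.2.2.1 :: q.2.2.2 :: vs F := by simp [vs]

theorem vs_len (F : List (V × V × V × V)) : (vs F).length = 4 * F.length := by
  induction F with
  | nil => rfl
  | cons q F ih => rw [vs_cons]; simp [ih]; omega

theorem mem_vs {F : List (V × V × V × V)} {q : V × V × V × V} (hq : q ∈ F) :
    q.1 ∈ vs F ∧ q.2.1 ∈ vs F ∧ q.2.2.1 ∈ vs F ∧ q.2.2.2 ∈ vs F := by
  simp only [vs, List.mem_flatMap]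
  exact ⟨⟨q, hq, by simp⟩, ⟨q, hq, by simp⟩, ⟨q, hq, by simp⟩, ⟨q, hq, by simp⟩⟩

end con

section st
variable {V : Type*} [DecidableEq V] {G : SimpleGraph V}

def St (G : SimpleGraph V) (u v : V) (F : List (V × V × V × V)) (l : List V) : Prop :=
  l.Nodup ∧ l.IsChain G.Adj ∧ l.head? = some u ∧ l.getLast? = some v ∧ (vs F).Nodup ∧
  ∀ q ∈ F, Con2 l q.1 q.2.1 ∧ q.2.2.1 ∉ l ∧ q.2.2.2 ∉ l ∧ G.Adj q.1 q.2.2.2 ∧ G.Adj q.2.2.2 q.2.2.1 ∧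
    G.Adj q.2.2.1 q.2.1

theorem St.pop {u v : V} {q} {F l} (h : St G u v (q :: F) l) : St G u v F l := by
  obtain ⟨h1, h2, h3, h4, h5, h6⟩ := h
  refine ⟨h1, h2, h3, h4, ?_, fun q hq => h6 q (by simp [hq])⟩
  rw [vs_cons] at h5
  simp at h5
  exact h5.2.2.2.2

theorem St.expand1 {u v : V} {x y x' y' : V} {F : List (V × V × V × V)} {l : List V} (h : St G u v ((x, y, x', y') :: F) l)
    (hc : Cn l x y) : ∃ l', St G u v F l' ∧ l'.length = l.length + 2 := by
  obtain ⟨h1, h2, h3, h4, h5, h6⟩ := h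
  obtain ⟨A, B, rfl⟩ := hc
  have hq := h6 _ (List.mem_cons_self)
  obtain ⟨-, k2, k3, k4, k5, k6⟩ := hq
  simp only at k2 k3 k4 k5 k6
  rw [vs_cons] at h5
  simp only at h5
  simp only [List.nodup_cons, List.mem_cons, not_or] at h5
  obtain ⟨⟨a1, a2, a3, a4⟩, ⟨b1, b2, b3⟩, ⟨c1, c2⟩, d1, h5⟩ := h5
  refine ⟨A ++ x :: y' :: x' :: y :: B, ⟨?_, ?_, ?_, ?_, h5, ?_⟩, by simp; omega⟩
  · have e : (A ++ x :: y' :: x' :: y :: B).Perm (y' :: x' :: (A ++ x :: y :: B)) := by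
      rw [List.perm_iff_count]; intro z; simp [List.count_cons]; omega
    rw [e.nodup_iff]
    simp only [List.nodup_cons, List.mem_cons, not_or]
    exact ⟨⟨fun h => c1 h.symm, k3⟩, k2, h1⟩
  · rw [List.isChain_append] at h2 ⊢
    refine ⟨h2.1, ?_, by simpa using h2.2.2⟩
    have := h2.2.1
    simp only [List.isChain_cons_cons] at this ⊢
    exact ⟨k4, k5, k6, this.2⟩
  · simpa [List.head?_append] using h3
  · simpa [List.getLast?_append] using h4
  · intro q hq
    obtain ⟨m1, m2, m3, m4, m5, m6⟩ := h6 q (by simp [hq])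
    obtain ⟨v1, v2, v3, v4⟩ := mem_vs hq
    refine ⟨?_, ?_, ?_, m4, m5, m6⟩
    · rcases m1.split (fun h => a4 (h ▸ v1)) (fun h => a4 (h ▸ v2)) with h | h
      · exact h.left _
      · have : A ++ x :: y' :: x' :: y :: B = (A ++ [x, y', x']) ++ y :: B := by simp
        rw [this]; exact h.right _
    · simp only [List.mem_append, List.mem_cons, not_or] at m2 ⊢
      exact ⟨m2.1, m2.2.1, fun h => d1 (h ▸ v3), fun h => c2 (h ▸ v3), m2.2.2⟩
    · simp only [List.mem_append, List.mem_cons, not_or] at m3 ⊢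
      exact ⟨m3.1, m3.2.1, fun h => d1 (h ▸ v4), fun h => c2 (h ▸ v4), m3.2.2⟩

theorem St.expand {u v : V} {q : V × V × V × V} {F : List (V × V × V × V)} {l : List V} (h : St G u v (q :: F) l) :
    ∃ l', St G u v F l' ∧ l'.length = l.length + 2 := by
  obtain ⟨x, y, x', y'⟩ := q
  have h' := h
  obtain ⟨h1, h2, h3, h4, h5, h6⟩ := h
  rcases (h6 _ List.mem_cons_self).1 with hc | hc
  · exact h'.expand1 hc
  · refine St.expand1 (x := y) (y := x) (x' := y') (y' := x') ⟨h1, h2, h3, h4, ?_, ?_⟩ hc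
    · have e : (vs ((y, x, y', x') :: F)).Perm (vs ((x, y, x', y') :: F)) := by
        rw [vs_cons, vs_cons, List.perm_iff_count]; intro z; simp [List.count_cons]; omega
      rw [e.nodup_iff]; exact h5
    · intro q hq
      rcases List.mem_cons.1 hq with rfl | hq
      · obtain ⟨m1, m2, m3, m4, m5, m6⟩ := h6 _ List.mem_cons_self
        exact ⟨m1.symm, m3, m2, m6.symm, m5.symm, m4.symm⟩
      · exact h6 q (by simp [hq])

theorem St.cyc {u v : V} (huv : G.Adj v u) {F : List (V × V × V × V)} {l : List V} (h : St G u v F l) (j : ℕ)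
    (hj : j ≤ F.length) : HasCyc G.Adj (l.length + 2 * j) := by
  induction j generalizing F l with
  | zero => exact ⟨_, u, v, ⟨l, h.1, h.2.1, h.2.2.1, h.2.2.2.1, rfl, rfl⟩, huv⟩
  | succ j ih =>
    cases F with
    | nil => simp at hj
    | cons q F =>
      obtain ⟨l', h1, h2⟩ := h.expand
      have := ih h1 (by simpa using hj)
      rw [h2] at this
      convert this using 1; omega

theorem op_ext {u v : V} {F : List (V × V × V × V)} {A P B : List V} {a b c z z' : V}
    (h : St G u v F (A ++ a :: (P ++ c :: B))) (hb : b ∈ P) (hz : z ∉ A ++ a :: (P ++ c :: B))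
    (hz' : z' ∉ A ++ a :: (P ++ c :: B)) (hzz : z ≠ z') (hzF : z ∉ vs F) (hzF' : z' ∉ vs F)
    (ha : a ∉ vs F) (hc : c ∉ vs F) (hP : ∀ p ∈ P, p ∉ vs F)
    (e1 : G.Adj a z) (e2 : G.Adj z c) (e3 : G.Adj z b) (e4 : G.Adj b z') (e5 : G.Adj z' c) :
    St G u v ((z, c, z', b) :: F) (A ++ a :: z :: c :: B) := by
  obtain ⟨h1, h2, h3, h4, h5, h6⟩ := h
  have hn := h1
  simp only [List.mem_append, List.mem_cons, not_or] at hz hz'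
  have hbc : b ≠ c ∧ b ∉ A ∧ b ≠ a ∧ b ∉ B := by
    rw [List.nodup_append', List.nodup_cons, List.nodup_append', List.nodup_cons] at h1
    obtain ⟨n1, ⟨n2, n3, ⟨n4, n5⟩, n6⟩, n7⟩ := h1
    refine ⟨?_, ?_, ?_, ?_⟩
    · rintro rfl; exact n6 hb (by simp)
    · intro h; exact n7 h (by simp [hb])
    · rintro rfl; exact n2 (by simp [hb])
    · intro h; exact n6 hb (by simp [h])
  refine ⟨?_, ?_, ?_, ?_, ?_, ?_⟩
  · have e : (A ++ a :: z :: c :: B).Perm (z :: (A ++ a :: c :: B)) := by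
      rw [List.perm_iff_count]; intro z; simp [List.count_cons]; omega
    rw [e.nodup_iff, List.nodup_cons]
    refine ⟨?_, ?_⟩
    · simp only [List.mem_append, List.mem_cons, not_or]
      exact ⟨hz.1, hz.2.1, hz.2.2.2⟩
    · refine h1.sublist ?_
      refine (List.Sublist.refl A).append (List.Sublist.cons_cons a ?_)
      exact List.sublist_append_right P _
  · rw [List.isChain_append] at h2 ⊢
    refine ⟨h2.1, ?_, by simpa using h2.2.2⟩
    simp only [List.isChain_cons_cons]
    refine ⟨e1, e2, ?_⟩
    have := h2.2.1.tail
    simp only [List.tail_cons] at this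
    rw [List.isChain_append] at this
    exact this.2.1
  · simpa [List.head?_append] using h3
  · have e1 : A ++ a :: (P ++ c :: B) = (A ++ a :: P) ++ c :: B := by simp
    have e2 : A ++ a :: z :: c :: B = (A ++ [a, z]) ++ c :: B := by simp
    rw [e1, gl_cons] at h4
    rw [e2, gl_cons]; exact h4
  · rw [vs_cons]
    simp only [List.nodup_cons, List.mem_cons, not_or]
    refine ⟨⟨hz.2.2.2.1, hzz, ?_, hzF⟩, ⟨fun h => hz'.2.2.2.1 h.symm, fun h => hbc.1 h.symm, hc⟩, ⟨?_, hzF'⟩, hP b hb, h5⟩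
    · rintro rfl; exact hz.2.2.1 hb
    · rintro rfl; exact hz'.2.2.1 hb
  · intro q hq
    rcases List.mem_cons.1 hq with rfl | hq
    · simp only
      refine ⟨Or.inl ⟨A ++ [a], B, by simp⟩, ?_, ?_, e3, e4, e5⟩
      · simp only [List.mem_append, List.mem_cons, not_or]
        exact ⟨hz'.1, hz'.2.1, fun h => hzz h.symm, hz'.2.2.2⟩
      · simp only [List.mem_append, List.mem_cons, not_or]
        exact ⟨hbc.2.1, hbc.2.2.1, fun h => hz.2.2.1 (h ▸ hb), hbc.1, hbc.2.2.2⟩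
    · obtain ⟨m1, m2, m3, m4, m5, m6⟩ := h6 q hq
      obtain ⟨v1, v2, v3, v4⟩ := mem_vs hq
      refine ⟨?_, ?_, ?_, m4, m5, m6⟩
      · rcases m1.split (fun h => ha (h ▸ v1)) (fun h => ha (h ▸ v2)) with h | h
        · exact h.left _
        · rcases h.split (fun h => hc (h ▸ v1)) (fun h => hc (h ▸ v2)) with h | h
          · exact absurd v1 (hP _ h.mem1)
          · have : A ++ a :: z :: c :: B = (A ++ [a, z, c]) ++ B := by simp
            rw [this]; exact h.right _
      · simp only [List.mem_append, List.mem_cons, not_or] at m2 ⊢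
        exact ⟨m2.1, m2.2.1, fun h => hzF (h ▸ v3), m2.2.2.2⟩
      · simp only [List.mem_append, List.mem_cons, not_or] at m3 ⊢
        exact ⟨m3.1, m3.2.1, fun h => hzF (h ▸ v4), m3.2.2.2⟩

theorem op_int {u v : V} {F : List (V × V × V × V)} {A P M Q B : List V} {a b c z1 z2 z3 : V}
    (h : St G u v F (A ++ a :: (P ++ c :: (M ++ z1 :: (Q ++ z3 :: B))))) (hb : b ∈ P) (hz2 : z2 ∈ Q)
    (ha : a ∉ vs F) (hc : c ∉ vs F) (hz1F : z1 ∉ vs F) (hz3F : z3 ∉ vs F)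
    (hP : ∀ p ∈ P, p ∉ vs F) (hQ : ∀ p ∈ Q, p ∉ vs F)
    (e1 : G.Adj a z1) (e2 : G.Adj a z2) (e3 : G.Adj b z1) (e4 : G.Adj b z2) (e5 : G.Adj c z3) :
    St G u v ((a, z1, b, z2) :: F) (A ++ a :: z1 :: (M.reverse ++ c :: z3 :: B)) := by
  obtain ⟨h1, h2, h3, h4, h5, h6⟩ := h
  have hperm : (A ++ a :: (P ++ c :: (M ++ z1 :: (Q ++ z3 :: B)))).Perm
      ((P ++ Q) ++ (A ++ a :: z1 :: (M.reverse ++ c :: z3 :: B))) := by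
    rw [List.perm_iff_count]; intro z; simp [List.count_cons]; omega
  have h1' := hperm.nodup_iff.1 h1
  rw [List.nodup_append'] at h1'
  obtain ⟨n1, n2, n3⟩ := h1'
  have hmem : ∀ x, x ∈ (A ++ a :: z1 :: (M.reverse ++ c :: z3 :: B)) → x ∈ (A ++ a :: (P ++ c :: (M ++ z1 :: (Q ++ z3 :: B)))) := by
    intro x hx; rw [hperm.mem_iff]; exact List.mem_append_right _ hx
  have hbl : b ∉ (A ++ a :: z1 :: (M.reverse ++ c :: z3 :: B)) := fun h => n3 (by simp [hb]) h
  have hzl : z2 ∉ (A ++ a :: z1 :: (M.reverse ++ c :: z3 :: B)) := fun h => n3 (by simp [hz2]) h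
  have hbz : b ≠ z2 := by
    rintro rfl
    rw [List.nodup_append'] at n1
    exact n1.2.2 hb hz2
  refine ⟨n2, ?_, ?_, ?_, ?_, ?_⟩
  · rw [List.isChain_append] at h2
    have k1 := h2.2.1.tail
    simp only [List.tail_cons] at k1
    rw [List.isChain_append] at k1
    have k2 := k1.2.1
    have e : c :: (M ++ z1 :: (Q ++ z3 :: B)) = (c :: (M ++ [z1])) ++ (Q ++ z3 :: B) := by simp
    rw [e, List.isChain_append] at k2
    have k3 := k2.2.1
    rw [List.isChain_append] at k3
    have k4 : (c :: (M ++ [z1])).reverse.IsChain G.Adj := by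
      rw [List.isChain_reverse]; exact k2.1.imp (fun _ _ h => h.symm)
    have k5 : ((c :: (M ++ [z1])).reverse ++ (z3 :: B)).IsChain G.Adj := by
      rw [List.isChain_append]
      refine ⟨k4, k3.2.1, ?_⟩
      intro x hx y hy
      rw [List.getLast?_reverse] at hx
      simp at hx hy
      rw [← hx, ← hy]; exact e5
    rw [List.isChain_append]
    refine ⟨h2.1, ?_, by simpa using h2.2.2⟩
    have e' : z1 :: (M.reverse ++ c :: z3 :: B) = ((c :: (M ++ [z1])).reverse ++ (z3 :: B)) := by simp
    rw [List.isChain_cons_cons, e']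
    exact ⟨e1, k5⟩
  · simpa [List.head?_append] using h3
  · have e1 : A ++ a :: (P ++ c :: (M ++ z1 :: (Q ++ z3 :: B))) = (A ++ a :: (P ++ c :: (M ++ z1 :: Q))) ++ z3 :: B := by simp
    have e2 : A ++ a :: z1 :: (M.reverse ++ c :: z3 :: B) = (A ++ a :: z1 :: (M.reverse ++ [c])) ++ z3 :: B := by simp
    rw [e1, gl_cons] at h4
    rw [e2, gl_cons]; exact h4
  · rw [vs_cons]
    simp only [List.nodup_cons, List.mem_cons, not_or]
    simp only [List.mem_append, List.mem_cons, not_or] at hbl hzl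
    exact ⟨⟨e1.ne, fun h => hbl.2.1 h.symm, e2.ne, ha⟩, ⟨e3.ne', fun h => hzl.2.2.1 h.symm, hz1F⟩, ⟨hbz, hP b hb⟩, hQ _ hz2, h5⟩
  · intro q hq
    rcases List.mem_cons.1 hq with rfl | hq
    · simp only
      exact ⟨Or.inl ⟨A, _, rfl⟩, hbl, hzl, e2, e4.symm, e3⟩
    · obtain ⟨m1, m2, m3, m4, m5, m6⟩ := h6 q hq
      obtain ⟨v1, v2, v3, v4⟩ := mem_vs hq
      refine ⟨?_, fun h => m2 (hmem _ h), fun h => m3 (hmem _ h), m4, m5, m6⟩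
      rcases m1.split (fun h => ha (h ▸ v1)) (fun h => ha (h ▸ v2)) with h | h
      · exact h.left _
      rcases h.split (fun h => hc (h ▸ v1)) (fun h => hc (h ▸ v2)) with h | h
      · exact absurd v1 (hP _ h.mem1)
      rcases h.split (fun h => hz1F (h ▸ v1)) (fun h => hz1F (h ▸ v2)) with h | h
      · exact (((h.rev.left _).cons _).cons _).right _
      rcases h.split (fun h => hz3F (h ▸ v1)) (fun h => hz3F (h ▸ v2)) with h | h
      · exact absurd v1 (hQ _ h.mem1)
      have : A ++ a :: z1 :: (M.reverse ++ c :: z3 :: B) = (A ++ a :: z1 :: (M.reverse ++ [c, z3])) ++ B := by simp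
      rw [this]; exact h.right _

end st


theorem c4free (e h C S k : ℕ) (hC : 1 ≤ C) (hh : h = 1024 * C ^ 2) (he : 61440 * C ^ 3 ≤ e)
    (h1 : e ^ 2 ≤ h * S) (h2 : S ≤ k + e) (h3 : k ≤ h * h) : False := by
  have hc : C ^ 2 ≤ C ^ 3 := Nat.pow_le_pow_right hC (by norm_num)
  have hc6 : 1 ≤ C ^ 6 := Nat.one_le_pow _ _ hC
  have a1 : e ^ 2 ≤ h * (h * h + e) := h1.trans (Nat.mul_le_mul_left _ (by omega))
  have a2 : h * e ≤ 1024 * C ^ 3 * e := Nat.mul_le_mul_right _ (by rw [hh]; omega)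
  have a3 : 61440 * C ^ 3 * e ≤ e ^ 2 := by rw [pow_two]; exact Nat.mul_le_mul_right _ he
  have a4 : h * (h * h) = 1073741824 * C ^ 6 := by rw [hh]; ring
  have a5 : 60416 * C ^ 3 * (61440 * C ^ 3) ≤ 60416 * C ^ 3 * e := Nat.mul_le_mul_left _ he
  have a6 : 60416 * C ^ 3 * (61440 * C ^ 3) = 3711959040 * C ^ 6 := by ring
  rw [a6] at a5
  have a7 : h * (h * h + e) = h * (h * h) + h * e := by ring
  rw [a7, a4] at a1
  have a8 : 61440 * C ^ 3 * e = 60416 * C ^ 3 * e + 1024 * C ^ 3 * e := by ring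
  omega

theorem c4dom {h C : ℕ} (hC : 1 ≤ C) (hh : h = 1024 * C ^ 2) (E : Finset (ℕ × ℕ)) (I J : Finset ℕ)
    (hE : ∀ p ∈ E, p.1 ∈ I ∧ p.2 ∈ J) (hI : I.card ≤ h) (hJ : J.card ≤ h) (i0 j0 : ℕ)
    (hi0 : ∀ i ∈ I, i0 ≤ i ∧ i < i0 + 2 * h) (hj0 : ∀ i ∈ J, j0 ≤ i ∧ i < j0 + 2 * h)
    (hcard : 65536 * C ^ 3 ≤ E.card) :
    ∃ a b c z1 z2 z3, a < b ∧ b < c ∧ z1 < z2 ∧ z2 < z3 ∧ (a, z1) ∈ E ∧ (a, z2) ∈ E ∧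
      (b, z1) ∈ E ∧ (b, z2) ∈ E ∧ (c, z3) ∈ E := by
  classical
  set U := E.filter (fun p => ¬ ∃ p' ∈ E, p.1 < p'.1 ∧ p.2 < p'.2) with hU
  have hUc : U.card ≤ 4 * h := by
    have : U.card ≤ (Finset.range (4 * h)).card := by
      apply Finset.card_le_card_of_injOn (fun p => (p.1 - i0) + (j0 + 2 * h - p.2))
      · intro p hp
        rw [Finset.mem_coe, hU, Finset.mem_filter] at hp
        have := hi0 _ (hE p hp.1).1
        have := hj0 _ (hE p hp.1).2
        simp; omega
      · intro p hp p' hp' hpp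
        rw [Finset.mem_coe, hU, Finset.mem_filter] at hp hp'
        have b1 := hi0 _ (hE p hp.1).1
        have b2 := hj0 _ (hE p hp.1).2
        have b3 := hi0 _ (hE p' hp'.1).1
        have b4 := hj0 _ (hE p' hp'.1).2
        simp only at hpp
        rcases lt_trichotomy p.1 p'.1 with h | h | h
        · exact absurd ⟨p', hp'.1, h, by omega⟩ hp.2
        · exact Prod.ext h (by omega)
        · exact absurd ⟨p, hp.1, h, by omega⟩ hp'.2
    simpa using this
  set E' := E \ U with hE'
  have hE'E : ∀ p ∈ E', p ∈ E := fun p hp => (Finset.mem_sdiff.1 hp).1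
  have hdom : ∀ p ∈ E', ∃ p' ∈ E, p.1 < p'.1 ∧ p.2 < p'.2 := by
    intro p hp
    by_contra hc
    exact (Finset.mem_sdiff.1 hp).2 (by rw [hU, Finset.mem_filter]; exact ⟨hE'E p hp, hc⟩)
  have hE'c : 61440 * C ^ 3 ≤ E'.card := by
    have := Finset.le_card_sdiff U E
    rw [← hE'] at this
    have hc : C ^ 2 ≤ C ^ 3 := Nat.pow_le_pow_right hC (by norm_num)
    omega
  set S := (E' ×ˢ E').filter (fun p => p.1.1 = p.2.1) with hS
  set Ch := S.filter (fun p => p.1.2 ≠ p.2.2) with hCh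
  have hS1 : S.card = ∑ x ∈ I, (E'.filter (fun p => p.1 = x)).card ^ 2 := by
    rw [Finset.card_eq_sum_card_fiberwise (f := fun p => p.1.1) (t := I)]
    · apply Finset.sum_congr rfl
      intro x hx
      rw [pow_two, ← Finset.card_product]
      congr 1
      ext p
      simp only [hS, Finset.mem_filter, Finset.mem_product]
      constructor
      · rintro ⟨⟨⟨a, b⟩, c⟩, d⟩
        exact ⟨⟨a, d⟩, b, c ▸ d⟩
      · rintro ⟨⟨a, b⟩, c, d⟩
        exact ⟨⟨⟨a, c⟩, b.trans d.symm⟩, b⟩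
    · intro p hp
      rw [Finset.mem_coe, hS, Finset.mem_filter, Finset.mem_product] at hp
      exact (hE _ (hE'E _ hp.1.1)).1
  have hE1 : E'.card = ∑ x ∈ I, (E'.filter (fun p => p.1 = x)).card := by
    rw [Finset.card_eq_sum_card_fiberwise (f := fun p => p.1) (t := I)]
    intro p hp
    exact (hE _ (hE'E _ hp)).1
  have hCS : E'.card ^ 2 ≤ h * S.card := by
    rw [hS1]
    calc E'.card ^ 2 ≤ I.card * ∑ x ∈ I, (E'.filter (fun p => p.1 = x)).card ^ 2 := by
          conv_lhs => rw [hE1]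
          exact sq_sum_le_card_mul_sum_sq
      _ ≤ _ := Nat.mul_le_mul_right _ hI
  have hS2 : S.card ≤ Ch.card + E'.card := by
    rw [← Finset.card_filter_add_card_filter_not (s := S) (fun p => p.1.2 ≠ p.2.2)]
    apply Nat.add_le_add_left
    apply Finset.card_le_card_of_injOn (fun p => p.1)
    · intro p hp
      simp only [Finset.mem_coe, hS, Finset.mem_filter, Finset.mem_product] at hp
      exact hp.1.1.1
    · intro p hp p' hp' hpp
      simp only [Finset.mem_coe, hS, Finset.mem_filter, Finset.mem_product, not_not] at hp hp'
      simp only at hpp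
      refine Prod.ext hpp (Prod.ext ?_ ?_)
      · rw [← hp.1.2, ← hp'.1.2, hpp]
      · rw [← hp.2, ← hp'.2, hpp]
  have hpig : ∃ p ∈ Ch, ∃ p' ∈ Ch, p ≠ p' ∧ (p.1.2, p.2.2) = (p'.1.2, p'.2.2) := by
    apply Finset.exists_ne_map_eq_of_card_lt_of_maps_to (t := J ×ˢ J)
    · by_contra hc
      push Not at hc
      rw [Finset.card_product] at hc
      exact c4free _ h C _ _ hC hh hE'c hCS hS2 (hc.trans (Nat.mul_le_mul hJ hJ))
    · intro p hp
      simp only [Finset.mem_coe, hCh, hS, Finset.mem_filter, Finset.mem_product] at hp ⊢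
      exact ⟨(hE _ (hE'E _ hp.1.1.1)).2, (hE _ (hE'E _ hp.1.1.2)).2⟩
  have key : ∀ x x' y y', x < x' → y < y' → (x, y) ∈ E' → (x, y') ∈ E' → (x', y) ∈ E' → (x', y') ∈ E' →
      ∃ a b c z1 z2 z3, a < b ∧ b < c ∧ z1 < z2 ∧ z2 < z3 ∧ (a, z1) ∈ E ∧ (a, z2) ∈ E ∧
      (b, z1) ∈ E ∧ (b, z2) ∈ E ∧ (c, z3) ∈ E := by
    intro x x' y y' hx hy q1 q2 q3 q4
    obtain ⟨⟨c, z⟩, hp, h1, h2⟩ := hdom _ q4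
    exact ⟨x, x', c, y, y', z, hx, h1, hy, h2, hE'E _ q1, hE'E _ q2, hE'E _ q3, hE'E _ q4, hp⟩
  obtain ⟨⟨⟨x, y⟩, ⟨w, y'⟩⟩, hp, ⟨⟨x', u⟩, ⟨w', u'⟩⟩, hp', hne, he⟩ := hpig
  simp only [hCh, hS, Finset.mem_filter, Finset.mem_product, Prod.mk.injEq] at hp hp' he
  obtain ⟨⟨⟨q1, q2⟩, rfl⟩, q3⟩ := hp
  obtain ⟨⟨⟨q1', q2'⟩, rfl⟩, q3'⟩ := hp'
  obtain ⟨rfl, rfl⟩ := he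
  have hxx : x ≠ x' := by rintro rfl; exact hne rfl
  rcases Nat.lt_or_gt_of_ne hxx with h1 | h1 <;> rcases Nat.lt_or_gt_of_ne q3 with h2 | h2
  · exact key x x' y y' h1 h2 q1 q2 q1' q2'
  · exact key x x' y' y h1 h2 q2 q1 q2' q1'
  · exact key x' x y y' h1 h2 q1' q2' q1 q2
  · exact key x' x y' y h1 h2 q2' q1' q2 q1

/-- three common neighbours by pigeonhole -/
theorem triple {V : Type*} [DecidableEq V] {h C m : ℕ} (hC : 5 ≤ C) (hh : h = 1024 * C ^ 2)
    (hm : 17280000000 * C ^ 9 ≤ m) (Q : Finset ℕ) (hQ : Q.card ≤ h) (Z : Finset V) (hZ : Z.card ≤ C * m)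
    (r : ℕ → V → Prop) [∀ a b, Decidable (r a b)]
    (hE : 64 * C ^ 2 * m ≤ ∑ i ∈ Q, (Z.filter (fun z => r i z)).card) :
    ∃ a b c z z', a ∈ Q ∧ b ∈ Q ∧ c ∈ Q ∧ a < b ∧ b < c ∧ z ∈ Z ∧ z' ∈ Z ∧ z ≠ z' ∧
      r a z ∧ r b z ∧ r c z ∧ r a z' ∧ r b z' ∧ r c z' := by
  classical
  have hsw : ∑ i ∈ Q, (Z.filter (fun z => r i z)).card = ∑ z ∈ Z, (Q.filter (fun i => r i z)).card :=
    Finset.sum_card_bipartiteAbove_eq_sum_card_bipartiteBelow r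
  set Z3 := Z.filter (fun z => 3 ≤ (Q.filter (fun i => r i z)).card) with hZ3
  have hub : ∑ z ∈ Z, (Q.filter (fun i => r i z)).card ≤ Z3.card * h + Z.card * 2 := by
    rw [← Finset.sum_filter_add_sum_filter_not Z (fun z => 3 ≤ (Q.filter (fun i => r i z)).card)]
    apply Nat.add_le_add
    · rw [← smul_eq_mul]
      apply Finset.sum_le_card_nsmul
      intro z hz
      exact (Finset.card_filter_le _ _).trans hQ
    · rw [← smul_eq_mul]
      refine (Finset.sum_le_card_nsmul _ _ 2 ?_).trans ?_
      · intro z hz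
        rw [Finset.mem_filter] at hz
        omega
      · rw [smul_eq_mul, smul_eq_mul]; exact Nat.mul_le_mul_right _ (Finset.card_filter_le _ _)
  have hlarge : h * (h * h) < Z3.card := by
    by_contra hc
    push Not at hc
    have a1 : Z3.card * h ≤ h * (h * h) * h := Nat.mul_le_mul_right _ hc
    have a2 : 64 * C ^ 2 * m ≤ h * (h * h) * h + C * m * 2 := by
      rw [hsw] at hE
      refine hE.trans (hub.trans (Nat.add_le_add a1 (Nat.mul_le_mul_right _ hZ)))
    have a3 : h * (h * h) * h = 1099511627776 * C ^ 8 := by rw [hh]; ring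
    have a4 : C * m ≤ C ^ 2 * m := Nat.mul_le_mul_right _ (Nat.le_self_pow (by norm_num) C)
    have a5 : C ^ 2 * (17280000000 * C ^ 9) ≤ C ^ 2 * m := Nat.mul_le_mul_left _ hm
    have a6 : C ^ 2 * (17280000000 * C ^ 9) = 17280000000 * (C ^ 3 * C ^ 8) := by ring
    have a7 : 5 ^ 3 * C ^ 8 ≤ C ^ 3 * C ^ 8 := Nat.mul_le_mul_right _ (Nat.pow_le_pow_left hC 3)
    have a8 : 1 ≤ C ^ 8 := Nat.one_le_pow _ _ (by omega)
    have a9 : 64 * C ^ 2 * m = 64 * (C ^ 2 * m) := by ring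
    have a10 : C * m * 2 = 2 * (C * m) := by ring
    omega
  have hch : ∀ z : V, ∃ t : ℕ × ℕ × ℕ, z ∈ Z3 → t.1 ∈ Q ∧ t.2.1 ∈ Q ∧ t.2.2 ∈ Q ∧ t.1 < t.2.1 ∧ t.2.1 < t.2.2 ∧
      r t.1 z ∧ r t.2.1 z ∧ r t.2.2 z := by
    intro z
    by_cases hz : z ∈ Z3
    · rw [hZ3, Finset.mem_filter] at hz
      obtain ⟨t, ht, htc⟩ := Finset.exists_subset_card_eq hz.2
      refine ⟨(t.orderEmbOfFin htc 0, t.orderEmbOfFin htc 1, t.orderEmbOfFin htc 2), fun _ => ?_⟩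
      have q : ∀ i, t.orderEmbOfFin htc i ∈ Q.filter (fun i => r i z) := fun i => ht (Finset.orderEmbOfFin_mem t htc i)
      simp only [Finset.mem_filter] at q
      refine ⟨(q 0).1, (q 1).1, (q 2).1, ?_, ?_, (q 0).2, (q 1).2, (q 2).2⟩
      · exact (t.orderEmbOfFin htc).strictMono (by decide)
      · exact (t.orderEmbOfFin htc).strictMono (by decide)
    · exact ⟨(0, 0, 0), fun h => absurd h hz⟩
  choose f hf using hch
  obtain ⟨z, hz, z', hz', hne, he⟩ : ∃ z ∈ Z3, ∃ z' ∈ Z3, z ≠ z' ∧ f z = f z' := by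
    apply Finset.exists_ne_map_eq_of_card_lt_of_maps_to (t := Q ×ˢ (Q ×ˢ Q))
    · rw [Finset.card_product, Finset.card_product]
      exact lt_of_le_of_lt (Nat.mul_le_mul hQ (Nat.mul_le_mul hQ hQ)) hlarge
    · intro z hz
      have := hf z hz
      simp only [Finset.mem_coe, Finset.mem_product]
      exact ⟨this.1, this.2.1, this.2.2.1⟩
  obtain ⟨p1, p2, p3, p4, p5, p6, p7, p8⟩ := hf z hz
  obtain ⟨-, -, -, -, -, p6', p7', p8'⟩ := hf z' hz'
  rw [← he] at p6' p7' p8'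
  exact ⟨_, _, _, z, z', p1, p2, p3, p4, p5, (Finset.mem_filter.1 hz).1, (Finset.mem_filter.1 hz').1, hne,
    p6, p7, p8, p6', p7', p8'⟩


section dec
variable {V : Type*}

theorem dec1 (l : List V) (u : V) {i : ℕ} (hi : i < l.length) :
    l = l.take i ++ l.getD i u :: l.drop (i + 1) := by
  have h1 : l.getD i u = l[i] := by simp [hi]
  rw [h1, List.getElem_cons_drop, List.take_append_drop]

theorem dec2 (l : List V) (u : V) {a c : ℕ} (hac : a < c) (hc : c < l.length) :
    ∃ A P B, l = A ++ l.getD a u :: (P ++ l.getD c u :: B) ∧ A.length = a ∧ P.length = c - a - 1 ∧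
      B.length = l.length - c - 1 ∧
      (∀ b, a < b → b < c → l.getD b u ∈ P) ∧ (∀ p ∈ P, ∃ b, a < b ∧ b < c ∧ l.getD b u = p) ∧
      (∀ i, B.getD i u = l.getD (c + 1 + i) u) := by
  have h1 := dec1 l u (hac.trans hc)
  have hD : ∀ i, (l.drop (a + 1)).getD i u = l.getD (a + 1 + i) u := by
    intro i; simp [List.getD_eq_getElem?_getD, List.getElem?_drop]
  have h2 := dec1 (l.drop (a + 1)) u (i := c - a - 1) (by simp; omega)
  rw [hD, show a + 1 + (c - a - 1) = c by omega] at h2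
  refine ⟨l.take a, (l.drop (a + 1)).take (c - a - 1), (l.drop (a + 1)).drop (c - a - 1 + 1), ?_, by simp; omega,
    by simp; omega, by simp; omega, ?_, ?_, ?_⟩
  · rw [← h2]; exact h1
  · intro b hab hbc
    rw [List.mem_iff_getElem?]
    refine ⟨b - a - 1, ?_⟩
    rw [List.getElem?_take, if_pos (by omega), List.getElem?_drop, show a + 1 + (b - a - 1) = b by omega]
    simp [List.getElem?_eq_getElem (hbc.trans hc)]
  · intro p hp
    rw [List.mem_iff_getElem?] at hp
    obtain ⟨i, hi⟩ := hp
    rw [List.getElem?_take] at hi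
    split_ifs at hi with hi'
    rw [List.getElem?_drop] at hi
    exact ⟨a + 1 + i, by omega, by omega, by simp [hi]⟩
  · intro i
    simp only [List.getD_eq_getElem?_getD, List.getElem?_drop]
    congr 2; omega

end dec

section ops
variable {V : Type*} [DecidableEq V] {G : SimpleGraph V}

theorem op_ext_pos {u v w : V} {F : List (V × V × V × V)} {l : List V} {a b c : ℕ} {z z' : V}
    (h : St G u v F l) (hab : a < b) (hbc : b < c) (hc : c < l.length) (hz : z ∉ l) (hz' : z' ∉ l) (hzz : z ≠ z')
    (hzF : z ∉ vs F) (hzF' : z' ∉ vs F) (hF : ∀ i, a ≤ i → i ≤ c → l.getD i w ∉ vs F)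
    (e1 : G.Adj (l.getD a w) z) (e2 : G.Adj (l.getD b w) z) (e3 : G.Adj (l.getD c w) z)
    (e4 : G.Adj (l.getD b w) z') (e5 : G.Adj (l.getD c w) z') :
    ∃ F' l', St G u v F' l' ∧ F'.length = F.length + 1 ∧ l'.length + (c - a) = l.length + 2 := by
  obtain ⟨A, P, B, hl, lA, lP, lB, p1, p2, -⟩ := dec2 l w (hab.trans hbc) hc
  have h' := h
  rw [hl] at h' hz hz'
  refine ⟨_, _, op_ext h' (p1 b hab hbc) hz hz' hzz hzF hzF' (hF a le_rfl (by omega)) (hF c (by omega) le_rfl) ?_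
    e1 e3.symm e2.symm e4 e5.symm, by simp, ?_⟩
  · intro p hp
    obtain ⟨i, h1, h2, rfl⟩ := p2 p hp
    exact hF i h1.le h2.le
  · simp; omega

theorem op_int_pos {u v w : V} {F : List (V × V × V × V)} {l : List V} {a b c z1 z2 z3 : ℕ}
    (h : St G u v F l) (hab : a < b) (hbc : b < c) (hcz : c < z1) (hz : z1 < z2) (hz' : z2 < z3) (hc : z3 < l.length)
    (hF : ∀ i, a ≤ i → i ≤ c → l.getD i w ∉ vs F) (hF' : ∀ i, z1 ≤ i → i ≤ z3 → l.getD i w ∉ vs F)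
    (e1 : G.Adj (l.getD a w) (l.getD z1 w)) (e2 : G.Adj (l.getD a w) (l.getD z2 w))
    (e3 : G.Adj (l.getD b w) (l.getD z1 w)) (e4 : G.Adj (l.getD b w) (l.getD z2 w))
    (e5 : G.Adj (l.getD c w) (l.getD z3 w)) :
    ∃ F' l', St G u v F' l' ∧ F'.length = F.length + 1 ∧ l'.length + ((c - a) + (z3 - z1)) = l.length + 2 := by
  obtain ⟨A, P, B, hl, lA, lP, lB, p1, p2, p3⟩ := dec2 l w (hab.trans hbc) (show c < l.length by omega)
  obtain ⟨M, Q, D, hB, lM, lQ, lD, q1, q2, -⟩ := dec2 B w (a := z1 - c - 1) (c := z3 - c - 1) (by omega) (by omega)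
  rw [p3, p3, show c + 1 + (z1 - c - 1) = z1 by omega, show c + 1 + (z3 - c - 1) = z3 by omega] at hB
  have h' := h
  rw [hl, hB] at h'
  have hz2 := q1 (z2 - c - 1) (by omega) (by omega)
  rw [p3, show c + 1 + (z2 - c - 1) = z2 by omega] at hz2
  refine ⟨_, _, op_int h' (p1 b hab hbc) hz2 (hF a le_rfl (by omega)) (hF c (by omega) le_rfl)
    (hF' z1 le_rfl (by omega)) (hF' z3 (by omega) le_rfl) ?_ ?_ e1 e2 e3 e4 e5, by simp, ?_⟩
  · intro p hp
    obtain ⟨i, h1, h2, rfl⟩ := p2 p hp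
    exact hF i h1.le h2.le
  · intro p hp
    obtain ⟨i, h1, h2, rfl⟩ := q2 p hp
    rw [p3]
    exact hF' _ (by omega) (by omega)
  · simp; omega

variable [Fintype V] [DecidableRel G.Adj]

theorem op {C m h : ℕ} (hC : 5 ≤ C) (hh : h = 1024 * C ^ 2) (hm : 17280000000 * C ^ 9 ≤ m)
    (hN : Fintype.card V ≤ C * m) (hdeg : ∀ v, m ≤ 2 * (Finset.univ.filter (G.Adj v)).card)
    {u v : V} {F : List (V × V × V × V)} {l : List V} (hst : St G u v F l) (hFl : F.length ≤ 2 * h)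
    (hlm : m ≤ l.length) :
    ∃ F' l' d, St G u v F' l' ∧ F'.length = F.length + 1 ∧ Even d ∧ 2 ≤ d ∧ d ≤ 4 * h ∧ l'.length + d = l.length := by
  classical
  set n := l.length with hn
  set y : ℕ → V := fun i => l.getD i u with hy
  have hnN : n ≤ C * m := (hst.1.length_le_card).trans hN
  have hinj : ∀ i, i < n → ∀ j, j < n → y i = y j → i = j := by
    intro i hi j hj hij
    simp only [hy, List.getD_eq_getElem _ _ hi, List.getD_eq_getElem _ _ hj] at hij
    exact (List.Nodup.getElem_inj_iff hst.1).1 hij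
  have hsurj : ∀ x ∈ l, ∃ i, i < n ∧ y i = x := by
    intro x hx
    obtain ⟨i, hi, rfl⟩ := List.getElem_of_mem hx
    exact ⟨i, hi, by simp only [hy, List.getD_eq_getElem _ _ hi]⟩
  have hhpos : 0 < h := by rw [hh]; positivity
  -- arithmetic
  have hc24 : C ^ 4 ≤ C ^ 9 := Nat.pow_le_pow_right (by omega) (by norm_num)
  have hc2 : C ^ 2 ≤ C ^ 4 := Nat.pow_le_pow_right (by omega) (by norm_num)
  have hc0 : 1 ≤ C ^ 2 := Nat.one_le_pow _ _ (by omega)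
  have hhh : h * h = 1048576 * C ^ 4 := by rw [hh]; ring
  have hhm : (8 * h + 2) * (2 * h) * 8 ≤ m := by
    have : (8 * h + 2) * (2 * h) * 8 = 128 * (h * h) + 32 * h := by ring
    rw [this, hhh, hh]; omega
  have hhm2 : (8 * h + 2) * (2 * h) ≤ m := by omega
  set T := n / (2 * h) with hT
  have hTn : T * (2 * h) ≤ n := Nat.div_mul_le_self _ _
  have hTbig : 8 * h < T := by
    have : 8 * h + 2 ≤ T := by rw [hT, Nat.le_div_iff_mul_le (by omega)]; omega
    omega
  set Pos := (Finset.range n).filter (fun i => y i ∈ vs F) with hPos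
  have hPosc : Pos.card ≤ 8 * h := by
    have h1 : Pos.card ≤ (vs F).toFinset.card := by
      apply Finset.card_le_card_of_injOn y
      · intro i hi
        rw [Finset.mem_coe, hPos, Finset.mem_filter] at hi
        simpa using hi.2
      · intro i hi j hj hij
        rw [Finset.mem_coe, hPos, Finset.mem_filter, Finset.mem_range] at hi hj
        exact hinj i hi.1 j hj.1 hij
    have h2 := List.toFinset_card_le (vs F)
    rw [vs_len] at h2
    omega
  set Bad := Pos.image (fun i => i / (2 * h)) with hBad
  have hBadc : Bad.card ≤ 8 * h := Finset.card_image_le.trans hPosc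
  have hgood : ∀ i, i < n → i / (2 * h) ∉ Bad → y i ∉ vs F := by
    intro i hi hb hc
    exact hb (Finset.mem_image.2 ⟨i, by rw [hPos, Finset.mem_filter]; exact ⟨by simpa using hi, hc⟩, rfl⟩)
  have hblk : ∀ i a c k, a ≤ i → i ≤ c → a / (2 * h) = k → c / (2 * h) = k → i / (2 * h) = k := by
    intro i a c k h1 h2 h3 h4
    have := Nat.div_le_div_right (c := 2 * h) h1
    have := Nat.div_le_div_right (c := 2 * h) h2
    omega
  have hblk2 : ∀ i k, i / (2 * h) = k → 2 * h * k ≤ i ∧ i < 2 * h * k + 2 * h := by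
    intro i k hk
    have h1 := Nat.div_add_mod i (2 * h)
    have h2 := Nat.mod_lt i (show 0 < 2 * h by omega)
    rw [hk] at h1
    omega
  obtain ⟨k0, hk0T, hk0B⟩ : ∃ k0 ∈ Finset.range T, k0 ∉ Bad := by
    by_contra hc
    push Not at hc
    have := Finset.card_le_card (show Finset.range T ⊆ Bad from hc)
    rw [Finset.card_range] at this
    omega
  rw [Finset.mem_range] at hk0T
  set Q := (Finset.range h).image (fun j => 2 * h * k0 + 2 * j) with hQ
  have hQc : Q.card = h := by
    rw [hQ, Finset.card_image_of_injective, Finset.card_range]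
    intro a b hab; simp at hab; omega
  have hkT : 2 * h * k0 + 2 * h ≤ n := by
    have : (k0 + 1) * (2 * h) ≤ T * (2 * h) := Nat.mul_le_mul_right _ hk0T
    have e : (k0 + 1) * (2 * h) = 2 * h * k0 + 2 * h := by ring
    omega
  have hQm : ∀ i ∈ Q, i < n ∧ i / (2 * h) = k0 ∧ i % 2 = 0 := by
    intro i hi
    obtain ⟨j, hj, rfl⟩ := Finset.mem_image.1 hi
    rw [Finset.mem_range] at hj
    refine ⟨by omega, ?_, ?_⟩
    · rw [Nat.mul_add_div (by omega), Nat.div_eq_of_lt (by omega)]; omega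
    · have : 2 * h * k0 + 2 * j = 2 * (h * k0 + j) := by ring
      omega
  set Z0 := Finset.univ.filter (fun z => z ∉ l) with hZ0
  have hsplit : ∀ i, m ≤ 2 * ((Z0.filter (G.Adj (y i))).card + ((Finset.range n).filter (fun j => G.Adj (y i) (y j))).card) := by
    intro i
    refine (hdeg (y i)).trans (Nat.mul_le_mul_left _ ?_)
    have hs : Finset.univ.filter (G.Adj (y i)) ⊆ (Z0.filter (G.Adj (y i))) ∪
        ((Finset.range n).filter (fun j => G.Adj (y i) (y j))).image y := by
      intro x hx
      rw [Finset.mem_filter] at hx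
      rw [Finset.mem_union]
      by_cases hxl : x ∈ l
      · right
        obtain ⟨j, hj, rfl⟩ := hsurj x hxl
        exact Finset.mem_image.2 ⟨j, by simp [hj, hx.2], rfl⟩
      · left; simp [hZ0, hxl, hx.2]
    exact (Finset.card_le_card hs).trans ((Finset.card_union_le _ _).trans (Nat.add_le_add_left Finset.card_image_le _))
  set Q1 := Q.filter (fun i => m ≤ 4 * (Z0.filter (G.Adj (y i))).card) with hQ1
  set Q2 := Q.filter (fun i => ¬ m ≤ 4 * (Z0.filter (G.Adj (y i))).card) with hQ2
  have hQ12 : Q1.card + Q2.card = h := by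
    rw [← hQc]; exact Finset.card_filter_add_card_filter_not _
  have hQ1Q : ∀ i ∈ Q1, i ∈ Q := fun i hi => (Finset.mem_filter.1 hi).1
  have hQ2Q : ∀ i ∈ Q2, i ∈ Q := fun i hi => (Finset.mem_filter.1 hi).1
  rcases (show 512 * C ^ 2 ≤ Q1.card ∨ 512 * C ^ 2 ≤ Q2.card by omega) with hcase | hcase
  · -- external
    set Z := Z0.filter (fun z => z ∉ vs F) with hZ
    have hlow : ∀ i ∈ Q1, m ≤ 8 * (Z.filter (fun z => G.Adj (y i) z)).card := by
      intro i hi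
      have h1 := (Finset.mem_filter.1 hi).2
      have hs : Z0.filter (G.Adj (y i)) ⊆ Z.filter (fun z => G.Adj (y i) z) ∪ (vs F).toFinset := by
        intro x hx
        rw [Finset.mem_filter] at hx
        by_cases hxF : x ∈ vs F
        · simp [hxF]
        · simp [hZ, hx.1, hx.2, hxF]
      have h2 := (Finset.card_le_card hs).trans (Finset.card_union_le _ _)
      have h3 := List.toFinset_card_le (vs F)
      rw [vs_len] at h3
      omega
    have hsum : 64 * C ^ 2 * m ≤ ∑ i ∈ Q1, (Z.filter (fun z => G.Adj (y i) z)).card := by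
      have h1 : Q1.card * m ≤ ∑ i ∈ Q1, 8 * (Z.filter (fun z => G.Adj (y i) z)).card := by
        rw [← smul_eq_mul]; exact Finset.card_nsmul_le_sum _ _ _ hlow
      rw [← Finset.mul_sum] at h1
      have h2 : 512 * C ^ 2 * m ≤ Q1.card * m := Nat.mul_le_mul_right _ hcase
      have h3 : 512 * C ^ 2 * m = 8 * (64 * C ^ 2 * m) := by ring
      omega
    obtain ⟨a, b, c, z, z', ha, hb, hc, hab, hbc, hz, hz', hzz, e1, e2, e3, e4, e5, e6⟩ :=
      triple hC hh hm Q1 (by omega) Z ((Finset.card_le_univ _).trans hN) (fun i z => G.Adj (y i) z) hsum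
    simp only [hZ, hZ0, Finset.mem_filter, Finset.mem_univ, true_and] at hz hz'
    obtain ⟨a1, a2, a3⟩ := hQm a (hQ1Q a ha)
    obtain ⟨b1, b2, b3⟩ := hQm b (hQ1Q b hb)
    obtain ⟨c1, c2, c3⟩ := hQm c (hQ1Q c hc)
    obtain ⟨F', l', r1, r2, r3⟩ := op_ext_pos (w := u) hst hab hbc c1 hz.1 hz'.1 hzz hz.2 hz'.2
      (fun i h1 h2 => hgood i (by omega) (by rw [hblk i a c k0 h1 h2 a2 c2]; exact hk0B)) e1 e2 e3 e5 e6
    have := hblk2 a k0 a2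
    have := hblk2 c k0 c2
    refine ⟨F', l', c - a - 2, r1, r2, ?_, by omega, by omega, by omega⟩
    rw [Nat.even_iff]; omega
  · -- internal
    have hint : ∀ i ∈ Q2, m ≤ 4 * ((Finset.range n).filter (fun j => G.Adj (y i) (y j))).card := by
      intro i hi
      have h1 := (Finset.mem_filter.1 hi).2
      have h2 := hsplit i
      omega
    set Gd := (Finset.range n).filter (fun j => j / (2 * h) < T ∧ j / (2 * h) ∉ Bad ∧ j / (2 * h) ≠ k0) with hGd
    set BP := (Finset.range n).filter (fun j => ¬ (j / (2 * h) < T ∧ j / (2 * h) ∉ Bad ∧ j / (2 * h) ≠ k0)) with hBP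
    have hBPc : BP.card ≤ (2 * h) * (8 * h + 2) := by
      refine (Finset.card_le_mul_card_image_of_maps_to (f := fun j => j / (2 * h)) (t := insert T (insert k0 Bad))
        ?_ (2 * h) ?_).trans (Nat.mul_le_mul_left _ ?_)
      · intro j hj
        rw [hBP, Finset.mem_filter, Finset.mem_range] at hj
        have : j / (2 * h) ≤ T := Nat.div_le_div_right hj.1.le
        simp only [Finset.mem_coe, Finset.mem_insert]
        by_contra hc
        push Not at hc
        exact hj.2 ⟨by omega, hc.2.2, hc.2.1⟩
      · intro k hk
        have : BP.filter (fun j => j / (2 * h) = k) ⊆ Finset.Ico (2 * h * k) (2 * h * k + 2 * h) := by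
          intro j hj
          rw [Finset.mem_filter] at hj
          rw [Finset.mem_Ico]
          exact hblk2 j k hj.2
        have := Finset.card_le_card this
        rw [Nat.card_Ico] at this
        omega
      · have := Finset.card_insert_le T (insert k0 Bad)
        have := Finset.card_insert_le k0 Bad
        omega
    have hlow : ∀ i ∈ Q2, m ≤ 8 * (Gd.filter (fun j => G.Adj (y i) (y j))).card := by
      intro i hi
      have h1 := hint i hi
      have hs : (Finset.range n).filter (fun j => G.Adj (y i) (y j)) ⊆ Gd.filter (fun j => G.Adj (y i) (y j)) ∪ BP := by
        intro j hj
        rw [Finset.mem_filter] at hj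
        rw [Finset.mem_union, hGd, hBP, Finset.mem_filter, Finset.mem_filter, Finset.mem_filter]
        by_cases hb : (j / (2 * h) < T ∧ j / (2 * h) ∉ Bad ∧ j / (2 * h) ≠ k0)
        · exact Or.inl ⟨⟨hj.1, hb⟩, hj.2⟩
        · exact Or.inr ⟨hj.1, hb⟩
      have h2 := (Finset.card_le_card hs).trans (Finset.card_union_le _ _)
      have e : (8 * h + 2) * (2 * h) = (2 * h) * (8 * h + 2) := by ring
      omega
    set E := (Q2 ×ˢ Gd).filter (fun p => G.Adj (y p.1) (y p.2)) with hE
    have hEc : 64 * C ^ 2 * m ≤ E.card := by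
      have h0 : E.card = ∑ i ∈ Q2, (Gd.filter (fun j => G.Adj (y i) (y j))).card := by
        rw [hE, Finset.card_filter, Finset.sum_product]
        apply Finset.sum_congr rfl
        intro i hi
        rw [Finset.card_filter]
      have h1 : Q2.card * m ≤ ∑ i ∈ Q2, 8 * (Gd.filter (fun j => G.Adj (y i) (y j))).card := by
        rw [← smul_eq_mul]; exact Finset.card_nsmul_le_sum _ _ _ hlow
      rw [← Finset.mul_sum, ← h0] at h1
      have h2 : 512 * C ^ 2 * m ≤ Q2.card * m := Nat.mul_le_mul_right _ hcase
      have h3 : 512 * C ^ 2 * m = 8 * (64 * C ^ 2 * m) := by ring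
      omega
    obtain ⟨⟨k, ε⟩, hkε, hfib⟩ := Finset.exists_le_card_fiber_of_mul_le_card_of_maps_to
      (s := E) (t := Finset.range T ×ˢ Finset.range 2) (f := fun p => (p.2 / (2 * h), p.2 % 2)) (n := 65536 * C ^ 3)
      (by
        intro p hp
        simp only [hE, hGd, Finset.mem_filter, Finset.mem_product] at hp
        simp only [Finset.mem_product, Finset.mem_range]
        exact ⟨hp.1.2.2.1, Nat.mod_lt _ (by norm_num)⟩)
      ⟨(0, 0), by simp; omega⟩
      (by
        rw [Finset.card_product, Finset.card_range, Finset.card_range]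
        have h1 : T * 2 * (65536 * C ^ 3) = 64 * C * (T * (2 * h)) := by rw [hh]; ring
        have h2 : 64 * C * (T * (2 * h)) ≤ 64 * C * (C * m) := Nat.mul_le_mul_left _ (hTn.trans hnN)
        have h3 : 64 * C * (C * m) = 64 * C ^ 2 * m := by ring
        omega)
    set E1 := E.filter (fun p => (p.2 / (2 * h), p.2 % 2) = (k, ε)) with hE1
    set J := (Finset.range n).filter (fun j => j / (2 * h) = k ∧ j % 2 = ε) with hJ
    have hE1m : ∀ p ∈ E1, p.1 ∈ Q2 ∧ p.2 ∈ J ∧ G.Adj (y p.1) (y p.2) ∧ k ∉ Bad ∧ k ≠ k0 := by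
      intro p hp
      simp only [hE1, hE, hGd, Finset.mem_filter, Finset.mem_product, Prod.mk.injEq] at hp
      obtain ⟨⟨⟨p1, p2, p3, p4, p5⟩, p6⟩, p7, p8⟩ := hp
      refine ⟨p1, by rw [hJ, Finset.mem_filter]; exact ⟨p2, p7, p8⟩, p6, p7 ▸ p4, p7 ▸ p5⟩
    have hJc : J.card ≤ h := by
      have : J.card ≤ (Finset.range h).card := by
        apply Finset.card_le_card_of_injOn (fun j => (j - 2 * h * k) / 2)
        · intro j hj
          rw [Finset.mem_coe, hJ, Finset.mem_filter] at hj
          have := hblk2 j k hj.2.1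
          simp; omega
        · intro j hj j' hj' hjj
          rw [Finset.mem_coe, hJ, Finset.mem_filter] at hj hj'
          have h1 := hblk2 j k hj.2.1
          have h2 := hblk2 j' k hj'.2.1
          have e : 2 * h * k = 2 * (h * k) := by ring
          simp only at hjj
          omega
      simpa using this
    obtain ⟨a, b, c, z1, z2, z3, hab, hbc, hz, hz', e1, e2, e3, e4, e5⟩ :=
      c4dom (by omega) hh E1 Q2 J (fun p hp => ⟨(hE1m p hp).1, (hE1m p hp).2.1⟩) (by omega) hJc (2 * h * k0) (2 * h * k)
        (fun i hi => hblk2 i k0 (hQm i (hQ2Q i hi)).2.1)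
        (fun i hi => hblk2 i k (Finset.mem_filter.1 hi).2.1) hfib
    have f1 := hE1m _ e1
    have f2 := hE1m _ e2
    have f3 := hE1m _ e3
    have f4 := hE1m _ e4
    have f5 := hE1m _ e5
    simp only at f1 f2 f3 f4 f5
    have hkB := f1.2.2.2.1
    have hkk := f1.2.2.2.2
    obtain ⟨a1, a2, a3⟩ := hQm a (hQ2Q a f1.1)
    obtain ⟨c1, c2, c3⟩ := hQm c (hQ2Q c f5.1)
    have zz1 := f1.2.1
    have zz3 := f5.2.1
    rw [hJ, Finset.mem_filter, Finset.mem_range] at zz1 zz3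
    obtain ⟨z11, z12, z13⟩ := zz1
    obtain ⟨z31, z32, z33⟩ := zz3
    have b1 := hblk2 a k0 a2
    have b2 := hblk2 c k0 c2
    have b3 := hblk2 z1 k z12
    have b4 := hblk2 z3 k z32
    have g1 : ∀ i, a ≤ i → i ≤ c → y i ∉ vs F := fun i h1 h2 =>
      hgood i (by omega) (by rw [hblk i a c k0 h1 h2 a2 c2]; exact hk0B)
    have g2 : ∀ i, z1 ≤ i → i ≤ z3 → y i ∉ vs F := fun i h1 h2 =>
      hgood i (by omega) (by rw [hblk i z1 z3 k h1 h2 z12 z32]; exact hkB)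
    rcases Nat.lt_or_gt_of_ne hkk with hlt | hlt
    · have : 2 * h * (k + 1) ≤ 2 * h * k0 := Nat.mul_le_mul_left _ hlt
      rw [Nat.mul_add] at this
      obtain ⟨F', l', r1, r2, r3⟩ := op_int_pos (w := u) hst hz hz' (by omega) hab hbc c1 g2 g1
        f1.2.2.1.symm f3.2.2.1.symm f2.2.2.1.symm f4.2.2.1.symm f5.2.2.1.symm
      refine ⟨F', l', (c - a) + (z3 - z1) - 2, r1, r2, ?_, by omega, by omega, by omega⟩
      rw [Nat.even_iff]; omega
    · have : 2 * h * (k0 + 1) ≤ 2 * h * k := Nat.mul_le_mul_left _ hlt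
      rw [Nat.mul_add] at this
      obtain ⟨F', l', r1, r2, r3⟩ := op_int_pos (w := u) hst hab hbc (by omega) hz hz' z31 g1 g2
        f1.2.2.1 f2.2.2.1 f3.2.2.1 f4.2.2.1 f5.2.2.1
      refine ⟨F', l', (c - a) + (z3 - z1) - 2, r1, r2, ?_, by omega, by omega, by omega⟩
      rw [Nat.even_iff]; omega

theorem partI {C m h : ℕ} (hC : 5 ≤ C) (hh : h = 1024 * C ^ 2) (hm : 17280000000 * C ^ 9 ≤ m) (hme : Even m)
    (hN : Fintype.card V ≤ C * m) (hdeg : ∀ v, m ≤ 2 * (Finset.univ.filter (G.Adj v)).card)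
    {n : ℕ} (hne : Even n) (hn : m + 2 * h * (4 * h) ≤ n) (hcyc : HasCyc G.Adj n) : HasCyc G.Adj m := by
  obtain ⟨S, u, v, ⟨l0, k1, k2, k3, k4, -, k5⟩, huv⟩ := hcyc
  have h0 : St G u v [] l0 := ⟨k1, k2, k3, k4, by simp [vs], by simp⟩
  -- build up
  have hbuild : ∀ g, g ≤ 2 * h → ∃ F l, St G u v F l ∧ F.length = g ∧ Even l.length ∧ m + (2 * h - g) * (4 * h) ≤ l.length := by
    intro g hg
    induction g with
    | zero => exact ⟨[], l0, h0, rfl, k5 ▸ hne, by simpa [k5] using hn⟩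
    | succ g ih =>
      obtain ⟨F, l, a1, a2, a3, a4⟩ := ih (by omega)
      obtain ⟨F', l', d, b1, b2, b3, b4, b5, b6⟩ := op hC hh hm hN hdeg a1 (by omega) (by omega)
      refine ⟨F', l', b1, by omega, ?_, ?_⟩
      · rw [Nat.even_iff] at *; omega
      · have e : 2 * h - g = (2 * h - (g + 1)) + 1 := by omega
        rw [e, Nat.add_mul] at a4
        omega
  obtain ⟨F, l, a1, a2, a3, a4⟩ := hbuild (2 * h) le_rfl
  have hdesc : ∀ N, ∀ F l, St G u v F l → F.length = 2 * h → Even l.length → m ≤ l.length → l.length ≤ m + N →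
      HasCyc G.Adj m := by
    intro N
    induction N with
    | zero =>
      intro F l a1 a2 a3 a4 a5
      have e : l.length = m := by omega
      rw [← e]; exact a1.cyc huv 0 (by omega)
    | succ N ih =>
      intro F l a1 a2 a3 a4 a5
      by_cases e : l.length = m
      · rw [← e]; exact a1.cyc huv 0 (by omega)
      obtain ⟨F', l', d, b1, b2, b3, b4, b5, b6⟩ := op hC hh hm hN hdeg a1 (by omega) a4
      by_cases hl : m ≤ l'.length
      · cases F' with
        | nil => simp at b2
        | cons q F' =>
          refine ih F' l' b1.pop (by simp at b2; omega) ?_ hl (by omega)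
          rw [Nat.even_iff] at *; omega
      · have := b1.cyc huv ((m - l'.length) / 2) (by omega)
        convert this using 1
        rw [Nat.even_iff] at *; omega
  exact hdesc _ F l a1 a2 a3 (by omega) (by omega : l.length ≤ m + l.length)

end ops


theorem rotate_cyc2 {V : Type*} [DecidableEq V] {r : V → V → Prop} (hr : ∀ x y, r x y → r y x) {S : Finset V} {n : ℕ} {a b c : V}
    (h : HP r S n a b) (hba : r b a) (hc : c ∈ S) : ∃ d, HP r S n c d ∧ r d c := by
  obtain ⟨S1, n1, S2, n2, h1, h2, h3, h4, h5⟩ := h.split hc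
  rcases (h1.symm hr).tail with ⟨e1, e2, e3⟩ | ⟨d, m, e1, e2, e3⟩
  · subst e2; exact ⟨b, h, hba⟩
  · have h6 := h2.append (e3.symm hr) hba (by
      rw [Finset.disjoint_left]
      intro x hx hx'
      have h7 := Finset.mem_erase.1 hx'
      have : x ∈ S1 ∩ S2 := Finset.mem_inter.2 ⟨h7.2, hx⟩
      rw [h3] at this
      exact h7.1 (by simpa using this))
    have hS : S2 ∪ S1.erase c = S := by
      have := h2.left
      rw [← h4]
      ext x
      simp only [Finset.mem_union, Finset.mem_erase]
      by_cases hx : x = c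
      · subst hx; simp [this]
      · simp [hx]; exact or_comm
    rw [hS] at h6
    have hn : n2 + m = n := by omega
    rw [hn] at h6
    exact ⟨d, h6, hr _ _ e2⟩

section ham
variable {U : Type*} [Fintype U] [DecidableEq U]

open Classical in
theorem ham_complete (H : SimpleGraph U) (hn : 3 ≤ Fintype.card U) (hH : ∀ x y, x ≠ y → H.Adj x y) :
    HasCyc H.Adj (Fintype.card U) := by
  have hl : (Finset.univ : Finset U).toList.length = Fintype.card U := by simp
  have hnd : (Finset.univ : Finset U).toList.Nodup := Finset.nodup_toList _
  generalize hL : (Finset.univ : Finset U).toList = L at hl hnd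
  have hne : L ≠ [] := by rintro rfl; simp at hl; omega
  have hp : HP H.Adj L.toFinset (Fintype.card U) (L.head hne) (L.getLast hne) := by
    refine ⟨L, hnd, ?_, List.head?_eq_some_head hne, List.getLast?_eq_some_getLast hne, rfl, hl⟩
    exact (List.Pairwise.imp (fun h => hH _ _ h) hnd).isChain
  exact ⟨_, _, _, hp, hH _ _ (hp.ne (by omega)).symm⟩

open Classical in
theorem ham_cross (H : SimpleGraph U) (hno : ¬ HasCyc H.Adj (Fintype.card U)) {u v : U}
    (h : HP H.Adj Finset.univ (Fintype.card U) u v) :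
    (Finset.univ.filter (H.Adj u)).card + (Finset.univ.filter (H.Adj v)).card + 1 ≤ Fintype.card U := by
  have hpos := h.pos
  set n := Fintype.card U with hn
  obtain ⟨y, hy, y0, yn, hS⟩ := h.toFun
  have hsurj : ∀ x, ∃ i, i < n ∧ y i = x := by
    intro x
    have : x ∈ (Finset.range n).image y := by rw [← hS]; simp
    obtain ⟨i, hi, h2⟩ := Finset.mem_image.1 this
    exact ⟨i, by simpa using hi, h2⟩
  set A := (Finset.range (n - 1)).filter (fun j => H.Adj u (y (j + 1))) with hA
  set B := (Finset.range (n - 1)).filter (fun j => H.Adj v (y j)) with hB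
  have hAB : Disjoint A B := by
    rw [Finset.disjoint_left]
    intro j hj hj'
    rw [hA, Finset.mem_filter, Finset.mem_range] at hj
    rw [hB, Finset.mem_filter] at hj'
    have p1 := (hy.up (Nat.zero_le j) (by omega)).append
      (hy.down (fun x y h => h.symm) (a := j + 1) (b := n - 1) (by omega) le_rfl) (by
        show H.Adj (y j) (y (n - 1)); rw [yn]; exact hj'.2.symm) (by
        rw [Finset.disjoint_left]; intro x hx hx'; simp at hx hx'; omega)
    have p2 := hy.map p1 (by intro i hi; simp at hi; omega)
    have e : j + 1 - 0 + (n - 1 + 1 - (j + 1)) = n := by omega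
    rw [e] at p2
    exact hno ⟨_, _, _, p2, by rw [y0]; exact hj.2.symm⟩
  have hc1 : (Finset.univ.filter (H.Adj u)).card ≤ A.card := by
    have : Finset.univ.filter (H.Adj u) ⊆ A.image (fun j => y (j + 1)) := by
      intro x hx
      rw [Finset.mem_filter] at hx
      obtain ⟨i, hi, rfl⟩ := hsurj x
      rcases Nat.eq_zero_or_pos i with rfl | hi0
      · rw [y0] at hx; exact absurd hx.2 (H.loopless.irrefl u)
      · refine Finset.mem_image.2 ⟨i - 1, ?_, by simp [show i - 1 + 1 = i by omega]⟩
        rw [hA, Finset.mem_filter, Finset.mem_range, show i - 1 + 1 = i by omega]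
        exact ⟨by omega, hx.2⟩
    exact (Finset.card_le_card this).trans Finset.card_image_le
  have hc2 : (Finset.univ.filter (H.Adj v)).card ≤ B.card := by
    have : Finset.univ.filter (H.Adj v) ⊆ B.image y := by
      intro x hx
      rw [Finset.mem_filter] at hx
      obtain ⟨i, hi, rfl⟩ := hsurj x
      have : i ≠ n - 1 := by
        rintro rfl
        rw [yn] at hx; exact absurd hx.2 (H.loopless.irrefl v)
      refine Finset.mem_image.2 ⟨i, ?_, rfl⟩
      rw [hB, Finset.mem_filter, Finset.mem_range]
      exact ⟨by omega, hx.2⟩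
    exact (Finset.card_le_card this).trans Finset.card_image_le
  have h3 : A.card + B.card ≤ n - 1 := by
    rw [← Finset.card_union_of_disjoint hAB]
    have : A ∪ B ⊆ Finset.range (n - 1) := Finset.union_subset (Finset.filter_subset _ _) (Finset.filter_subset _ _)
    simpa using Finset.card_le_card this
  omega

open Classical in
theorem ham_path (H H' : SimpleGraph U) (hn : 3 ≤ Fintype.card U) (hno : ¬ HasCyc H.Adj (Fintype.card U)) {u v : U}
    (hH : ∀ x y, H'.Adj x y → H.Adj x y ∨ (x = u ∧ y = v) ∨ (x = v ∧ y = u))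
    (hc : HasCyc H'.Adj (Fintype.card U)) : HP H.Adj Finset.univ (Fintype.card U) u v := by
  obtain ⟨S, a, b, h1, h2⟩ := hc
  have hS : S = Finset.univ := by rw [← Finset.card_eq_iff_eq_univ]; exact h1.card
  obtain ⟨d, h3, h4⟩ := rotate_cyc2 (fun x y h => h.symm) h1 h2 (c := u) (by rw [hS]; simp)
  rcases h3.tail with ⟨-, -, h5⟩ | ⟨c, k, hk, h5, h6⟩
  · omega
  have h7 : HP H.Adj (S.erase u) k c d := by
    have := h6.map (r := H.Adj) id (Function.injective_id.injOn) (by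
      intro x hx y hy hxy
      rcases hH x y hxy with h | h | h
      · exact h
      · rw [h.1] at hx; simp at hx
      · rw [h.2] at hy; simp at hy)
    simpa using this
  have hcd := h7.ne (by omega)
  have hins : insert u (S.erase u) = Finset.univ := by rw [Finset.insert_erase (by rw [hS]; simp), hS]
  have hcu := h7.left
  have hdu := h7.right
  simp at hcu hdu
  by_cases hd : d = v
  · subst hd
    have h8 : H.Adj u c := by
      rcases hH u c h5 with h | h | h
      · exact h
      · exact absurd h.2 hcd
      · exact absurd h.2 hcu.1
    have := h7.cons h8 (by simp)
    rw [hins, ← hk] at this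
    exact this
  · have h9 : H.Adj d u := by
      rcases hH d u h4 with h | h | h
      · exact h
      · exact absurd h.1 hdu.1
      · exact absurd h.1 hd
    by_cases hcv : c = v
    · subst hcv
      have := (h7.symm (fun x y h => h.symm)).cons h9.symm (by simp)
      rw [hins, ← hk] at this
      exact this
    · exfalso
      have h8 : H.Adj u c := by
        rcases hH u c h5 with h | h | h
        · exact h
        · exact absurd h.2 hcv
        · exact absurd h.2 hcu.1
      have := h7.cons h8 (by simp)
      rw [← hk] at this
      exact hno ⟨_, _, _, this, h9⟩

open Classical in
theorem ham (G : SimpleGraph U) (A : Finset U) (hn : 3 ≤ Fintype.card U)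
    (h1 : ∀ v ∈ A, Fintype.card U ≤ 2 * (Finset.univ.filter (G.Adj v)).card)
    (h2 : ∀ w, w ∉ A → Fintype.card U + 1 ≤ A.card + (Finset.univ.filter (G.Adj w)).card) :
    HasCyc G.Adj (Fintype.card U) := by
  by_contra hno
  obtain ⟨H, hGH, hmax⟩ := (Set.toFinite {H : SimpleGraph U | ¬ HasCyc H.Adj (Fintype.card U)}).exists_le_maximal
    (show G ∈ _ from hno)
  have hHno : ¬ HasCyc H.Adj (Fintype.card U) := hmax.1
  have hmono : ∀ v, (Finset.univ.filter (G.Adj v)).card ≤ (Finset.univ.filter (H.Adj v)).card := by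
    intro v
    apply Finset.card_le_card
    intro x hx
    rw [Finset.mem_filter] at hx ⊢
    exact ⟨hx.1, hGH hx.2⟩
  have key : ∀ u v, u ≠ v → ¬ H.Adj u v →
      (Finset.univ.filter (H.Adj u)).card + (Finset.univ.filter (H.Adj v)).card + 1 ≤ Fintype.card U := by
    intro u v huv hadj
    have hc : HasCyc (H ⊔ SimpleGraph.edge u v).Adj (Fintype.card U) := by
      by_contra hc
      have := hmax.2 (show H ⊔ SimpleGraph.edge u v ∈ _ from hc) le_sup_left
      apply hadj
      apply this
      simp [SimpleGraph.edge_adj, huv]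
    refine ham_cross H hHno (ham_path H _ hn hHno ?_ hc)
    intro x y hxy
    rw [SimpleGraph.sup_adj, SimpleGraph.edge_adj] at hxy
    rcases hxy with h | h
    · exact Or.inl h
    · right; rcases h.1 with h | h
      · exact Or.inl h
      · exact Or.inr h
  have hAA : ∀ u ∈ A, ∀ v ∈ A, u ≠ v → H.Adj u v := by
    intro u hu v hv huv
    by_contra hc
    have := key u v huv hc
    have := h1 u hu
    have := h1 v hv
    have := hmono u
    have := hmono v
    omega
  have hAB : ∀ u ∈ A, ∀ w, w ∉ A → H.Adj u w := by
    intro u hu w hw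
    by_contra hc
    have := key u w (by rintro rfl; exact hw hu) hc
    have := h2 w hw
    have := hmono w
    have hs : A.erase u ⊆ Finset.univ.filter (H.Adj u) := by
      intro x hx
      rw [Finset.mem_erase] at hx
      simp [hAA u hu x hx.2 (Ne.symm hx.1)]
    have := Finset.card_le_card hs
    rw [Finset.card_erase_of_mem hu] at this
    omega
  apply hHno
  apply ham_complete H hn
  intro x y hxy
  by_cases hx : x ∈ A
  · by_cases hy : y ∈ A
    · exact hAA x hx y hy hxy
    · exact hAB x hx y hy
  · by_cases hy : y ∈ A
    · exact (hAB y hy x hx).symm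
    · by_contra hc
      have := key x y hxy hc
      have := h2 y hy
      have := hmono y
      have hs : A ⊆ Finset.univ.filter (H.Adj x) := by
        intro z hz
        simp [(hAB z hz x hx).symm]
      have := Finset.card_le_card hs
      omega

end ham


theorem hp_walk {V : Type*} [DecidableEq V] {R : SimpleGraph V} {n : ℕ} : ∀ {S : Finset V} {a b : V},
    HP R.Adj S n a b → ∃ p : R.Walk a b, p.IsPath ∧ p.length + 1 = n ∧ ∀ x, x ∈ p.support → x ∈ S := by
  induction n with
  | zero => intro S a b h; have := h.pos; omega
  | succ n ih =>
    intro S a b h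
    rcases h.tail with ⟨h1, rfl, h2⟩ | ⟨c, k, hk, h1, h2⟩
    · refine ⟨SimpleGraph.Walk.nil, by simp, by simpa using h2.symm, ?_⟩
      intro x hx; rw [h1]; simpa using hx
    · have hkn : k = n := by omega
      subst hkn
      obtain ⟨p, p1, p2, p3⟩ := ih h2
      refine ⟨SimpleGraph.Walk.cons h1 p, ?_, by simpa using p2, ?_⟩
      · rw [SimpleGraph.Walk.cons_isPath_iff]
        exact ⟨p1, fun hx => by have := p3 _ hx; simp at this⟩
      · intro x hx
        rw [SimpleGraph.Walk.support_cons, List.mem_cons] at hx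
        rcases hx with rfl | hx
        · exact h.left
        · exact Finset.mem_of_mem_erase (p3 x hx)

theorem hasCycleLen_of {V : Type*} [DecidableEq V] {R : SimpleGraph V} {n : ℕ} (hn : 3 ≤ n)
    (h : HasCyc R.Adj n) : HasCycleLen R n := by
  obtain ⟨S, a, b, h1, h2⟩ := h
  rcases h1.tail with ⟨-, -, h3⟩ | ⟨c, k, hk, h4, h5⟩
  · omega
  obtain ⟨p, p1, p2, p3⟩ := hp_walk h5
  have ha : a ∉ p.support := fun hx => by have := p3 _ hx; simp at this
  have hcb := h5.ne (by omega)
  refine ⟨b, SimpleGraph.Walk.cons h2 (SimpleGraph.Walk.cons h4 p), ?_, ?_⟩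
  · rw [SimpleGraph.Walk.cons_isCycle_iff, SimpleGraph.Walk.cons_isPath_iff]
    refine ⟨⟨p1, ha⟩, ?_⟩
    rw [SimpleGraph.Walk.edges_cons, List.mem_cons, not_or]
    refine ⟨?_, fun hx => ha (p.snd_mem_support_of_mem_edges hx)⟩
    intro he
    rw [Sym2.eq_iff] at he
    rcases he with he | he
    · exact h2.ne he.1
    · exact hcb he.1.symm
  · simp; omega

section asm
variable {V : Type*} [Fintype V] [DecidableEq V] (R : SimpleGraph V) [DecidableRel R.Adj]

theorem sub_card (X : Finset V) (v : V) (p : V → Prop) [DecidablePred p] :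
    ((Finset.univ : Finset {x // x ∈ X}).filter (fun x => p x.1)).card = (X.filter p).card := by
  rw [← Finset.card_image_of_injective _ Subtype.val_injective]
  congr 1
  ext x
  simp only [Finset.mem_image, Finset.mem_filter, Finset.mem_univ, true_and, Subtype.exists]
  constructor
  · rintro ⟨a, ha, hp, rfl⟩; exact ⟨ha, hp⟩
  · rintro ⟨ha, hp⟩; exact ⟨x, ha, hp, rfl⟩

theorem sub_cyc {R : SimpleGraph V} (X : Finset V) {n : ℕ}
    (h : HasCyc (R.comap (Subtype.val : {x // x ∈ X} → V)).Adj n) : HasCyc R.Adj n := by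
  obtain ⟨S, a, b, h1, h2⟩ := h
  exact ⟨_, _, _, h1.map (r := R.Adj) Subtype.val Subtype.val_injective.injOn (fun x _ y _ h => h), h2⟩

theorem ham_sub {X B : Finset V} (hBX : B ⊆ X) (hn : 3 ≤ X.card)
    (h1 : ∀ v ∈ B, X.card ≤ 2 * (X.filter (R.Adj v)).card)
    (h2 : ∀ w ∈ X, w ∉ B → X.card + 1 ≤ B.card + (X.filter (R.Adj w)).card) : HasCyc R.Adj X.card := by
  have hc : Fintype.card {x // x ∈ X} = X.card := Fintype.card_coe X
  have hd : ∀ v : {x // x ∈ X}, (Finset.univ.filter ((R.comap (Subtype.val : {x // x ∈ X} → V)).Adj v)).card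
      = (X.filter (R.Adj v.1)).card := fun v => sub_card X v.1 (R.Adj v.1)
  have hB : (Finset.univ.filter (fun x : {x // x ∈ X} => x.1 ∈ B)).card = B.card := by
    have hX : X.Nonempty := Finset.card_pos.1 (by omega)
    obtain ⟨v, hv⟩ := hX
    rw [sub_card X v (fun x => x ∈ B)]
    congr 1
    ext x
    rw [Finset.mem_filter]
    exact ⟨fun h => h.2, fun h => ⟨hBX h, h⟩⟩
  apply sub_cyc X
  have := ham (R.comap (Subtype.val : {x // x ∈ X} → V)) (Finset.univ.filter (fun x : {x // x ∈ X} => x.1 ∈ B))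
    (by omega) (by
      intro v hv
      have h3 := h1 v.1 (Finset.mem_filter.1 hv).2
      have h4 := hd v
      rw [hc]
      convert h3 using 2
      rw [← h4]; congr!) (by
      intro w hw
      have h3 := h2 w.1 w.2 (fun h => hw (by simp [h]))
      have h4 := hd w
      rw [hc, hB]
      convert h3 using 2
      rw [← h4]; congr!)
  rw [hc] at this
  exact this

theorem c2_sub {A : Finset V} (h : TwoConnectedOn R A) : C2 (R.comap (Subtype.val : {x // x ∈ A} → V)) := by
  rintro c Q ⟨x, hx⟩ hc ⟨w, hwQ, hwc⟩
  have hcon := h.2.2 c.1 c.2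
  have hxc : x ≠ c := by rintro rfl; exact hc hx
  have hx' : x.1 ∈ ((A.erase c.1 : Finset V) : Set V) := by
    simp only [Finset.coe_erase, Set.mem_diff, Finset.mem_coe, Set.mem_singleton_iff]
    exact ⟨x.2, fun h => hxc (Subtype.ext h)⟩
  have hw' : w.1 ∈ ((A.erase c.1 : Finset V) : Set V) := by
    simp only [Finset.coe_erase, Set.mem_diff, Finset.mem_coe, Set.mem_singleton_iff]
    exact ⟨w.2, fun h => hwc (Subtype.ext h)⟩
  obtain ⟨p⟩ := hcon.preconnected ⟨x.1, hx'⟩ ⟨w.1, hw'⟩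
  obtain ⟨d, hd, h1, h2⟩ := p.exists_boundary_dart {z | ∃ q ∈ Q, q.1 = z.1} ⟨x, hx, rfl⟩ (by
    rintro ⟨q, hq, hqw⟩
    exact hwQ ((Subtype.ext hqw : q = w) ▸ hq))
  obtain ⟨q, hq, hq1⟩ := h1
  have hy := d.snd.2
  simp only [Finset.coe_erase, Set.mem_diff, Finset.mem_coe, Set.mem_singleton_iff] at hy
  refine ⟨q, hq, ⟨d.snd.1, hy.1⟩, fun h => h2 ⟨_, h, rfl⟩, fun h => hy.2 (congrArg Subtype.val h), ?_⟩
  have := d.adj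
  simp only [SimpleGraph.comap_adj] at this ⊢
  rw [hq1]; exact this

end asm

theorem stmt12 (V : Type*) [Fintype V] [DecidableEq V]
    (R : SimpleGraph V) [DecidableRel R.Adj]
    (s t k : ℕ) (hs : 2 ≤ s) (ht : 2 ≤ t) (hk : 3 ≤ k)
    (hks : k ≤ s) (hstk : s ≤ t + k)
    (W : Finset V) (Vp : Fin s → Finset V)
    (hWcard : W.card ≤ s - 1)
    (hdisjWV : ∀ i, Disjoint W (Vp i))
    (hdisjVV : ∀ i j, i ≠ j → Disjoint (Vp i) (Vp j))
    (hcover : ∀ v : V, v ∈ W ∨ ∃ i, v ∈ Vp i)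
    (hnoedge : ∀ i j, i ≠ j → ∀ x ∈ Vp i, ∀ y ∈ Vp j, ¬ R.Adj x y)
    (h2conn : ∀ i, TwoConnectedOn R (Vp i))
    (m : ℕ) (hmEven : Even m) (hm : 17280000000 * (t + k) ^ 9 ≤ m)
    (hnoCm : ¬ HasCycleLen R m)
    (hcardV : Fintype.card V ≤ (t + k) * m)
    (hdeg : m + 24000000 * (t + k) ^ 5 + 2 * s < 2 * R.minDegree) :
    ∀ i, (Vp i ∪ bigNbrSet R s W (Vp i)).card ≤ m - 1 := by
  intro i
  by_contra hcon
  push Not at hcon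
  set A := Vp i with hA
  obtain ⟨C, hCdef⟩ : ∃ C, C = t + k := ⟨_, rfl⟩
  rw [← hCdef] at hm hcardV hdeg hstk
  have hC : 5 ≤ C := by omega
  obtain ⟨h, hh⟩ : ∃ h, h = 1024 * C ^ 2 := ⟨_, rfl⟩
  have hhh : h * h = 1048576 * C ^ 4 := by rw [hh]; ring
  have hc4 : 1 ≤ C ^ 4 := Nat.one_le_pow _ _ (by omega)
  have hc5 : 5 * C ^ 4 ≤ C ^ 5 := by
    have : C ^ 5 = C * C ^ 4 := by ring
    rw [this]; exact Nat.mul_le_mul_right _ hC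
  have hc9 : 1 ≤ C ^ 9 := Nat.one_le_pow _ _ (by omega)
  have hm3 : 3 ≤ m := by omega
  have hno : ¬ HasCyc R.Adj m := fun hc => hnoCm (hasCycleLen_of hm3 hc)
  have hdegv : ∀ v, R.minDegree ≤ (Finset.univ.filter (R.Adj v)).card := by
    intro v
    have := R.minDegree_le_degree v
    rw [← SimpleGraph.card_neighborFinset_eq_degree, SimpleGraph.neighborFinset_eq_filter] at this
    exact this
  have hdA : ∀ v ∈ A, R.minDegree ≤ (A.filter (R.Adj v)).card + (s - 1) := by
    intro v hv
    refine (hdegv v).trans ?_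
    have hs' : Finset.univ.filter (R.Adj v) ⊆ A.filter (R.Adj v) ∪ W := by
      intro x hx
      rw [Finset.mem_filter] at hx
      rw [Finset.mem_union, Finset.mem_filter]
      rcases hcover x with hxW | ⟨j, hj⟩
      · exact Or.inr hxW
      · by_cases hij : i = j
        · subst hij; exact Or.inl ⟨hj, hx.2⟩
        · exact absurd hx.2 (hnoedge i j hij v hv x hj)
    exact (Finset.card_le_card hs').trans ((Finset.card_union_le _ _).trans (Nat.add_le_add_left hWcard _))
  by_cases hbig : m + 8 * (h * h) + 12 ≤ A.card
  · -- large part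
    obtain ⟨m', hm'⟩ := hmEven
    have hE := theoremE (G := R.comap (Subtype.val : {x // x ∈ A} → V)) (c2_sub R (h2conn i))
      (δ := m' + 4 * (h * h) + 6) (by omega) (by
        intro v
        have h3 := hdA v.1 v.2
        have h4 : (Finset.univ.filter ((R.comap (Subtype.val : {x // x ∈ A} → V)).Adj v)).card
          = (A.filter (R.Adj v.1)).card := sub_card A v.1 (R.Adj v.1)
        rw [h4]; omega) (by rw [Fintype.card_coe]; omega)
    obtain ⟨n, n1, n2, n3⟩ := hE
    have e : 2 * h * (4 * h) = 8 * (h * h) := by ring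
    exact hno (partI (G := R) hC hh hm ⟨m', hm'⟩ hcardV (fun v => by have := hdegv v; omega) n1 (by omega) (sub_cyc A n3))
  · by_cases hmA : m ≤ A.card
    · obtain ⟨X, hXA, hXc⟩ := Finset.exists_subset_card_eq hmA
      apply hno
      rw [← hXc]
      refine ham_sub R (B := X) (le_refl X) (by omega) ?_ (fun w h1 h2 => absurd h1 h2)
      intro v hv
      have h3 := hdA v (hXA hv)
      have hs' : A.filter (R.Adj v) ⊆ X.filter (R.Adj v) ∪ (A \ X) := by
        intro x hx
        rw [Finset.mem_filter] at hx
        rw [Finset.mem_union, Finset.mem_filter, Finset.mem_sdiff]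
        by_cases hxX : x ∈ X
        · exact Or.inl ⟨hxX, hx.2⟩
        · exact Or.inr ⟨hx.1, hxX⟩
      have h4 := (Finset.card_le_card hs').trans (Finset.card_union_le _ _)
      rw [Finset.card_sdiff_of_subset hXA] at h4
      omega
    · obtain ⟨X, hAX, hXU, hXc⟩ := Finset.exists_subsuperset_card_eq
        (Finset.subset_union_left : A ⊆ A ∪ bigNbrSet R s W A) (n := m) (by omega) (by omega)
      apply hno
      rw [← hXc]
      have hmono : ∀ v, (A.filter (R.Adj v)).card ≤ (X.filter (R.Adj v)).card := fun v =>
        Finset.card_le_card (Finset.filter_subset_filter _ hAX)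
      have hbc : (bigNbrSet R s W A).card ≤ s - 1 := (Finset.card_filter_le _ _).trans hWcard
      have hUc := Finset.card_union_le A (bigNbrSet R s W A)
      refine ham_sub R hAX (by omega) ?_ ?_
      · intro v hv
        have := hdA v hv
        have := hmono v
        omega
      · intro w hw hwA
        have hwb : w ∈ bigNbrSet R s W A := by
          rcases Finset.mem_union.1 (hXU hw) with h | h
          · exact absurd h hwA
          · exact h
        have h3 : 2 * s ≤ (A.filter (R.Adj w)).card := (Finset.mem_filter.1 hwb).2
        have := hmono w
        omega
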